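/- Let k be a field, let N and c be positive integers with c ≤ N−1, and let f_1, …, f_c be homogeneous polynomials in k[X_0,…,X_N] of degrees d_1,…,d_c with d_1+⋯+d_c ≥ N+1. Let X ⊆ ℙ^N_k be the closed subscheme cut out by the homogeneous ideal (f_1,…,f_c), and assume X is geometrically integral of dimension N−c ≥ 1 and smooth over k (equivalently, for every point a ∈ k̄^{N+1}∖{0} with f_1(a)=⋯=f_c(a)=0, the Jacobian matrix ((∂f_i/∂X_j)(a)) has rank c). Then the separable covering gonality of the function field K(X) of X over k satisfies scvg_k(K(X)) ≥ d_1+⋯+d_c − N + 1. -/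

import Mathlib

set_option linter.unusedSectionVars false
set_option linter.unusedSimpArgs false
set_option linter.unusedVariables false

universe u v

/-- `K` is an algebraic function field over `k`, i.e. a finitely generated field extension. -/
def IsAlgFunctionField (k : Type u) (K : Type v) [Field k] [Field K] [Algebra k K] : Prop :=
  (⊤ : IntermediateField k K).FG

/-- There is a covering diagram for `K/k` of degree `e`: algebraic function fields `K_B`, `K_C`
over `k`, a `k`-algebra embedding `K ↪ K_C` which is module-finite, and a `k`-algebra embedding
`K_B(t) ↪ K_C` with `[K_C : K_B(t)] = e`. -/
def HasSepCvgDiagram (k : Type u) (K : Type v) [Field k] [Field K] [Algebra k K] (e : ℕ) :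
    Prop :=
  ∃ (K_B K_C : Type (max u v)) (_ : Field K_B) (_ : Field K_C)
    (_ : Algebra k K_B) (_ : Algebra k K_C),
    IsAlgFunctionField k K_B ∧ IsAlgFunctionField k K_C ∧
    ∃ (f : K →ₐ[k] K_C) (π : RatFunc K_B →ₐ[k] K_C),
      f.toRingHom.Finite ∧
      (letI := f.toRingHom.toAlgebra
       Algebra.IsSeparable K K_C) ∧
      (letI := π.toRingHom.toAlgebra
       Module.finrank (RatFunc K_B) K_C = e)

/-- The separable covering gonality of `K` over `k`. -/
noncomputable def scvg (k : Type u) (K : Type v) [Field k] [Field K] [Algebra k K] : ℕ :=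
  sInf {e : ℕ | 0 < e ∧ HasSepCvgDiagram k K e}

/-- The function field `K(X)` of `X = Proj (k[X_0,…,X_N] ⧸ I)` for a homogeneous prime `I`:
the subfield of the fraction field of the homogeneous coordinate ring consisting of ratios of
(images of) homogeneous polynomials of the same degree. -/
noncomputable def projFunctionField (k : Type u) [Field k] (n : ℕ)
    (I : Ideal (MvPolynomial (Fin n) k)) [I.IsPrime] :
    IntermediateField k (FractionRing (MvPolynomial (Fin n) k ⧸ I)) :=
  IntermediateField.adjoin k
    { x | ∃ (p q : MvPolynomial (Fin n) k) (m : ℕ), p.IsHomogeneous m ∧ q.IsHomogeneous m ∧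
        algebraMap (MvPolynomial (Fin n) k ⧸ I) (FractionRing (MvPolynomial (Fin n) k ⧸ I))
          (Ideal.Quotient.mk I q) ≠ 0 ∧
        x = algebraMap (MvPolynomial (Fin n) k ⧸ I) (FractionRing (MvPolynomial (Fin n) k ⧸ I))
              (Ideal.Quotient.mk I p) /
            algebraMap (MvPolynomial (Fin n) k ⧸ I) (FractionRing (MvPolynomial (Fin n) k ⧸ I))
              (Ideal.Quotient.mk I q) }

universe w


/-! ### PB1 -/

section

/-- monomial -/
def pmon {L : Type*} [Field L] {n : ℕ} (y : Fin n → L) (a : Fin n → ℕ) : L := ∏ i, y i ^ a i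

section PB
variable {p : ℕ} [hp : Fact p.Prime] {L : Type*} [Field L] [CharP L p] {n : ℕ}

lemma pmon_add (y : Fin n → L) (a b : Fin n → ℕ) : pmon y (a + b) = pmon y a * pmon y b := by
  simp [pmon, pow_add, Finset.prod_mul_distrib]

lemma pmon_mul (y : Fin n → L) (a : Fin n → ℕ) (m : ℕ) :
    pmon y (fun i => m * a i) = pmon y a ^ m := by
  simp only [pmon, ← Finset.prod_pow]
  exact Finset.prod_congr rfl fun i _ => by rw [mul_comm, pow_mul]

lemma pmon_zero (y : Fin n → L) : pmon y 0 = 1 := by simp [pmon]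

/-- the sum `∑ c_α^p y^α`. -/
noncomputable def psum (p : ℕ) {L : Type*} [Field L] {n : ℕ} (y : Fin n → L) (c : (Fin n → Fin p) → L) : L :=
  ∑ α, c α ^ p * pmon y (fun i => (α i : ℕ))

def PIndep (p : ℕ) {L : Type*} [Field L] {n : ℕ} (y : Fin n → L) : Prop := ∀ c : (Fin n → Fin p) → L, psum p y c = 0 → c = 0
def PSpan (p : ℕ) {L : Type*} [Field L] {n : ℕ} (y : Fin n → L) : Prop := ∀ g : L, ∃ c : (Fin n → Fin p) → L, g = psum p y c

structure IsPB (p : ℕ) {L : Type*} [Field L] {n : ℕ} (y : Fin n → L) : Prop where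
  indep : PIndep p y
  span : PSpan p y

lemma psum_add (y : Fin n → L) (c d : (Fin n → Fin p) → L) :
    psum p y (c + d) = psum p y c + psum p y d := by
  simp only [psum, Pi.add_apply, add_pow_char, add_mul, Finset.sum_add_distrib]

lemma psum_smul (y : Fin n → L) (a : L) (c : (Fin n → Fin p) → L) :
    psum p y (a • c) = a ^ p * psum p y c := by
  simp only [psum, Pi.smul_apply, smul_eq_mul, mul_pow, Finset.mul_sum, mul_assoc]

lemma psum_neg (y : Fin n → L) (c : (Fin n → Fin p) → L) :
    psum p y (-c) = - psum p y c := by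
  have h := psum_add y c (-c)
  have h0 : psum p y (0 : (Fin n → Fin p) → L) = 0 := by
    simp [psum, hp.out.ne_zero]
  rw [add_neg_cancel, h0] at h
  linear_combination -h

/-- reduce an exponent mod p -/
def pmod (p : ℕ) [hp : Fact p.Prime] {n : ℕ} (a : Fin n → ℕ) : Fin n → Fin p := fun i => ⟨a i % p, Nat.mod_lt _ hp.out.pos⟩

lemma psum_single [DecidableEq (Fin n → Fin p)] (y : Fin n → L) (α : Fin n → Fin p) (c : L) :
    psum p y (Pi.single α c) = c ^ p * pmon y (fun i => (α i : ℕ)) := by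
  rw [psum, Finset.sum_eq_single α]
  · simp
  · intro b _ hb
    simp [Pi.single_eq_of_ne hb, hp.out.ne_zero]
  · simp

lemma pmon_divmod (y : Fin n → L) (a : Fin n → ℕ) :
    pmon y a = pmon y (fun i => a i / p) ^ p * pmon y (fun i => (pmod p a i : ℕ)) := by
  rw [← pmon_mul, ← pmon_add]
  congr 1
  funext i
  simp [pmod, Nat.div_add_mod]

lemma psum_single_mod [DecidableEq (Fin n → Fin p)] (y : Fin n → L) (a : Fin n → ℕ) (c : L) :
    psum p y (Pi.single (pmod p a) (c * pmon y (fun i => a i / p))) = c ^ p * pmon y a := by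
  rw [psum_single, pmon_divmod (p := p) y a, mul_pow, mul_assoc]

namespace IsPB
variable {y : Fin n → L}

noncomputable def coef (hy : IsPB p y) (g : L) : (Fin n → Fin p) → L := (hy.span g).choose

lemma coef_spec (hy : IsPB p y) (g : L) : psum p y (hy.coef g) = g := ((hy.span g).choose_spec).symm

lemma psum_inj (hy : IsPB p y) {c d : (Fin n → Fin p) → L} (h : psum p y c = psum p y d) : c = d := by
  have := hy.indep (c + -d) (by rw [psum_add, psum_neg, h, add_neg_cancel])
  exact eq_of_sub_eq_zero (by rw [sub_eq_add_neg]; exact this)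

lemma coef_psum (hy : IsPB p y) (c : (Fin n → Fin p) → L) : hy.coef (psum p y c) = c :=
  hy.psum_inj (hy.coef_spec _)

lemma coef_add (hy : IsPB p y) (g h : L) : hy.coef (g + h) = hy.coef g + hy.coef h :=
  hy.psum_inj (by rw [psum_add, coef_spec, coef_spec, coef_spec])

lemma coef_pow_mul (hy : IsPB p y) (a g : L) : hy.coef (a ^ p * g) = a • hy.coef g :=
  hy.psum_inj (by rw [psum_smul, coef_spec, coef_spec])

lemma coef_mon (hy : IsPB p y) [DecidableEq (Fin n → Fin p)] (c : L) (a : Fin n → ℕ) :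
    hy.coef (c ^ p * pmon y a) = Pi.single (pmod p a) (c * pmon y (fun i => a i / p)) :=
  hy.psum_inj (by rw [coef_spec, psum_single_mod])

/-- induction principle -/
lemma ind (hy : IsPB p y) {motive : L → Prop} (h0 : motive 0) (hadd : ∀ a b, motive a → motive b → motive (a + b))
    (hm : ∀ (c : L) (a : Fin n → ℕ), motive (c ^ p * pmon y a)) (g : L) : motive g := by
  rw [← hy.coef_spec g, psum]
  exact Finset.sum_induction _ motive hadd h0 fun α _ => hm _ _

/-- The log Cartier operator. -/
noncomputable def kap (hy : IsPB p y) : L →+ L where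
  toFun g := hy.coef g (pmod p 0)
  map_zero' := by
    have := hy.coef_pow_mul 0 0
    rw [mul_zero] at this
    rw [this]; simp
  map_add' a b := by rw [coef_add]; rfl

lemma kap_pow_mul (hy : IsPB p y) (a g : L) : hy.kap (a ^ p * g) = a * hy.kap g := by
  change hy.coef _ _ = a * hy.coef _ _
  rw [coef_pow_mul]; rfl

lemma pmod_eq_zero (a : Fin n → ℕ) : pmod p a = pmod p 0 ↔ ∀ i, p ∣ a i := by
  simp only [funext_iff, pmod, Fin.mk.injEq, Pi.zero_apply, Nat.zero_mod, Nat.dvd_iff_mod_eq_zero]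

lemma kap_mon (hy : IsPB p y) (c : L) (a : Fin n → ℕ) (ha : ∀ i, p ∣ a i) :
    hy.kap (c ^ p * pmon y a) = c * pmon y (fun i => a i / p) := by
  classical
  change hy.coef _ _ = _
  rw [coef_mon, (pmod_eq_zero a).2 ha, Pi.single_eq_same]

lemma kap_mon_ne (hy : IsPB p y) (c : L) (a : Fin n → ℕ) (ha : ¬ ∀ i, p ∣ a i) :
    hy.kap (c ^ p * pmon y a) = 0 := by
  classical
  change hy.coef _ _ = _
  rw [coef_mon, Pi.single_eq_of_ne]
  intro h; exact ha ((pmod_eq_zero a).1 h.symm)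

lemma kap_one (hy : IsPB p y) : hy.kap 1 = 1 := by
  have := hy.kap_mon 1 0 (by simp)
  simpa [pmon] using this

lemma kap_pow (hy : IsPB p y) (c : L) : hy.kap (c ^ p) = c := by
  have := hy.kap_pow_mul c 1
  simpa [hy.kap_one] using this

noncomputable def delFun (hy : IsPB p y) (i : Fin n) : L →+ L where
  toFun g := ∑ α, ((α i : ℕ) : L) * (hy.coef g α ^ p * pmon y (fun i => (α i : ℕ)))
  map_zero' := by
    have := hy.coef_pow_mul 0 0
    rw [mul_zero, zero_smul] at this
    rw [this]; simp [hp.out.ne_zero]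
  map_add' a b := by
    rw [coef_add]
    simp only [Pi.add_apply, add_pow_char, add_mul, mul_add, Finset.sum_add_distrib]

lemma delFun_mon (hy : IsPB p y) (i : Fin n) (c : L) (a : Fin n → ℕ) :
    hy.delFun i (c ^ p * pmon y a) = (a i : L) * (c ^ p * pmon y a) := by
  classical
  change ∑ α, ((α i : ℕ) : L) * (hy.coef _ α ^ p * pmon y (fun i => (α i : ℕ))) = _
  rw [coef_mon, Finset.sum_eq_single (pmod p a)]
  · rw [Pi.single_eq_same, mul_pow, mul_assoc, ← pmon_divmod]
    congr 1
    simp only [pmod]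
    conv_rhs => rw [← Nat.div_add_mod (a i) p]
    simp
  · intro b _ hb
    rw [Pi.single_eq_of_ne hb]; simp [hp.out.ne_zero]
  · simp

lemma delFun_mul (hy : IsPB p y) (i : Fin n) (g h : L) :
    hy.delFun i (g * h) = g * hy.delFun i h + h * hy.delFun i g := by
  induction g using hy.ind with
  | h0 => simp
  | hadd a b ha hb => rw [add_mul, map_add, ha, hb, map_add]; ring
  | hm c a =>
    induction h using hy.ind with
    | h0 => simp
    | hadd a b ha hb => rw [mul_add, map_add, ha, hb, map_add]; ring
    | hm d b =>
      have : c ^ p * pmon y a * (d ^ p * pmon y b) = (c * d) ^ p * pmon y (a + b) := by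
        rw [pmon_add]; ring
      rw [this, delFun_mon, delFun_mon, delFun_mon, pmon_add]
      simp only [Pi.add_apply, Nat.cast_add]
      ring

/-- log derivations -/
noncomputable def del (hy : IsPB p y) (i : Fin n) : Derivation ℤ L L :=
  Derivation.mk' (hy.delFun i).toIntLinearMap (fun a b => by
    simpa using hy.delFun_mul i a b)

lemma del_mon (hy : IsPB p y) (i : Fin n) (c : L) (a : Fin n → ℕ) :
    hy.del i (c ^ p * pmon y a) = (a i : L) * (c ^ p * pmon y a) := hy.delFun_mon i c a

lemma del_y (hy : IsPB p y) (i j : Fin n) : hy.del i (y j) = if i = j then y j else 0 := by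
  classical
  have h : y j = 1 ^ p * pmon y (Pi.single j 1) := by
    rw [pmon, Finset.prod_eq_single j]
    · simp
    · intro b _ hb; simp [Pi.single_eq_of_ne hb]
    · simp
  have := hy.del_mon i 1 (Pi.single j 1)
  rw [← h] at this
  rw [this]
  by_cases hij : i = j
  · subst hij; simp
  · simp [hij, Pi.single_eq_of_ne hij]

lemma kap_del (hy : IsPB p y) (i : Fin n) (g : L) : hy.kap (hy.del i g) = 0 := by
  induction g using hy.ind with
  | h0 => simp
  | hadd a b ha hb => rw [map_add, map_add, ha, hb, add_zero]
  | hm c a =>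
    rw [del_mon]
    by_cases h : ∀ i, p ∣ a i
    · have : ((a i : ℕ) : L) = 0 := (CharP.cast_eq_zero_iff L p _).2 (h i)
      rw [this]; simp
    · rw [show (a i : L) * (c ^ p * pmon y a) = (a i : ℕ) • (c ^ p * pmon y a) by simp,
        map_nsmul, hy.kap_mon_ne c a h, smul_zero]

end IsPB
end PB

end

/-! ### PB2 -/

section

/-- the universal polynomial whose derivative measures nonadditivity of `z^(p-1) dz` -/
lemma exists_frob_defect {p : ℕ} [hp : Fact p.Prime] {L : Type*} [Field L] [CharP L p]
    (D : Derivation ℤ L L) (a b : L) :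
    ∃ Q : L, D Q = (a + b) ^ (p - 1) * D (a + b) - a ^ (p - 1) * D a - b ^ (p - 1) * D b := by
  obtain ⟨m, hm⟩ : ∃ m, p = m + 1 := ⟨p - 1, by have := hp.out.pos; omega⟩
  have hchoose : ∀ i ∈ Finset.range m, ((p.choose (i + 1) / p : ℕ) : L) * ((i + 1 : ℕ) : L) = (m.choose i : L) ∧
      ((p.choose (i + 1) / p : ℕ) : L) * ((m - i : ℕ) : L) = (m.choose (i + 1) : L) := by
    intro i hi
    have hi := Finset.mem_range.1 hi
    have hd : p ∣ p.choose (i + 1) := hp.out.dvd_choose_self (by omega) (by omega)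
    obtain ⟨q, hq⟩ := hd
    have hq' : p.choose (i + 1) / p = q := by rw [hq, Nat.mul_div_cancel_left _ hp.out.pos]
    rw [hq', ← Nat.cast_mul, ← Nat.cast_mul]
    have h1 := Nat.add_one_mul_choose_eq m i
    rw [← hm, hq] at h1
    have h1' : q * (i + 1) = m.choose i := by
      apply Nat.eq_of_mul_eq_mul_left hp.out.pos
      rw [h1]; ring
    refine ⟨by rw [h1'], ?_⟩
    congr 1
    have h2 := Nat.choose_succ_succ m i
    rw [← Nat.succ_eq_add_one m] at hm
    rw [← hm, Nat.succ_eq_add_one, hq] at h2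
    have h3 : q * (m - i) + q * (i + 1) = q * p := by
      rw [← mul_add]; congr 1; omega
    rw [mul_comm p q] at h2
    omega
  refine ⟨∑ i ∈ Finset.range m, ((p.choose (i + 1) / p : ℕ) : L) * (a ^ (i + 1) * b ^ (m - i)), ?_⟩
  have e1 : (a + b) ^ m - a ^ m = ∑ i ∈ Finset.range m, a ^ i * b ^ (m - i) * (m.choose i : L) := by
    rw [add_pow, Finset.sum_range_succ]; simp
  have e2 : (a + b) ^ m - b ^ m = ∑ i ∈ Finset.range m, a ^ (i + 1) * b ^ (m - (i + 1)) * (m.choose (i + 1) : L) := by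
    rw [add_pow, Finset.sum_range_succ']; simp
  have hm' : p - 1 = m := by omega
  rw [hm', map_add]
  have : (a + b) ^ m * (D a + D b) - a ^ m * D a - b ^ m * D b =
      ((a + b) ^ m - a ^ m) * D a + ((a + b) ^ m - b ^ m) * D b := by ring
  rw [this, e1, e2, map_sum, Finset.sum_mul, Finset.sum_mul, ← Finset.sum_add_distrib]
  refine Finset.sum_congr rfl fun i hi => ?_
  obtain ⟨h1, h2⟩ := hchoose i hi
  rw [← nsmul_eq_mul, D.map_smul_of_tower, D.leibniz, D.leibniz_pow, D.leibniz_pow]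
  have e3 : m - i - 1 = m - (i + 1) := by omega
  rw [← h1, ← h2, e3]
  simp only [nsmul_eq_mul, smul_eq_mul, Nat.add_sub_cancel]
  ring

section PB
variable {p : ℕ} [hp : Fact p.Prime] {L : Type*} [Field L] [CharP L p] {n : ℕ}

lemma natCast_pow_char (m : ℕ) : ((m : L)) ^ p = m := by
  have := map_natCast (frobenius L p) m
  rwa [frobenius_def] at this

namespace IsPB
variable {y : Fin n → L}

lemma kap_natCast_mul (hy : IsPB p y) (m : ℕ) (g : L) : hy.kap (m * g) = m * hy.kap g := by
  rw [← nsmul_eq_mul, map_nsmul, nsmul_eq_mul]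

lemma kap_dlog (hy : IsPB p y) (i : Fin n) (z : L) : ∀ m : L, hy.del i m = 0 →
    hy.kap (z ^ (p - 1) * hy.del i z * m) = hy.del i z * hy.kap m := by
  induction z using hy.ind with
  | h0 => simp
  | hadd a b ha hb =>
    intro m hm
    obtain ⟨Q, hQ⟩ := exists_frob_defect (p := p) (hy.del i) a b
    have : (a + b) ^ (p - 1) * hy.del i (a + b) * m =
        hy.del i (Q * m) + a ^ (p - 1) * hy.del i a * m + b ^ (p - 1) * hy.del i b * m := by
      rw [Derivation.leibniz, hm, hQ]; simp only [smul_eq_mul]; ring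
    rw [this, map_add, map_add, kap_del, ha m hm, hb m hm, map_add]; ring
  | hm c a =>
    intro m hm
    rw [del_mon]
    have : (c ^ p * pmon y a) ^ (p - 1) * ((a i : L) * (c ^ p * pmon y a)) * m
      = (c ^ p * pmon y a) ^ p * ((a i : ℕ) * m) := by
      conv_rhs => rw [← Nat.sub_add_cancel hp.out.one_le, pow_succ]
      rw [Nat.sub_add_cancel hp.out.one_le]
      ring
    rw [this, kap_pow_mul, kap_natCast_mul]; ring

lemma y_ne_zero (hy : IsPB p y) (i : Fin n) : y i ≠ 0 := by
  classical
  intro h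
  have hne : Nontrivial (Fin p) := by
    have := hp.out.two_le
    exact Fin.nontrivial_iff_two_le.2 this
  have := hy.coef_mon 1 (Pi.single i 1)
  have h0 : pmon y (Pi.single i 1) = 0 := by
    rw [pmon]; exact Finset.prod_eq_zero (Finset.mem_univ i) (by simp [h])
  have h1 : (fun j => (Pi.single i 1 : Fin n → ℕ) j / p) = 0 := by
    funext j
    by_cases hj : j = i
    · subst hj; simp [Nat.div_eq_of_lt hp.out.one_lt]
    · simp [Pi.single_eq_of_ne hj]
  rw [h0, h1, pmon_zero, mul_zero] at this
  have h2 : hy.coef 0 = 0 := by simpa using hy.coef_pow_mul 0 0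
  rw [h2] at this
  have := congrFun this (pmod p (Pi.single i 1))
  simp at this

end IsPB

/-- If there is a p-basis of size `n`, p-independent families of size `n` are p-bases. -/
lemma PIndep.isPB {y y' : Fin n → L} (hy : IsPB p y) (h' : PIndep p y') : IsPB p y' := by
  refine ⟨h', ?_⟩
  let this : Module L L := Module.compHom L (frobenius L p)
  have hsm : ∀ a b : L, @HSMul.hSMul L L L (@instHSMul L L this.toSMul) a b = a ^ p * b := fun a b => rfl
  let fam (y : Fin n → L) : (Fin n → Fin p) → L := fun α => pmon y fun i => (α i : ℕ)
  have hsum : ∀ (y : Fin n → L) (c : (Fin n → Fin p) → L),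
      ∑ α, @HSMul.hSMul L L L (@instHSMul L L this.toSMul) (c α) (fam y α) = psum p y c := fun y c => rfl
  have hlin : ∀ (y : Fin n → L), PIndep p y → @LinearIndependent _ L L (fam y) _ _ this := by
    intro y hy
    rw [Fintype.linearIndependent_iff]
    intro g hg i
    rw [hsum] at hg
    exact congrFun (hy g hg) i
  have hspan : ⊤ ≤ @Submodule.span L L _ _ this (Set.range (fam y)) := by
    intro g _
    obtain ⟨c, hc⟩ := hy.span g
    rw [hc, ← hsum]
    exact Submodule.sum_mem _ fun α _ => Submodule.smul_mem _ _ (Submodule.subset_span ⟨α, rfl⟩)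
  let bas := Module.Basis.mk (R := L) (M := L) (hlin y hy.indep) hspan
  have hcard : Fintype.card (Fin n → Fin p) = @Module.finrank L L _ _ this :=
    (Module.finrank_eq_card_basis bas).symm
  have hne : Nonempty (Fin n → Fin p) := ⟨pmod p 0⟩
  have htop := (hlin y' h').span_eq_top_of_card_eq_finrank hcard
  intro g
  have : g ∈ @Submodule.span L L _ _ this (Set.range (fam y')) := by rw [htop]; trivial
  obtain ⟨c, hc⟩ := (Submodule.mem_span_range_iff_exists_fun L).1 this
  exact ⟨c, by rw [← hsum, hc]⟩

end PB

end

/-! ### PB3 -/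

section

section PB
variable {p : ℕ} [hp : Fact p.Prime] {L : Type*} [Field L] [CharP L p] {n : ℕ}

lemma der_pow_char (D : Derivation ℤ L L) (c g : L) : D (c ^ p * g) = c ^ p * D g := by
  rw [D.leibniz, D.leibniz_pow]
  simp

lemma pmon_ne_zero {y : Fin n → L} (hy : ∀ i, y i ≠ 0) (a : Fin n → ℕ) : pmon y a ≠ 0 :=
  Finset.prod_ne_zero_iff.2 fun i _ => pow_ne_zero _ (hy i)

/-- independence from a dual operator -/
lemma pindep_of_dual (φ : L →+ L) (hφ : ∀ c g, φ (c ^ p * g) = c * φ g) (h : L) (hh : h ≠ 0)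
    (y : Fin n → L) (hy0 : ∀ i, y i ≠ 0)
    (h1 : ∀ b : Fin n → ℕ, (∀ i, p ∣ b i) → φ (h * pmon y b) = h * pmon y (fun i => b i / p))
    (h2 : ∀ b : Fin n → ℕ, (¬ ∀ i, p ∣ b i) → φ (h * pmon y b) = 0) : PIndep p y := by
  intro c hc
  funext γ
  have key : φ (h * (psum p y c * pmon y (fun i => p - (γ i : ℕ)))) = c γ * (h * pmon y 1) := by
    rw [psum, Finset.sum_mul, Finset.mul_sum, map_sum, Finset.sum_eq_single γ]
    · rw [mul_assoc, ← pmon_add, mul_left_comm, hφ]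
      have : ((fun i => ((γ i : ℕ))) + fun i => p - (γ i : ℕ)) = fun _ => p := by
        funext i; have := (γ i).2; simp only [Pi.add_apply]; omega
      rw [this, h1 _ (by simp)]
      congr 3
      funext i; simp [Nat.div_self hp.out.pos]
    · intro β _ hβ
      rw [mul_assoc, ← pmon_add, mul_left_comm, hφ, h2, mul_zero]
      intro hall
      apply hβ
      funext i
      have h3 := hall i
      simp only [Pi.add_apply] at h3
      have hb := (β i).2
      have hg := (γ i).2
      obtain ⟨q, hq⟩ := h3
      have : q = 1 := by
        have h4 : 0 < q := Nat.pos_of_ne_zero (by rintro rfl; omega)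
        have h5 : q < 2 := by
          by_contra h6
          have : p * 2 ≤ p * q := Nat.mul_le_mul_left _ (by omega)
          omega
        omega
      rw [this] at hq
      exact Fin.ext (by omega)
    · simp
  rw [hc] at key
  simp only [zero_mul, mul_zero, map_zero] at key
  have := pmon_ne_zero hy0 1
  have h3 : h * pmon y 1 ≠ 0 := mul_ne_zero hh this
  exact (mul_eq_zero.1 key.symm).resolve_right h3

lemma der_leibniz_prod {ι : Type*} [DecidableEq ι] (D : Derivation ℤ L L) (s : Finset ι) (f : ι → L) :
    D (∏ i ∈ s, f i) = ∑ i ∈ s, (∏ j ∈ s.erase i, f j) * D (f i) := by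
  induction s using Finset.induction_on with
  | empty => simp
  | insert a s ha ih =>
    rw [Finset.prod_insert ha, D.leibniz, ih, Finset.sum_insert ha, Finset.erase_insert ha]
    simp only [smul_eq_mul, Finset.mul_sum]
    rw [add_comm]
    congr 1
    refine Finset.sum_congr rfl fun i hi => ?_
    have hne : a ≠ i := by rintro rfl; exact ha hi
    rw [Finset.erase_insert_of_ne hne, Finset.prod_insert (fun h => ha (Finset.mem_of_mem_erase h))]
    ring

namespace IsPB
variable {y : Fin n → L}

lemma kap_of_dual (hy : IsPB p y) (φ : L →+ L) (hφ : ∀ c g, φ (c ^ p * g) = c * φ g) (h : L)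
    (h1 : ∀ b : Fin n → ℕ, (∀ i, p ∣ b i) → φ (h * pmon y b) = h * pmon y (fun i => b i / p))
    (h2 : ∀ b : Fin n → ℕ, (¬ ∀ i, p ∣ b i) → φ (h * pmon y b) = 0) (g : L) :
    φ (h * g) = h * hy.kap g := by
  induction g using hy.ind with
  | h0 => simp
  | hadd a b ha hb => rw [mul_add, map_add, ha, hb, map_add, mul_add]
  | hm c a =>
    rw [mul_left_comm, hφ]
    by_cases ha : ∀ i, p ∣ a i
    · rw [h1 a ha, hy.kap_mon c a ha]; ring
    · rw [h2 a ha, hy.kap_mon_ne c a ha]; ring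

lemma der_expand (hy : IsPB p y) (D : Derivation ℤ L L) (g : L) : D g = ∑ j, D (y j) / y j * hy.del j g := by
  have hmon : ∀ a : Fin n → ℕ, D (pmon y a) = ∑ j, D (y j) / y j * ((a j : L) * pmon y a) := by
    intro a
    rw [pmon, der_leibniz_prod]
    refine Finset.sum_congr rfl fun j _ => ?_
    rw [D.leibniz_pow, ← Finset.mul_prod_erase _ _ (Finset.mem_univ j)]
    have hj := hy.y_ne_zero j
    rcases Nat.eq_zero_or_pos (a j) with h | h
    · simp [h]
    · obtain ⟨m, hm⟩ : ∃ m, a j = m + 1 := ⟨a j - 1, by omega⟩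
      rw [hm]
      simp only [Nat.add_sub_cancel, smul_eq_mul, nsmul_eq_mul, pow_succ]
      field_simp
  induction g using hy.ind with
  | h0 => simp
  | hadd a b ha hb => simp only [map_add, mul_add, Finset.sum_add_distrib, ha, hb]
  | hm c a =>
    rw [der_pow_char, hmon, Finset.mul_sum]
    refine Finset.sum_congr rfl fun j _ => ?_
    rw [del_mon]; ring

lemma der_ext (hy : IsPB p y) {D D' : Derivation ℤ L L} (h : ∀ j, D (y j) = D' (y j)) : D = D' := by
  ext g
  rw [hy.der_expand D g, hy.der_expand D' g]
  simp only [h]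

end IsPB

open Matrix

/-- Jacobian -/
noncomputable def pJac {y : Fin n → L} (hy : IsPB p y) (u : Fin n → L) : Matrix (Fin n) (Fin n) L :=
  Matrix.of fun i j => hy.del i (u j)

noncomputable def pJacLog {y : Fin n → L} (hy : IsPB p y) (u : Fin n → L) : Matrix (Fin n) (Fin n) L :=
  Matrix.of fun i j => hy.del i (u j) / u j

lemma pJac_chain {y y' : Fin n → L} (hy : IsPB p y) (hy' : IsPB p y') (u : Fin n → L) :
    pJac hy u = pJacLog hy y' * pJac hy' u := by
  ext i j
  rw [mul_apply]
  simp only [pJac, pJacLog, of_apply]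
  exact hy'.der_expand _ _

lemma pJacLog_chain {y y' : Fin n → L} (hy : IsPB p y) (hy' : IsPB p y') (u : Fin n → L) :
    pJacLog hy u = pJacLog hy y' * pJacLog hy' u := by
  ext i j
  rw [mul_apply]
  simp only [pJacLog, of_apply]
  rw [hy'.der_expand (hy.del i) (u j), Finset.sum_div]
  exact Finset.sum_congr rfl fun k _ => by ring

/-- the compatibility relation -/
def PRel {y y' : Fin n → L} (hy : IsPB p y) (hy' : IsPB p y') : Prop :=
  (pJacLog hy y').det ≠ 0 ∧ ∀ g, hy.kap ((pJacLog hy y').det * g) = (pJacLog hy y').det * hy'.kap g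

lemma PRel.trans {y y' y'' : Fin n → L} {hy : IsPB p y} {hy' : IsPB p y'} {hy'' : IsPB p y''}
    (h1 : PRel hy hy') (h2 : PRel hy' hy'') : PRel hy hy'' := by
  unfold PRel
  rw [pJacLog_chain hy hy', det_mul]
  refine ⟨mul_ne_zero h1.1 h2.1, fun g => ?_⟩
  rw [mul_assoc, h1.2, h2.2, mul_assoc]

lemma pJacLog_self {y : Fin n → L} (hy : IsPB p y) : pJacLog hy y = 1 := by
  ext i j
  simp only [pJacLog, of_apply, hy.del_y, one_apply]
  split_ifs
  · exact div_self (hy.y_ne_zero j)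
  · simp

lemma PRel.refl {y : Fin n → L} (hy : IsPB p y) : PRel hy hy := by
  unfold PRel
  rw [pJacLog_self]; simp

lemma IsPB.exchange {y : Fin n → L} (hy : IsPB p y) (i : Fin n) (z : L) (hz : hy.del i z ≠ 0) :
    ∃ hy' : IsPB p (Function.update y i z), PRel hy hy' := by
  have hz0 : z ≠ 0 := by rintro rfl; simp at hz
  set h := hy.del i z / z with hh
  have hh0 : h ≠ 0 := div_ne_zero hz hz0
  have hsplit : ∀ b : Fin n → ℕ, pmon (Function.update y i z) b = z ^ b i * pmon y (Function.update b i 0) := by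
    intro b
    simp only [pmon]
    rw [← Finset.mul_prod_erase _ _ (Finset.mem_univ i), ← Finset.mul_prod_erase _ (fun j => y j ^ (Function.update b i 0 j)) (Finset.mem_univ i)]
    simp only [Function.update_self, pow_zero, one_mul]
    congr 1
    refine Finset.prod_congr rfl fun j hj => ?_
    rw [Function.update_of_ne (Finset.ne_of_mem_erase hj), Function.update_of_ne (Finset.ne_of_mem_erase hj)]
  have hdm : ∀ b : Fin n → ℕ, hy.del i (pmon y (Function.update b i 0)) = 0 := by
    intro b
    have := hy.del_mon i 1 (Function.update b i 0)
    simpa using this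
  have hmul : ∀ m, hy.del i m = 0 → hy.kap (h * m) = h * hy.kap m := by
    intro m hm
    have e : h * m = (z⁻¹) ^ p * (z ^ (p - 1) * hy.del i z * m) := by
      have : z ^ p = z ^ (p - 1) * z := by rw [← pow_succ, Nat.sub_add_cancel hp.out.one_le]
      rw [hh, inv_pow, this]
      field_simp
    rw [e, hy.kap_pow_mul, hy.kap_dlog i z m hm, hh]; ring
  have h1 : ∀ b : Fin n → ℕ, (∀ i, p ∣ b i) → hy.kap (h * pmon (Function.update y i z) b) =
      h * pmon (Function.update y i z) (fun i => b i / p) := by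
    intro b hb
    rw [hsplit, hsplit]
    obtain ⟨q, hq⟩ := hb i
    have e : h * (z ^ b i * pmon y (Function.update b i 0)) = (z ^ q) ^ p * (h * pmon y (Function.update b i 0)) := by
      rw [hq, mul_comm p q, pow_mul]; ring
    rw [e, hy.kap_pow_mul, hmul _ (hdm b)]
    have := hy.kap_mon 1 (Function.update b i 0) (fun j => by
      by_cases hj : j = i
      · subst hj; simp
      · rw [Function.update_of_ne hj]; exact hb j)
    rw [one_pow, one_mul, one_mul] at this
    rw [this]
    have e2 : (fun j => Function.update b i 0 j / p) = Function.update (fun j => b j / p) i 0 := by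
      funext j
      by_cases hj : j = i
      · subst hj; simp
      · rw [Function.update_of_ne hj, Function.update_of_ne hj]
    rw [e2, hq, Nat.mul_div_cancel_left _ hp.out.pos]; ring
  have h2 : ∀ b : Fin n → ℕ, (¬ ∀ i, p ∣ b i) → hy.kap (h * pmon (Function.update y i z) b) = 0 := by
    intro b hb
    rw [hsplit]
    by_cases hbi : p ∣ b i
    · obtain ⟨q, hq⟩ := hbi
      have e : h * (z ^ b i * pmon y (Function.update b i 0)) = (z ^ q) ^ p * (h * pmon y (Function.update b i 0)) := by
        rw [hq, mul_comm p q, pow_mul]; ring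
      rw [e, hy.kap_pow_mul, hmul _ (hdm b)]
      have := hy.kap_mon_ne 1 (Function.update b i 0) (fun hall => hb fun j => by
        by_cases hj : j = i
        · subst hj; exact ⟨q, hq⟩
        · have := hall j; rwa [Function.update_of_ne hj] at this)
      rw [one_pow, one_mul] at this
      rw [this]; simp
    · have hne : ((b i : ℕ) : L) ≠ 0 := fun h0 => hbi ((CharP.cast_eq_zero_iff L p _).1 h0)
      have hpos : 0 < b i := Nat.pos_of_ne_zero (by rintro h0; rw [h0] at hbi; simp at hbi)
      have e : hy.del i (z ^ b i * pmon y (Function.update b i 0)) = (b i : ℕ) * (h * (z ^ b i * pmon y (Function.update b i 0))) := by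
        obtain ⟨m, hm⟩ : ∃ m, b i = m + 1 := ⟨b i - 1, by omega⟩
        rw [Derivation.leibniz, hdm, Derivation.leibniz_pow, hh, hm]
        simp only [smul_eq_mul, nsmul_eq_mul, Nat.add_sub_cancel, pow_succ]
        field_simp
        ring
      have e2 := hy.kap_del i (z ^ b i * pmon y (Function.update b i 0))
      rw [e, hy.kap_natCast_mul] at e2
      exact (mul_eq_zero.1 e2).resolve_left hne
  have hy'0 : ∀ j, Function.update y i z j ≠ 0 := by
    intro j
    by_cases hj : j = i
    · subst hj; simpa using hz0
    · rw [Function.update_of_ne hj]; exact hy.y_ne_zero j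
  have hind := pindep_of_dual hy.kap hy.kap_pow_mul h hh0 (Function.update y i z) hy'0 h1 h2
  have hy' := hind.isPB hy
  refine ⟨hy', ?_⟩
  have hdet : (pJacLog hy (Function.update y i z)).det = h := by
    have : pJacLog hy (Function.update y i z) = (1 : Matrix (Fin n) (Fin n) L).updateCol i (fun k => hy.del k z / z) := by
      ext k j
      by_cases hj : j = i
      · subst hj; simp [pJacLog]
      · rw [updateCol_ne hj, ← pJacLog_self hy]
        simp only [pJacLog, of_apply, Function.update_of_ne hj]
    rw [this, ← cramer_apply, cramer_one]; simp [hh]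
  unfold PRel
  rw [hdet]
  exact ⟨hh0, hy'.kap_of_dual hy.kap hy.kap_pow_mul h h1 h2⟩

lemma IsPB.perm {y : Fin n → L} (hy : IsPB p y) (σ : Equiv.Perm (Fin n)) :
    ∃ hy' : IsPB p (y ∘ σ), PRel hy hy' ∧ ∀ i, hy'.del i = hy.del (σ i) := by
  have hmon : ∀ b : Fin n → ℕ, pmon (y ∘ σ) b = pmon y (b ∘ σ.symm) := by
    intro b
    simp only [pmon]
    exact Fintype.prod_equiv σ _ _ (by simp)
  have hdet : (pJacLog hy (y ∘ σ)).det = ((Equiv.Perm.sign σ : ℤ) : L) := by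
    have : pJacLog hy (y ∘ σ) = (1 : Matrix (Fin n) (Fin n) L).submatrix id σ := by
      rw [← pJacLog_self hy]; rfl
    rw [this, det_permute']; simp
  have hs : ((Equiv.Perm.sign σ : ℤ) : L) ≠ 0 := by
    rcases Int.units_eq_one_or (Equiv.Perm.sign σ) with h | h <;> simp [h]
  have hk : ∀ g, hy.kap (((Equiv.Perm.sign σ : ℤ) : L) * g) = ((Equiv.Perm.sign σ : ℤ) : L) * hy.kap g := by
    intro g
    rw [← zsmul_eq_mul, map_zsmul, zsmul_eq_mul]
  have h1 : ∀ b : Fin n → ℕ, (∀ i, p ∣ b i) → hy.kap (((Equiv.Perm.sign σ : ℤ) : L) * pmon (y ∘ σ) b) =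
      ((Equiv.Perm.sign σ : ℤ) : L) * pmon (y ∘ σ) (fun i => b i / p) := by
    intro b hb
    rw [hk, hmon, hmon]
    have := hy.kap_mon 1 (b ∘ σ.symm) (fun i => hb _)
    rw [one_pow, one_mul, one_mul] at this
    rw [this]; rfl
  have h2 : ∀ b : Fin n → ℕ, (¬ ∀ i, p ∣ b i) → hy.kap (((Equiv.Perm.sign σ : ℤ) : L) * pmon (y ∘ σ) b) = 0 := by
    intro b hb
    rw [hk, hmon]
    have := hy.kap_mon_ne 1 (b ∘ σ.symm) (fun hall => hb fun i => by simpa using hall (σ i))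
    rw [one_pow, one_mul] at this
    rw [this, mul_zero]
  have hind := pindep_of_dual hy.kap hy.kap_pow_mul _ hs (y ∘ σ) (fun j => hy.y_ne_zero _) h1 h2
  have hy' := hind.isPB hy
  refine ⟨hy', ?_, fun i => ?_⟩
  · unfold PRel
    rw [hdet]
    exact ⟨hs, hy'.kap_of_dual hy.kap hy.kap_pow_mul _ h1 h2⟩
  · refine hy'.der_ext fun j => ?_
    rw [hy'.del_y]
    simp only [Function.comp_apply, hy.del_y, EmbeddingLike.apply_eq_iff_eq]

/-- Jacobian criterion and change of variables for p-bases. -/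
theorem IsPB.jacobian {y : Fin n → L} (hy : IsPB p y) (u : Fin n → L) (hu : (pJac hy u).det ≠ 0) :
    ∃ hu' : IsPB p u, PRel hy hu' := by
  have key : ∀ k : ℕ, k ≤ n → ∃ (y' : Fin n → L) (hy' : IsPB p y'), PRel hy hy' ∧
      ∀ j : Fin n, (j : ℕ) < k → y' j = u j := by
    intro k
    induction k with
    | zero => intro _; exact ⟨y, hy, PRel.refl hy, by simp⟩
    | succ k ih =>
      intro hk
      obtain ⟨y', hy', hR, hj⟩ := ih (by omega)
      have hd : (pJac hy' u).det ≠ 0 := by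
        rw [pJac_chain hy hy', det_mul] at hu
        exact right_ne_zero_of_mul hu
      let K : Fin n := ⟨k, by omega⟩
      obtain ⟨i, hik, hi⟩ : ∃ i : Fin n, k ≤ (i : ℕ) ∧ hy'.del i (u K) ≠ 0 := by
        by_contra hcon
        push Not at hcon
        apply hd
        rw [← Matrix.exists_mulVec_eq_zero_iff]
        refine ⟨fun j => if (j : ℕ) < k then - (hy'.del j (u K) / u j) else if j = K then 1 else 0, ?_, ?_⟩
        · intro h
          have := congrFun h K
          simp [K] at this
        · funext i
          simp only [mulVec, dotProduct, pJac, of_apply, Pi.zero_apply]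
          have e : ∀ j : Fin n, hy'.del i (u j) * (if (j : ℕ) < k then - (hy'.del j (u K) / u j) else if j = K then 1 else 0)
            = (if j = i then (if (i : ℕ) < k then - hy'.del i (u K) else 0) else 0) + (if j = K then hy'.del i (u K) else 0) := by
            intro j
            by_cases hjk : (j : ℕ) < k
            · have hne : j ≠ K := by rintro rfl; simp [K] at hjk
              rw [if_pos hjk, if_neg hne, ← hj j hjk, hy'.del_y]
              have := hy'.y_ne_zero j
              by_cases hji : j = i
              · subst hji; simp [hjk]; field_simp
              · simp [hji, Ne.symm hji]
            · rw [if_neg hjk]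
              by_cases hjK : j = K
              · subst hjK
                by_cases hKi : K = i
                · rw [← hKi]; simp [hjk]
                · simp [hKi]
              · simp only [hjK, if_false, mul_zero, add_zero]
                by_cases hji : j = i
                · subst hji; simp [hjk]
                · simp [hji]
          simp only [e, Finset.sum_add_distrib, Finset.sum_ite_eq', Finset.mem_univ, if_true]
          split_ifs with h
          · simp
          · rw [hcon i (by omega)]; simp
      obtain ⟨hy2, hR2, hdel⟩ := hy'.perm (Equiv.swap i K)
      have h3 : hy2.del K (u K) ≠ 0 := by
        rw [hdel, Equiv.swap_apply_right]; exact hi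
      obtain ⟨hy3, hR3⟩ := hy2.exchange K (u K) h3
      refine ⟨_, hy3, (hR.trans hR2).trans hR3, fun j hjk => ?_⟩
      by_cases hjK : j = K
      · rw [hjK]; simp
      · have hjk' : (j : ℕ) < k := by
          have : (j : ℕ) ≠ k := fun h => hjK (Fin.ext h)
          omega
        rw [Function.update_of_ne hjK, Function.comp_apply, Equiv.swap_apply_of_ne_of_ne _ hjK]
        · exact hj j hjk'
        · rintro rfl; omega
  obtain ⟨y', hy', hR, hj⟩ := key n le_rfl
  have : y' = u := funext fun j => hj j j.2
  subst this
  exact ⟨hy', hR⟩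

end PB

end

/-! ### PB4 -/

section

section PB
variable {p : ℕ} [hp : Fact p.Prime] {L : Type*} [Field L] [CharP L p] {n : ℕ}

lemma IsPB.kap_shift {y : Fin n → L} (hy : IsPB p y) (c : (Fin n → Fin p) → L) (γ : Fin n → Fin p) :
    hy.kap (psum p y c * pmon y (fun i => p - (γ i : ℕ))) = c γ * pmon y 1 := by
  rw [psum, Finset.sum_mul, map_sum, Finset.sum_eq_single γ]
  · rw [mul_assoc, ← pmon_add]
    have : ((fun i => ((γ i : ℕ))) + fun i => p - (γ i : ℕ)) = fun _ => p := by
      funext i; have := (γ i).2; simp only [Pi.add_apply]; omega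
    rw [this, hy.kap_mon _ _ (by simp)]
    congr 2
    funext i; simp [Nat.div_self hp.out.pos]
  · intro β _ hβ
    rw [mul_assoc, ← pmon_add, hy.kap_mon_ne]
    intro hall
    apply hβ
    funext i
    have h3 := hall i
    simp only [Pi.add_apply] at h3
    have hb := (β i).2
    have hg := (γ i).2
    obtain ⟨q, hq⟩ := h3
    have : q = 1 := by
      have h4 : 0 < q := Nat.pos_of_ne_zero (by rintro rfl; omega)
      have h5 : q < 2 := by
        by_contra h6
        have : p * 2 ≤ p * q := Nat.mul_le_mul_left _ (by omega)
        omega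
      omega
    rw [this] at hq
    exact Fin.ext (by omega)
  · simp

lemma IsPB.exists_small {u : Fin n → L} (hu : IsPB p u) {Γ : Type*} [LinearOrderedCommGroupWithZero Γ]
    (w : Valuation L Γ) (hw : ∀ i, w (u i) ≤ 1) (ϖ : L) (hϖ0 : ϖ ≠ 0) (hϖ : ∀ c, w ϖ ≠ w c ^ p) :
    ∃ Y, w Y < 1 ∧ hu.kap Y = ∏ i, u i := by
  have hmon : ∀ a, w (pmon u a) ≤ 1 := by
    intro a
    rw [pmon, map_prod]
    exact Finset.prod_le_one' fun i _ => by rw [map_pow]; exact pow_le_one' (hw i) _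
  obtain ⟨α, _, hα⟩ := Finset.exists_max_image (Finset.univ : Finset (Fin n → Fin p)) (fun α => w (hu.coef ϖ α))
    ⟨pmod p 0, Finset.mem_univ _⟩
  set c := hu.coef ϖ α with hc
  have hle : w ϖ ≤ w c ^ p := by
    conv_lhs => rw [← hu.coef_spec ϖ, psum]
    refine w.map_sum_le fun β _ => ?_
    rw [map_mul, map_pow]
    calc _ ≤ w c ^ p * 1 := mul_le_mul' (pow_le_pow_left' (hα β (Finset.mem_univ _)) _) (hmon _)
      _ = _ := mul_one _
  have hlt : w ϖ < w c ^ p := lt_of_le_of_ne hle (hϖ c)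
  have hc0 : c ≠ 0 := by
    intro h; rw [h] at hlt; simp [hp.out.ne_zero] at hlt
  have hwc : 0 < w c ^ p := pow_pos (zero_lt_iff.2 ((Valuation.ne_zero_iff _).2 hc0)) _
  refine ⟨(c⁻¹) ^ p * (ϖ * pmon u (fun i => p - (α i : ℕ))), ?_, ?_⟩
  · rw [map_mul, map_mul, map_pow, map_inv₀]
    calc _ ≤ (w c)⁻¹ ^ p * (w ϖ * 1) := by gcongr; exact hmon _
      _ < 1 := by rw [mul_one, inv_pow, inv_mul_lt_iff₀ hwc, mul_one]; exact hlt
  · rw [hu.kap_pow_mul]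
    have := hu.kap_shift (hu.coef ϖ) α
    rw [hu.coef_spec] at this
    rw [this, ← hc, ← mul_assoc, inv_mul_cancel₀ hc0, one_mul]
    simp [pmon]

lemma IsPB.kap_iter_mul {y : Fin n → L} (hy : IsPB p y) (a g : L) (r : ℕ) :
    hy.kap^[r] (a ^ (p ^ r) * g) = a * hy.kap^[r] g := by
  induction r generalizing g with
  | zero => simp
  | succ r ih =>
    rw [Function.iterate_succ_apply, Function.iterate_succ_apply, pow_succ, pow_mul, hy.kap_pow_mul, ih]

/-- The local representation. -/
theorem IsPB.local_rep {y : Fin n → L} (hy : IsPB p y) (u : Fin n → L) (hu : (pJac hy u).det ≠ 0)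
    {Γ : Type*} [LinearOrderedCommGroupWithZero Γ]
    (w : Valuation L Γ) (hw : ∀ i, w (u i) ≤ 1) (ϖ : L) (hϖ0 : ϖ ≠ 0) (hϖ : ∀ c, w ϖ ≠ w c ^ p) :
    ∃ H Y : L, w Y < 1 ∧ ∀ (G : L) (r : ℕ),
      hy.kap^[r + 1] (H * G ^ (p ^ (r + 1)) * Y ^ (p ^ r)) = (pJac hy u).det * G := by
  obtain ⟨hu', hR⟩ := hy.jacobian u hu
  obtain ⟨Y, hY, hY'⟩ := hu'.exists_small w hw ϖ hϖ0 hϖ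
  set H := (pJacLog hy u).det with hH
  have hdet : (pJac hy u).det = H * ∏ i, u i := by
    have : pJac hy u = pJacLog hy u * Matrix.diagonal u := by
      ext i j
      rw [Matrix.mul_diagonal]
      simp only [pJac, pJacLog, Matrix.of_apply]
      rw [div_mul_cancel₀ _ (hu'.y_ne_zero j)]
    rw [this, Matrix.det_mul, Matrix.det_diagonal]
  have hit : ∀ r g, hy.kap^[r] (H * g) = H * hu'.kap^[r] g := by
    intro r
    induction r with
    | zero => intro g; rfl
    | succ r ih =>
      intro g
      rw [Function.iterate_succ_apply, Function.iterate_succ_apply, hR.2, ih]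
  refine ⟨H, Y, hY, fun G r => ?_⟩
  rw [mul_assoc, hit, hu'.kap_iter_mul, Function.iterate_succ_apply', hdet]
  have := hu'.kap_iter_mul Y 1 r
  rw [mul_one] at this
  rw [this]
  have h1 : ∀ r, hu'.kap^[r] 1 = 1 := by
    intro r
    induction r with
    | zero => rfl
    | succ r ih => rw [Function.iterate_succ_apply, hu'.kap_one, ih]
  rw [h1, mul_one, hY']; ring

end PB

end

/-! ### P4 -/

section

section P4
open IsDedekindDomain

lemma withZero_exists_pow_lt (x y : WithZero (Multiplicative ℤ)) (hx : x < 1) (hy : y ≠ 0) : ∃ n : ℕ, x ^ n < y := by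
  simpa using exists_pow_lt₀ hx (Units.mk0 y hy)

theorem P4_main {p : ℕ} [hp : Fact p.Prime] {B E L : Type*} [CommRing B] [IsDedekindDomain B]
    [Field E] [Algebra B E] [IsFractionRing B E] [Field L] [CharP L p] [Algebra E L]
    (hB : ¬ IsField B)
    (κ : L →+ L) (hκ : ∀ c g, κ (c ^ p * g) = c * κ g) (φ : L →+* E) (r0 : ℕ)
    (hφ : ∀ l, algebraMap E L (φ l) = l ^ (p ^ r0)) (Λ : L →ₗ[E] E) (a : B) (ha : a ≠ 0) (G0 : L)
    (hloc : ∀ P : HeightOneSpectrum B, ∃ H G Y : L, P.valuation E (φ G) ≤ 1 ∧ P.valuation E (φ Y) < 1 ∧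
      ∀ r : ℕ, κ^[r+1] (H * G ^ (p ^ (r+1)) * Y ^ (p ^ r)) = G0) :
    ∃ r g, κ^[r] g = G0 ∧ ∃ b : B, Λ g = algebraMap B E (a * b) := by
  have hκr : ∀ r c g, κ^[r] (c ^ (p ^ r) * g) = c * κ^[r] g := by
    intro r
    induction r with
    | zero => intro c g; simp
    | succ r ih =>
      intro c g
      rw [Function.iterate_succ_apply, Function.iterate_succ_apply, pow_succ, pow_mul, hκ, ih]
  have hκs : ∀ (r : ℕ) {ι : Type _} (s : Finset ι) (f : ι → L), κ^[r] (∑ i ∈ s, f i) = ∑ i ∈ s, κ^[r] (f i) := by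
    intro r ι s f
    induction r with
    | zero => simp
    | succ r ih => simp only [Function.iterate_succ_apply', ih, map_sum]
  let Good : B → Prop := fun θ => ∃ r1 : ℕ, ∀ r ≥ r1, ∃ g, κ^[r] g = G0 ∧ ∃ b : B, (algebraMap B E θ) ^ (p ^ r) * Λ g = algebraMap B E (a * b)
  have key : ∀ P : HeightOneSpectrum B, ∃ θ, Good θ ∧ θ ∉ P.asIdeal := by
    intro P
    obtain ⟨H, G, Y, hG, hY, hr⟩ := hloc P
    have ha' : algebraMap B E a ≠ 0 := by simpa using ha
    obtain ⟨m0, hm0⟩ : ∃ m0 : ℕ, P.valuation E ((φ Y) ^ m0 * Λ H / algebraMap B E a) ≤ 1 := by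
      by_cases hl : Λ H = 0
      · exact ⟨0, by simp [hl]⟩
      · have hva : P.valuation E (algebraMap B E a / Λ H) ≠ 0 := by
          rw [Valuation.ne_zero_iff]; exact div_ne_zero ha' hl
        obtain ⟨m, hm⟩ := withZero_exists_pow_lt _ _ hY hva
        refine ⟨m, ?_⟩
        have : (φ Y) ^ m * Λ H / algebraMap B E a = (φ Y) ^ m / (algebraMap B E a / Λ H) := by
          field_simp
        rw [this, map_div₀, map_pow]
        exact div_le_one_of_le₀ hm.le zero_le
    obtain ⟨b1, ⟨e1, he1⟩, h1⟩ := P.exists_primeCompl_mul_eq_of_integer _ hG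
    obtain ⟨b3, ⟨e3, he3⟩, h3⟩ := P.exists_primeCompl_mul_eq_of_integer _ hY.le
    obtain ⟨b2, ⟨e2, he2⟩, h2⟩ := P.exists_primeCompl_mul_eq_of_integer _ hm0
    refine ⟨e1 * e2 * e3, ⟨m0 + r0 + 1, ?_⟩, ?_⟩
    · intro r hrr
      obtain ⟨t, rfl⟩ : ∃ t, r = t + r0 + 1 := ⟨r - r0 - 1, by omega⟩
      have htm : m0 ≤ p ^ t := by
        have := (Nat.lt_pow_self hp.out.one_lt : t < p ^ t); omega
      obtain ⟨q, hq⟩ := Nat.exists_eq_add_of_le htm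
      refine ⟨_, hr (t + r0), ?_⟩
      have e : H * G ^ p ^ (t + r0 + 1) * Y ^ p ^ (t + r0) = ((φ G) ^ p ^ (t+1) * (φ Y) ^ p ^ t) • H := by
        rw [Algebra.smul_def, map_mul, map_pow, map_pow, hφ, hφ, ← pow_mul, ← pow_mul, ← pow_add, ← pow_add]
        rw [show r0 + (t+1) = t + r0 + 1 by ring, show r0 + t = t + r0 by ring]; ring
      rw [e, map_smul, smul_eq_mul]
      have hp1 : p ^ (t+1) ≤ p ^ (t + r0 + 1) := Nat.pow_le_pow_right hp.out.pos (by omega)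
      obtain ⟨q1, hq1⟩ := Nat.exists_eq_add_of_le hp1
      have hp2 : 1 ≤ p ^ (t + r0 + 1) := Nat.one_le_pow _ _ hp.out.pos
      obtain ⟨q2, hq2⟩ := Nat.exists_eq_add_of_le hp2
      have hp3 : q ≤ p ^ (t + r0 + 1) := by
        have : p ^ t ≤ p ^ (t + r0 + 1) := Nat.pow_le_pow_right hp.out.pos (by omega)
        omega
      obtain ⟨q3, hq3⟩ := Nat.exists_eq_add_of_le hp3
      have h2' : φ Y ^ m0 * Λ H * algebraMap B E e2 = algebraMap B E (a * b2) := by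
        rw [map_mul, ← h2]; field_simp
      simp only at h1 h3
      refine ⟨(b1 ^ (p ^ (t+1)) * e1 ^ q1) * (b2 * e2 ^ q2) * (b3 ^ q * e3 ^ q3), ?_⟩
      have : algebraMap B E (a * ((b1 ^ (p ^ (t+1)) * e1 ^ q1) * (b2 * e2 ^ q2) * (b3 ^ q * e3 ^ q3)))
        = ((algebraMap B E b1) ^ (p ^ (t+1)) * algebraMap B E e1 ^ q1) * (algebraMap B E (a * b2) * algebraMap B E e2 ^ q2) * (algebraMap B E b3 ^ q * algebraMap B E e3 ^ q3) := by
        simp only [map_mul, map_pow]; ring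
      rw [this, ← h1, ← h3, ← h2', map_mul, map_mul]
      rw [mul_pow, mul_pow]
      nth_rw 1 [hq1]
      nth_rw 1 [hq2]
      rw [hq3, hq]
      ring
    · exact (Submonoid.mul_mem _ (Submonoid.mul_mem _ he1 he2) he3 : e1 * e2 * e3 ∈ P.asIdeal.primeCompl)
  have htop : Ideal.span {θ | Good θ} = ⊤ := by
    by_contra hne
    obtain ⟨m, hm, hle⟩ := Ideal.exists_le_maximal _ hne
    have hm0 : m ≠ ⊥ := by
      rintro rfl
      exact hB (Ring.isField_iff_maximal_bot.2 hm)
    obtain ⟨θ, hθ, hθ'⟩ := key ⟨m, hm.isPrime, hm0⟩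
    exact hθ' (hle (Ideal.subset_span hθ))
  have h1 : (1 : B) ∈ Submodule.span B {θ | Good θ} := by
    have := (Ideal.eq_top_iff_one _).1 htop; exact this
  obtain ⟨cf, hsup, hcf⟩ := Submodule.mem_span_set.1 h1
  have : ∃ R, ∀ r ≥ R, ∀ θ ∈ cf.support, ∃ g, κ^[r] g = G0 ∧ ∃ b : B, (algebraMap B E θ) ^ (p ^ r) * Λ g = algebraMap B E (a * b) := by
    choose! r1 hr1 using (fun θ (h : θ ∈ cf.support) => hsup h)
    exact ⟨cf.support.sup r1, fun r hr θ hθ => hr1 θ hθ r (le_trans (Finset.le_sup hθ) hr)⟩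
  obtain ⟨R, hR⟩ := this
  choose! g hg b hb using hR R le_rfl
  have hsum : ∑ θ ∈ cf.support, algebraMap E L (algebraMap B E (cf θ * θ)) = 1 := by
    rw [← map_sum, ← map_sum]
    have : ∑ θ ∈ cf.support, cf θ * θ = 1 := hcf
    rw [this]; simp
  refine ⟨R, ∑ θ ∈ cf.support, (algebraMap E L (algebraMap B E (cf θ * θ))) ^ (p ^ R) * g θ, ?_, ?_⟩
  · rw [hκs, ← one_mul G0, ← hsum, Finset.sum_mul]
    refine Finset.sum_congr rfl fun θ hθ => ?_
    rw [hκr, hg θ hθ]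
  · refine ⟨∑ θ ∈ cf.support, cf θ ^ (p ^ R) * b θ, ?_⟩
    rw [map_sum, Finset.mul_sum, map_sum]
    refine Finset.sum_congr rfl fun θ hθ => ?_
    rw [← map_pow, ← Algebra.smul_def, map_smul, smul_eq_mul]
    rw [map_mul, mul_pow, mul_assoc, hb θ hθ]
    simp only [map_mul, map_pow]; ring
end P4

end

/-! ### TD -/

section

section TD
variable {p : ℕ} [hp : Fact p.Prime]

section dual
variable {L E : Type*} [Field L] [CharP L p] [Field E] {n : ℕ}

lemma pindep_of_dual2 (ψ Λ : L →+ E) (y : Fin n → L) (hy0 : ∀ i, y i ≠ 0)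
    (hΛ : ∀ x, (∀ e, Λ (e * x) = 0) → x = 0)
    (h1 : ∀ (x : L) (b : Fin n → ℕ), (∀ i, p ∣ b i) → ψ (x ^ p * pmon y b) = Λ (x * pmon y (fun i => b i / p)))
    (h2 : ∀ (x : L) (b : Fin n → ℕ), (¬ ∀ i, p ∣ b i) → ψ (x ^ p * pmon y b) = 0) : PIndep p y := by
  intro c hc
  funext γ
  have key : ∀ e, Λ (e * (c γ * pmon y 1)) = 0 := by
    intro e
    have : ψ (e ^ p * psum p y c * pmon y (fun i => p - (γ i : ℕ))) = 0 := by rw [hc]; simp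
    rw [psum, Finset.mul_sum, Finset.sum_mul, map_sum, Finset.sum_eq_single γ] at this
    · rw [← mul_assoc, ← mul_pow, mul_assoc, ← pmon_add] at this
      have h3 : ((fun i => ((γ i : ℕ))) + fun i => p - (γ i : ℕ)) = fun _ => p := by
        funext i; have := (γ i).2; simp only [Pi.add_apply]; omega
      rw [h3, h1 _ _ (by simp)] at this
      rw [← this]
      congr 1
      rw [mul_assoc]
      congr 3
      funext i; simp [Nat.div_self hp.out.pos]
    · intro β _ hβ
      rw [← mul_assoc, ← mul_pow, mul_assoc, ← pmon_add, h2]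
      intro hall
      apply hβ
      funext i
      have h3 := hall i
      simp only [Pi.add_apply] at h3
      have hb := (β i).2
      have hg := (γ i).2
      obtain ⟨q, hq⟩ := h3
      have : q = 1 := by
        have h4 : 0 < q := Nat.pos_of_ne_zero (by rintro rfl; omega)
        have h5 : q < 2 := by
          by_contra h6
          have : p * 2 ≤ p * q := Nat.mul_le_mul_left _ (by omega)
          omega
        omega
      rw [this] at hq
      exact Fin.ext (by omega)
    · simp
  have := hΛ _ key
  simpa [pmon_ne_zero hy0] using this

lemma IsPB.kap_of_dual2 {y : Fin n → L} (hy : IsPB p y) (ψ Λ : L →+ E)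
    (h1 : ∀ (x : L) (b : Fin n → ℕ), (∀ i, p ∣ b i) → ψ (x ^ p * pmon y b) = Λ (x * pmon y (fun i => b i / p)))
    (h2 : ∀ (x : L) (b : Fin n → ℕ), (¬ ∀ i, p ∣ b i) → ψ (x ^ p * pmon y b) = 0) (g : L) :
    Λ (hy.kap g) = ψ g := by
  induction g using hy.ind with
  | h0 => simp
  | hadd a b ha hb => rw [map_add, map_add, map_add, ha, hb]
  | hm c a =>
    by_cases h : ∀ i, p ∣ a i
    · rw [hy.kap_mon _ _ h, h1 _ _ h]
    · rw [hy.kap_mon_ne _ _ h, h2 _ _ h, map_zero]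

lemma pspan_of (y : Fin n → L) (S : AddSubgroup L) (hS : ∀ g, g ∈ S ↔ ∃ c, g = psum p y c) (c : L) (a : Fin n → ℕ) :
    c ^ p * pmon y a ∈ S := by
  classical
  exact (hS _).2 ⟨_, (psum_single_mod y a c).symm⟩

/-- the additive group of all p-sums -/
def psumGrp (p : ℕ) [hp : Fact p.Prime] [CharP L p] (y : Fin n → L) : AddSubgroup L where
  carrier := {g | ∃ c, g = psum p y c}
  add_mem' := by
    rintro _ _ ⟨c, rfl⟩ ⟨d, rfl⟩
    exact ⟨c + d, (psum_add y c d).symm⟩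
  zero_mem' := ⟨0, by simp [psum, hp.out.ne_zero]⟩
  neg_mem' := by
    rintro _ ⟨c, rfl⟩
    exact ⟨-c, (psum_neg y c).symm⟩

lemma psumGrp_mon (y : Fin n → L) (c : L) (a : Fin n → ℕ) : c ^ p * pmon y a ∈ psumGrp p y :=
  pspan_of y _ (fun _ => Iff.rfl) c a

lemma psumGrp_smul (y : Fin n → L) (c : L) {g : L} (hg : g ∈ psumGrp p y) : c ^ p * g ∈ psumGrp p y := by
  obtain ⟨d, rfl⟩ := hg
  exact ⟨c • d, (psum_smul y c d).symm⟩

lemma pspan_iff (y : Fin n → L) : PSpan p y ↔ psumGrp p y = ⊤ := by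
  rw [AddSubgroup.eq_top_iff']; rfl
end dual

lemma pmon_map {E L : Type*} [Field E] [Field L] [Algebra E L] {n : ℕ} (z : Fin n → E) (a : Fin n → ℕ) :
    pmon (fun i => algebraMap E L (z i)) a = algebraMap E L (pmon z a) := by simp [pmon]

section sep
variable {M E : Type*} [Field M] [Field E] [CharP M p] [CharP E p] [Algebra M E] {n : ℕ}

lemma trace_pow_char [FiniteDimensional M E] [Algebra.IsSeparable M E] (x : E) :
    Algebra.trace M E (x ^ p) = (Algebra.trace M E x) ^ p := by
  apply (algebraMap M (AlgebraicClosure M)).injective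
  have : CharP (AlgebraicClosure M) p := charP_of_injective_algebraMap (algebraMap M (AlgebraicClosure M)).injective p
  rw [RingHom.map_pow, trace_eq_sum_embeddings (AlgebraicClosure M), trace_eq_sum_embeddings (AlgebraicClosure M), sum_pow_char]
  simp

lemma pspan_of_sep [Algebra.IsSeparable M E] {z : Fin n → M} (hz : PSpan p z) :
    PSpan p (fun i => algebraMap M E (z i)) := by
  rw [pspan_iff, AddSubgroup.eq_top_iff']
  intro e
  have : ExpChar M p := ExpChar.prime hp.out
  have h1 := IntermediateField.adjoin_simple_eq_adjoin_pow_expChar_pow_of_isSeparable' M E e p 1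
  have h2 : e ∈ IntermediateField.adjoin M {e ^ p ^ 1} := by
    rw [← h1]; exact IntermediateField.mem_adjoin_simple_self M e
  have h_integral : IsIntegral M (e ^ p ^ 1) := Algebra.IsIntegral.isIntegral _
  rw [pow_one] at h2 h_integral
  have h3 : e ∈ Algebra.adjoin M {e ^ p} := by
    rw [← IntermediateField.adjoin_simple_toSubalgebra_of_isAlgebraic h_integral.isAlgebraic]; exact h2
  rw [Algebra.adjoin_singleton_eq_range_aeval] at h3
  obtain ⟨P, hP⟩ := h3
  have hP' : Polynomial.aeval (e ^ p) P = e := hP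
  rw [← hP', Polynomial.aeval_eq_sum_range]
  refine sum_mem fun j _ => ?_
  obtain ⟨c, hc⟩ := hz (P.coeff j)
  rw [hc, Algebra.smul_def, mul_comm, ← pow_mul, mul_comm p, pow_mul]
  apply psumGrp_smul
  rw [psum, map_sum]
  refine sum_mem fun α _ => ?_
  rw [map_mul, map_pow, ← pmon_map]
  exact psumGrp_mon _ _ _

theorem IsPB.sep [FiniteDimensional M E] [Algebra.IsSeparable M E] {z : Fin n → M} (hz : IsPB p z) :
    ∃ hz' : IsPB p (fun i => algebraMap M E (z i)), ∀ e,
      Algebra.trace M E (hz'.kap e) = hz.kap (Algebra.trace M E e) := by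
  have h1 : ∀ (x : E) (b : Fin n → ℕ), (∀ i, p ∣ b i) →
    (hz.kap.comp (Algebra.trace M E).toAddMonoidHom) (x ^ p * pmon (fun i => algebraMap M E (z i)) b) =
     (Algebra.trace M E).toAddMonoidHom (x * pmon (fun i => algebraMap M E (z i)) (fun i => b i / p)) := by
    intro x b hb
    simp only [pmon_map, AddMonoidHom.comp_apply, LinearMap.toAddMonoidHom_coe]
    rw [mul_comm, ← Algebra.smul_def, LinearMap.map_smul, mul_comm x, ← Algebra.smul_def, LinearMap.map_smul, trace_pow_char (p := p), smul_eq_mul,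
      smul_eq_mul, mul_comm, hz.kap_mon _ _ hb, mul_comm]
  have h2 : ∀ (x : E) (b : Fin n → ℕ), (¬ ∀ i, p ∣ b i) →
    (hz.kap.comp (Algebra.trace M E).toAddMonoidHom) (x ^ p * pmon (fun i => algebraMap M E (z i)) b) = 0 := by
    intro x b hb
    simp only [pmon_map, AddMonoidHom.comp_apply, LinearMap.toAddMonoidHom_coe]
    rw [mul_comm, ← Algebra.smul_def, LinearMap.map_smul, trace_pow_char (p := p), smul_eq_mul, mul_comm, hz.kap_mon_ne _ _ hb]
  have hz' : IsPB p (fun i => algebraMap M E (z i)) := by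
    refine ⟨pindep_of_dual2 _ _ _ (fun i => by simpa using hz.y_ne_zero i) ?_ h1 h2, pspan_of_sep hz.span⟩
    intro x hx
    have := traceForm_nondegenerate M E
    apply this.2 x
    intro e
    exact hx e
  exact ⟨hz', fun e => hz'.kap_of_dual2 _ _ h1 h2 e⟩
end sep
end TD

end

/-! ### TD2 -/

section

section TD2
variable {p : ℕ} [hp : Fact p.Prime]

lemma pmon_update {L : Type*} [Field L] {n : ℕ} (y : Fin n → L) (i : Fin n) (z : L) (b : Fin n → ℕ) :
    pmon (Function.update y i z) b = z ^ b i * pmon y (Function.update b i 0) := by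
  simp only [pmon]
  rw [← Finset.mul_prod_erase _ _ (Finset.mem_univ i), ← Finset.mul_prod_erase _ (fun j => y j ^ (Function.update b i 0 j)) (Finset.mem_univ i)]
  simp only [Function.update_self, pow_zero, one_mul]
  congr 1
  refine Finset.prod_congr rfl fun j hj => ?_
  rw [Function.update_of_ne (Finset.ne_of_mem_erase hj), Function.update_of_ne (Finset.ne_of_mem_erase hj)]

lemma IsPB.exists_del_ne {L : Type*} [Field L] [CharP L p] {n : ℕ} {y : Fin n → L} (hy : IsPB p y)
    (a : L) (ha : ∀ b, b ^ p ≠ a) : ∃ i, hy.del i a ≠ 0 := by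
  by_contra hcon
  push Not at hcon
  have h0 : ∀ i α, ((α i : ℕ) : L) * hy.coef a α = 0 := by
    intro i α
    have h1 : psum p y (fun α => ((α i : ℕ) : L) * hy.coef a α) = 0 := by
      rw [← hcon i]
      change _ = ∑ α, ((α i : ℕ) : L) * (hy.coef a α ^ p * pmon y (fun i => (α i : ℕ)))
      rw [psum]
      refine Finset.sum_congr rfl fun α _ => ?_
      rw [mul_pow, natCast_pow_char, mul_assoc]
    exact congrFun (hy.indep _ h1) α
  have h2 : ∀ α, α ≠ pmod p 0 → hy.coef a α = 0 := by
    intro α hα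
    by_contra hne
    apply hα
    funext i
    have := h0 i α
    rcases mul_eq_zero.1 this with h | h
    · rw [CharP.cast_eq_zero_iff L p] at h
      have := Nat.eq_zero_of_dvd_of_lt h (α i).2
      apply Fin.ext; simp [pmod, this]
    · exact absurd h hne
  apply ha (hy.coef a (pmod p 0))
  conv_rhs => rw [← hy.coef_spec a, psum]
  rw [Finset.sum_eq_single (pmod p 0)]
  · have : (fun i : Fin n => ((pmod p (0 : Fin n → ℕ) i : Fin p) : ℕ)) = 0 := by
      funext i; simp [pmod]
    rw [this, pmon_zero, mul_one]
  · intro β _ hβ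
    rw [h2 β hβ]; simp [hp.out.ne_zero]
  · simp

theorem IsPB.insep_step {E E1 : Type*} [Field E] [Field E1] [CharP E p] [CharP E1 p] [Algebra E E1] {n : ℕ}
    {z : Fin n → E} (hz : IsPB p z) (u : E1) (a : E) (hua : u ^ p = algebraMap E E1 a)
    (ha : ∀ b, b ^ p ≠ a) (bas : Module.Basis (Fin p) E E1) (hbas : ∀ j, bas j = u ^ (j : ℕ)) :
    ∃ (y : Fin n → E1) (hy : IsPB p y) (Λ : E1 →ₗ[E] E), Λ ≠ 0 ∧ ∀ g, Λ (hy.kap g) = hz.kap (Λ g) := by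
  obtain ⟨i, hi⟩ := hz.exists_del_ne a ha
  obtain ⟨hz', hne, hrel⟩ := hz.exchange i a hi
  set h := (pJacLog hz (Function.update z i a)).det
  let y : Fin n → E1 := Function.update (fun j => algebraMap E E1 (z j)) i u
  have ha0 : a ≠ 0 := by rintro rfl; exact ha 0 (by simp [hp.out.ne_zero])
  have hu0 : u ≠ 0 := by
    rintro rfl
    rw [zero_pow hp.out.ne_zero] at hua
    exact ha0 (by simpa using hua.symm)
  have hymon : ∀ b, pmon y b = u ^ b i * algebraMap E E1 (pmon z (Function.update b i 0)) := by
    intro b; rw [pmon_update, pmon_map]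
  have hy0 : ∀ j, y j ≠ 0 := by
    intro j
    by_cases hj : j = i
    · subst hj; simpa [y] using hu0
    · simpa [y, hj] using hz.y_ne_zero j
  let z0 : Fin p := ⟨0, hp.out.pos⟩
  let Λ2 : E1 →ₗ[E] E := bas.coord z0
  have hΛ2u : ∀ (m : ℕ) (hm : m < p), Λ2 (u ^ m) = if m = 0 then 1 else 0 := by
    intro m hm
    have : bas ⟨m, hm⟩ = u ^ m := hbas _
    rw [← this]
    simp only [Λ2, Module.Basis.coord_apply, Module.Basis.repr_self, Finsupp.single_apply, z0, Fin.mk.injEq]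
  have hexp : ∀ x : E1, x = ∑ j, (bas.repr x j) • u ^ (j : ℕ) := by
    intro x; conv_lhs => rw [← bas.sum_repr x]
    simp [hbas]
  let Nm : E1 → E := fun x => ∑ j : Fin p, (bas.repr x j) ^ p * a ^ (j : ℕ)
  have hNm : ∀ x, x ^ p = algebraMap E E1 (Nm x) := by
    intro x
    conv_lhs => rw [hexp x, sum_pow_char]
    simp only [Nm, map_sum]
    refine Finset.sum_congr rfl fun j _ => ?_
    rw [Algebra.smul_def, mul_pow, map_mul, map_pow, map_pow, ← hua]
    ring
  have hK1 : ∀ (x : E1) (b : Fin n → ℕ), (∀ j, p ∣ Function.update b i 0 j) →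
      hz'.kap (Nm x * pmon z (Function.update b i 0)) = Λ2 x * pmon z (fun j => Function.update b i 0 j / p) := by
    intro x b hb
    simp only [Nm, Finset.sum_mul, map_sum]
    have : ∀ j : Fin p, (bas.repr x j) ^ p * a ^ (j : ℕ) * pmon z (Function.update b i 0)
        = (bas.repr x j) ^ p * pmon (Function.update z i a) (Function.update b i j) := by
      intro j
      rw [pmon_update]; simp [mul_assoc]
    simp only [this]
    rw [Finset.sum_eq_single z0]
    · have e : Function.update b i (z0 : ℕ) = Function.update b i 0 := rfl
      rw [e, hz'.kap_mon _ _ hb, pmon_update]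
      simp only [Function.update_self, Nat.zero_div, pow_zero, one_mul]
      congr 2
      funext j
      by_cases hj : j = i
      · subst hj; simp
      · simp [hj]
    · intro j _ hj
      apply hz'.kap_mon_ne
      intro hall
      have := hall i
      rw [Function.update_self] at this
      exact hj (Fin.ext (Nat.eq_zero_of_dvd_of_lt this j.2))
    · simp
  have hK2 : ∀ (x : E1) (b : Fin n → ℕ), (¬ ∀ j, p ∣ Function.update b i 0 j) →
      hz'.kap (Nm x * pmon z (Function.update b i 0)) = 0 := by
    intro x b hb
    simp only [Nm, Finset.sum_mul, map_sum]
    refine Finset.sum_eq_zero fun j _ => ?_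
    have : (bas.repr x j) ^ p * a ^ (j : ℕ) * pmon z (Function.update b i 0)
        = (bas.repr x j) ^ p * pmon (Function.update z i a) (Function.update b i j) := by
      rw [pmon_update]; simp [mul_assoc]
    rw [this]
    apply hz'.kap_mon_ne
    intro hall
    apply hb
    intro l
    have := hall l
    by_cases hl : l = i
    · subst hl; simp
    · simpa [hl] using this
  have hval : ∀ (x : E1) (b : Fin n → ℕ), Λ2 (x ^ p * pmon y b) =
      if p ∣ b i then Nm (x * u ^ (b i / p)) * pmon z (Function.update b i 0) else 0 := by
    intro x b
    have e : x ^ p * pmon y b = (Nm (x * u ^ (b i / p)) * pmon z (Function.update b i 0)) • u ^ (b i % p) := by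
      rw [hymon, Algebra.smul_def, map_mul, ← hNm, mul_pow]
      conv_lhs => rw [← Nat.div_add_mod (b i) p]
      rw [pow_add, ← pow_mul, mul_comm p]; ring
    rw [e, LinearMap.map_smul, hΛ2u _ (Nat.mod_lt _ hp.out.pos), smul_eq_mul]
    simp only [Nat.dvd_iff_mod_eq_zero]
    split_ifs <;> simp
  have h1 : ∀ (x : E1) (b : Fin n → ℕ), (∀ i, p ∣ b i) →
    (hz'.kap.comp Λ2.toAddMonoidHom) (x ^ p * pmon y b) = Λ2.toAddMonoidHom (x * pmon y (fun i => b i / p)) := by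
    intro x b hb
    simp only [AddMonoidHom.comp_apply, LinearMap.toAddMonoidHom_coe]
    rw [hval, if_pos (hb i), hK1, hymon, ← mul_assoc, mul_comm, ← smul_eq_mul, ← LinearMap.map_smul, Algebra.smul_def, mul_comm]
    · congr 3
      congr 1
      funext j
      by_cases hj : j = i
      · subst hj; simp
      · simp [hj]
    · intro j
      by_cases hj : j = i
      · subst hj; simp
      · simpa [hj] using hb j
  have h2 : ∀ (x : E1) (b : Fin n → ℕ), (¬ ∀ i, p ∣ b i) →
    (hz'.kap.comp Λ2.toAddMonoidHom) (x ^ p * pmon y b) = 0 := by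
    intro x b hb
    simp only [AddMonoidHom.comp_apply, LinearMap.toAddMonoidHom_coe]
    rw [hval]
    split_ifs with hbi
    · apply hK2
      intro hall
      apply hb
      intro j
      by_cases hj : j = i
      · subst hj; exact hbi
      · simpa [hj] using hall j
    · simp
  have hspan : PSpan p y := by
    rw [pspan_iff, AddSubgroup.eq_top_iff']
    intro g
    rw [hexp g]
    refine sum_mem fun j _ => ?_
    have hcs := hz'.coef_spec (bas.repr g j)
    rw [psum] at hcs
    rw [← hcs, Finset.sum_smul]
    refine sum_mem fun α _ => ?_
    have : (hz'.coef (bas.repr g j) α ^ p * pmon (Function.update z i a) (fun l => (α l : ℕ))) • u ^ (j : ℕ)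
      = (algebraMap E E1 (hz'.coef (bas.repr g j) α) * u ^ (α i : ℕ)) ^ p * pmon y (Function.update (fun l => (α l : ℕ)) i j) := by
      rw [hymon, pmon_update, Algebra.smul_def]
      simp only [map_mul, map_pow, ← hua, Function.update_self, Function.update_idem]
      ring
    rw [this]
    exact psumGrp_mon _ _ _
  have hy : IsPB p y := by
    refine ⟨pindep_of_dual2 _ _ _ hy0 ?_ h1 h2, hspan⟩
    intro x hx
    by_contra hx0
    have := hx x⁻¹
    rw [inv_mul_cancel₀ hx0] at this
    have h3 := hΛ2u 0 hp.out.pos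
    simp only [LinearMap.toAddMonoidHom_coe] at this
    rw [pow_zero, this] at h3
    simp at h3
  refine ⟨y, hy, h • Λ2, ?_, ?_⟩
  · intro h0
    have h3 := hΛ2u 0 hp.out.pos
    have h4 := congrArg (fun l => l 1) h0
    simp only [LinearMap.smul_apply, LinearMap.zero_apply, smul_eq_mul] at h4
    rw [pow_zero, if_pos rfl] at h3
    rw [h3, mul_one] at h4
    exact hne h4
  · intro g
    simp only [LinearMap.smul_apply, smul_eq_mul]
    rw [hrel]
    congr 1
    exact hy.kap_of_dual2 _ _ h1 h2 g
end TD2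

end

/-! ### TD3 -/

section

section TD3
variable {p : ℕ} [hp : Fact p.Prime]
open Polynomial IntermediateField

theorem IsPB.insep_simple {E L : Type*} [Field E] [Field L] [CharP E p] [CharP L p] [Algebra E L] {n : ℕ}
    {z : Fin n → E} (hz : IsPB p z) (u : L) (a : E) (hua : u ^ p = algebraMap E L a)
    (ha : ∀ b, b ^ p ≠ a) :
    ∃ (y : Fin n → E⟮u⟯) (hy : IsPB p y) (Λ : E⟮u⟯ →ₗ[E] E), Λ ≠ 0 ∧ ∀ g, Λ (hy.kap g) = hz.kap (Λ g) := by
  have hirr := X_pow_sub_C_irreducible_of_prime hp.out ha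
  have hmon : (X ^ p - C a).Monic := monic_X_pow_sub_C a hp.out.ne_zero
  have hmin : minpoly E u = X ^ p - C a :=
    (minpoly.eq_of_irreducible_of_monic hirr (by simp [hua]) hmon).symm
  have h_integral : IsIntegral E u := ⟨X ^ p - C a, hmon, by simp [hua]⟩
  let pb := IntermediateField.adjoin.powerBasis h_integral
  have hdim : pb.dim = p := by
    rw [IntermediateField.adjoin.powerBasis_dim, hmin, natDegree_X_pow_sub_C]
  refine hz.insep_step (IntermediateField.AdjoinSimple.gen E u) a ?_ ha (pb.basis.reindex (finCongr hdim)) ?_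
  · apply Subtype.ext; simpa using hua
  · intro j
    simp [pb]

theorem IsPB.insep : ∀ (m : ℕ) {E L : Type w} [Field E] [Field L] [CharP E p] [CharP L p] [Algebra E L]
    [FiniteDimensional E L] [IsPurelyInseparable E L] (_ : Module.finrank E L ≤ m) {n : ℕ}
    {z : Fin n → E} (hz : IsPB p z),
    ∃ (y : Fin n → L) (hy : IsPB p y) (Λ : L →ₗ[E] E), Λ ≠ 0 ∧ ∀ g, Λ (hy.kap g) = hz.kap (Λ g) := by
  intro m
  induction m with
  | zero =>
    intro E L _ _ _ _ _ _ _ h n z hz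
    have := Module.finrank_pos (R := E) (M := L); omega
  | succ m ih =>
    intro E L _ _ _ _ _ _ _ h n z hz
    have : ExpChar E p := ExpChar.prime hp.out
    have : ExpChar L p := ExpChar.prime hp.out
    by_cases hsurj : Function.Surjective (algebraMap E L)
    · let e : E ≃ₐ[E] L := AlgEquiv.ofBijective (Algebra.ofId E L) ⟨(algebraMap E L).injective, hsurj⟩
      have hsum : ∀ c : (Fin n → Fin p) → L, e.symm (psum p (fun i => e (z i)) c) = psum p z (fun α => e.symm (c α)) := by
        intro c; simp [psum, pmon]
      have hy : IsPB p (fun i => e (z i)) := by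
        constructor
        · intro c hc
          have h1 := hsum c
          rw [hc, map_zero] at h1
          have := hz.indep _ h1.symm
          funext α
          have h2 := congrFun this α
          simpa using h2
        · intro g
          refine ⟨fun α => e (hz.coef (e.symm g) α), ?_⟩
          apply e.symm.injective
          rw [hsum]
          simp [hz.coef_spec]
      refine ⟨_, hy, e.symm.toLinearMap, ?_, ?_⟩
      · intro h0
        have := congrArg (fun l => l 1) h0
        simp at this
      · intro g
        have h1 : ∀ (x : L) (b : Fin n → ℕ), (∀ i, p ∣ b i) →
          (hz.kap.comp e.symm.toLinearMap.toAddMonoidHom) (x ^ p * pmon (fun i => e (z i)) b) = e.symm.toLinearMap.toAddMonoidHom (x * pmon (fun i => e (z i)) (fun i => b i / p)) := by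
          intro x b hb
          have : ∀ b, e.symm (pmon (fun i => e (z i)) b) = pmon z b := fun b => by simp [pmon]
          simp only [AddMonoidHom.comp_apply, LinearMap.toAddMonoidHom_coe, AlgEquiv.toLinearMap_apply, map_mul, map_pow, this]
          rw [hz.kap_mon _ _ hb]
        have h2 : ∀ (x : L) (b : Fin n → ℕ), (¬ ∀ i, p ∣ b i) →
          (hz.kap.comp e.symm.toLinearMap.toAddMonoidHom) (x ^ p * pmon (fun i => e (z i)) b) = 0 := by
          intro x b hb
          have : ∀ b, e.symm (pmon (fun i => e (z i)) b) = pmon z b := fun b => by simp [pmon]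
          simp only [AddMonoidHom.comp_apply, LinearMap.toAddMonoidHom_coe, AlgEquiv.toLinearMap_apply, map_mul, map_pow, this]
          rw [hz.kap_mon_ne _ _ hb]
        exact hy.kap_of_dual2 _ _ h1 h2 g
    · rw [Function.Surjective] at hsurj
      push Not at hsurj
      obtain ⟨l, hl⟩ := hsurj
      have hex : ∃ j : ℕ, l ^ p ^ j ∈ (algebraMap E L).range := IsPurelyInseparable.pow_mem E p l
      classical
      obtain ⟨j, hj, hjmin⟩ : ∃ j : ℕ, l ^ p ^ (j+1) ∈ (algebraMap E L).range ∧ l ^ p ^ j ∉ (algebraMap E L).range := by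
        have h1 := Nat.find_spec hex
        have h2 : Nat.find hex ≠ 0 := by
          intro h0
          rw [h0] at h1
          obtain ⟨e, he⟩ := h1
          exact hl e (by simpa using he)
        obtain ⟨j, hj⟩ := Nat.exists_eq_succ_of_ne_zero h2
        refine ⟨j, ?_, Nat.find_min hex (by omega)⟩
        rw [hj] at h1; exact h1
      obtain ⟨a, ha⟩ := hj
      set u := l ^ p ^ j with hu
      have hua : u ^ p = algebraMap E L a := by rw [ha, hu, ← pow_mul, pow_succ]
      have hna : ∀ b, b ^ p ≠ a := by
        intro b hb
        apply hjmin
        refine ⟨b, ?_⟩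
        apply frobenius_inj L p
        simp only [frobenius_def]
        rw [hua, ← hb, map_pow]
      obtain ⟨y1, hy1, Λ1, hΛ1, hc1⟩ := hz.insep_simple (L := L) u a hua hna
      have hfr : Module.finrank E E⟮u⟯ * Module.finrank E⟮u⟯ L = Module.finrank E L := Module.finrank_mul_finrank E E⟮u⟯ L
      have h1 : 1 < Module.finrank E E⟮u⟯ := by
        have hpos := Module.finrank_pos (R := E) (M := E⟮u⟯)
        by_contra hcon
        have h1 : Module.finrank E E⟮u⟯ = 1 := by omega
        rw [IntermediateField.finrank_adjoin_simple_eq_one_iff, IntermediateField.mem_bot] at h1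
        exact hjmin h1
      have hle : Module.finrank E⟮u⟯ L ≤ m := by
        have : 2 * Module.finrank E⟮u⟯ L ≤ Module.finrank E L := by
          rw [← hfr]; exact Nat.mul_le_mul_right _ h1
        have := Module.finrank_pos (R := E⟮u⟯) (M := L)
        omega
      have : IsPurelyInseparable E⟮u⟯ L := IsPurelyInseparable.tower_top E E⟮u⟯ L
      obtain ⟨y, hy, Λ2, hΛ2, hc2⟩ := ih hle hy1
      refine ⟨y, hy, Λ1 ∘ₗ (Λ2.restrictScalars E), ?_, ?_⟩
      · intro h0
        obtain ⟨x, hx⟩ : ∃ x, Λ2 x ≠ 0 := by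
          by_contra hcon; push Not at hcon
          exact hΛ2 (LinearMap.ext hcon)
        apply hΛ1
        ext v
        have h3 := congrArg (fun q => q ((v * (Λ2 x)⁻¹) • x)) h0
        simp only [LinearMap.comp_apply, LinearMap.restrictScalars_apply, LinearMap.map_smul, LinearMap.zero_apply, smul_eq_mul] at h3
        rw [mul_assoc, inv_mul_cancel₀ hx, mul_one] at h3
        simpa using h3
      · intro g
        simp only [LinearMap.comp_apply, LinearMap.restrictScalars_apply]
        rw [hc2, hc1]

/-- Theorem D -/
theorem IsPB.thmD {M L : Type*} [Field M] [Field L] [CharP M p] [CharP L p] [Algebra M L]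
    [FiniteDimensional M L] {n : ℕ} {z : Fin n → M} (hz : IsPB p z) :
    ∃ (y : Fin n → L) (hy : IsPB p y) (Λ : L →ₗ[separableClosure M L] (separableClosure M L)), Λ ≠ 0 ∧
      ∀ g, Algebra.trace M (separableClosure M L) (Λ (hy.kap g)) =
        hz.kap (Algebra.trace M (separableClosure M L) (Λ g)) := by
  obtain ⟨hz', htr⟩ := hz.sep (E := separableClosure M L)
  have : CharP (separableClosure M L) p := inferInstance
  obtain ⟨y, hy, Λ, hΛ, hc⟩ := IsPB.insep _ (E := separableClosure M L) (L := L) le_rfl hz'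
  exact ⟨y, hy, Λ, hΛ, fun g => by rw [hc, htr]⟩
end TD3

end

/-! ### PBt -/

section

section PBt
open Polynomial IntermediateField

/-- elements of `F(t)` are quotients of polynomials in t -/
lemma exists_quot_of_top {F M : Type*} [Field F] [Field M] [Algebra F M] (t : M)
    (htop : F⟮t⟯ = ⊤) (g : M) : ∃ P Q : F[X], aeval t Q ≠ 0 ∧ g = aeval t P / aeval t Q := by
  have hg : g ∈ F⟮t⟯ := by rw [htop]; trivial
  rw [IntermediateField.mem_adjoin_simple_iff] at hg
  obtain ⟨P, Q, h⟩ := hg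
  by_cases hQ : aeval t Q = 0
  · exact ⟨0, 1, by simp, by simp [h, hQ]⟩
  · exact ⟨P, Q, hQ, h⟩

variable {p : ℕ} [hp : Fact p.Prime] {F M : Type*} [Field F] [Field M] [CharP F p] [CharP M p] [Algebra F M] {r : ℕ}

lemma pmon_cons (t : M) (b : Fin r → M) (a : Fin (r+1) → ℕ) :
    pmon (Fin.cons t b : Fin (r+1) → M) a = t ^ a 0 * pmon b (fun i => a i.succ) := by
  simp [pmon, Fin.prod_univ_succ]

theorem IsPB.ratFunc {b : Fin r → F} (hb : IsPB p b) (t : M) (ht : Transcendental F t) (htop : F⟮t⟯ = ⊤) :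
    IsPB p (Fin.cons t (fun i => algebraMap F M (b i)) : Fin (r+1) → M) := by
  set z : Fin (r+1) → M := Fin.cons t (fun i => algebraMap F M (b i)) with hz
  have hinj : Function.Injective (aeval (R := F) t) := transcendental_iff_injective.1 ht
  constructor
  · intro c hc
    have : ∀ α, ∃ P Q : F[X], aeval t Q ≠ 0 ∧ c α = aeval t P / aeval t Q := fun α => exists_quot_of_top t htop (c α)
    choose P Q hQ hPQ using this
    -- common denominator
    let R : (Fin (r+1) → Fin p) → F[X] := fun α => P α * ∏ β ∈ Finset.univ.erase α, Q β
    have hR : ∀ α, aeval t (R α) = c α * aeval t (∏ β, Q β) := by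
      intro α
      rw [hPQ, ← Finset.mul_prod_erase _ _ (Finset.mem_univ α), map_mul, map_mul]
      field_simp [hQ α]
    have hQ0 : aeval t (∏ β, Q β) ≠ 0 := by
      rw [map_prod]; exact Finset.prod_ne_zero_iff.2 fun β _ => hQ β
    have h0 : ∑ α : Fin (r+1) → Fin p, (R α) ^ p * (C (pmon b (fun i => (α i.succ : ℕ))) * X ^ (α 0 : ℕ)) = 0 := by
      apply hinj
      rw [map_zero, map_sum]
      have h1 : (aeval t (∏ β, Q β)) ^ p * psum p z c = 0 := by rw [hc, mul_zero]
      rw [← h1, psum, Finset.mul_sum]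
      refine Finset.sum_congr rfl fun α _ => ?_
      rw [map_mul, map_pow, hR, hz, pmon_cons, pmon_map]
      simp only [map_mul, aeval_C, map_pow, aeval_X]
      ring
    have hcoef : ∀ (f : F[X]) (w : F) (l j : Fin p) (m : ℕ), (f ^ p * (C w * X ^ (l : ℕ))).coeff (p * m + j) =
        if l = j then f.coeff m ^ p * w else 0 := by
      intro f w l j m
      rw [← map_frobenius_expand, ← mul_assoc, coeff_mul_X_pow', coeff_mul_C, coeff_map]
      split_ifs with h1 h2 h2
      · subst h2
        rw [Nat.add_sub_cancel, mul_comm p, coeff_expand_mul hp.out.pos, frobenius_def]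
      · rw [coeff_expand hp.out.pos, if_neg]
        · simp
        · intro hd
          apply h2
          have hj := j.2
          have hl := l.2
          rcases le_or_gt (l : ℕ) j with hlj | hlj
          · rw [Nat.add_sub_assoc hlj, Nat.dvd_add_right (Dvd.intro _ rfl)] at hd
            have := Nat.eq_zero_of_dvd_of_lt hd (by omega)
            apply Fin.ext; omega
          · have : p ∣ p * m - (l - j) := by
              have e : p * m + j - l = p * m - (l - j) := by omega
              rwa [e] at hd
            have h5 : (l : ℕ) - j ≤ p * m := by omega
            have := (Nat.dvd_sub_iff_right h5 (Dvd.intro _ rfl)).1 this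
            have := Nat.eq_zero_of_dvd_of_lt this (by omega)
            omega
      · subst h2; omega
      · rfl
    have hRz : ∀ α m, (R α).coeff m = 0 := by
      intro α m
      have h1 := congrArg (fun q => q.coeff (p * m + (α 0 : ℕ))) h0
      simp only [finsetSum_coeff, hcoef, coeff_zero] at h1
      rw [← (Fin.consEquiv (fun _ => Fin p)).sum_comp, Fintype.sum_prod_type] at h1
      simp only [Fin.consEquiv_apply, Fin.cons_zero, Fin.cons_succ] at h1
      rw [Finset.sum_eq_single (α 0)] at h1
      · simp only [if_true] at h1
        have h2 := hb.indep (fun β => (R (Fin.cons (α 0) β)).coeff m) h1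
        have h3 := congrFun h2 (fun i => α i.succ)
        have e : (Fin.cons (α 0) (fun i => α i.succ) : Fin (r+1) → Fin p) = α := Fin.cons_self_tail α
        simpa [e] using h3
      · intro j _ hj
        simp [hj]
      · simp
    funext α
    have : R α = 0 := by ext m; simp [hRz]
    have h3 := hR α
    rw [this, map_zero] at h3
    exact (mul_eq_zero.1 h3.symm).resolve_right hQ0
  · rw [pspan_iff, AddSubgroup.eq_top_iff']
    have hpol : ∀ P : F[X], aeval t P ∈ psumGrp p z := by
      intro P
      rw [aeval_eq_sum_range]
      refine sum_mem fun i _ => ?_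
      rw [← hb.coef_spec (P.coeff i), psum, Finset.sum_smul]
      refine sum_mem fun α _ => ?_
      have := psumGrp_mon (p := p) z (algebraMap F M (hb.coef (P.coeff i) α)) (Fin.cons i (fun j => (α j : ℕ)) : Fin (r+1) → ℕ)
      rw [hz, pmon_cons, pmon_map] at this
      simp only [Fin.cons_zero, Fin.cons_succ] at this
      rw [Algebra.smul_def, map_mul, map_pow]
      convert this using 1
      ring
    intro g
    obtain ⟨P, Q, hQ, rfl⟩ := exists_quot_of_top t htop g
    have : aeval t P / aeval t Q = ((aeval t Q)⁻¹) ^ p * aeval t (P * Q ^ (p - 1)) := by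
      have e : (aeval t Q) ^ p = (aeval t Q) ^ (p-1) * aeval t Q := by rw [← pow_succ, Nat.sub_add_cancel hp.out.one_le]
      rw [inv_pow, e, map_mul, map_pow]
      field_simp
    rw [this]
    exact psumGrp_smul _ _ (hpol _)

lemma IsPB.ratFunc_kap {b : Fin r → F} (hb : IsPB p b) {t : M} (ht0 : t ≠ 0)
    (hz : IsPB p (Fin.cons t (fun i => algebraMap F M (b i)) : Fin (r+1) → M)) (a : F) (i : ℕ) :
    ∃ c : F, hz.kap (algebraMap F M a * t ^ i) = algebraMap F M c * t ^ (i / p) ∧ (¬ p ∣ i → c = 0) := by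
  induction a using hb.ind with
  | h0 => exact ⟨0, by simp⟩
  | hadd a a' h1 h2 =>
    obtain ⟨c, hc, hc0⟩ := h1
    obtain ⟨c', hc', hc0'⟩ := h2
    refine ⟨c + c', ?_, fun h => by rw [hc0 h, hc0' h, add_zero]⟩
    rw [map_add, add_mul, map_add, hc, hc', map_add, add_mul]
  | hm c a =>
    have e : algebraMap F M (c ^ p * pmon b a) * t ^ i =
      (algebraMap F M c) ^ p * pmon (Fin.cons t (fun i => algebraMap F M (b i)) : Fin (r+1) → M) (Fin.cons i a : Fin (r+1) → ℕ) := by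
      rw [pmon_cons, pmon_map, map_mul, map_pow]
      simp only [Fin.cons_zero, Fin.cons_succ]
      ring
    rw [e]
    by_cases h : ∀ j, p ∣ (Fin.cons i a : Fin (r+1) → ℕ) j
    · rw [hz.kap_mon _ _ h, pmon_cons, pmon_map]
      refine ⟨c * pmon b (fun j => a j / p), ?_, fun h' => absurd (h 0) h'⟩
      simp only [Fin.cons_zero, Fin.cons_succ, map_mul]
      ring
    · rw [hz.kap_mon_ne _ _ h]
      exact ⟨0, by simp⟩

lemma IsPB.ratFunc_kap_inv {b : Fin r → F} (hb : IsPB p b) {t : M} (ht0 : t ≠ 0)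
    (hz : IsPB p (Fin.cons t (fun i => algebraMap F M (b i)) : Fin (r+1) → M)) (a : F) (i : ℕ) :
    ∃ c : F, hz.kap (algebraMap F M a * t⁻¹ ^ i) = algebraMap F M c * t⁻¹ ^ (i / p) ∧ (¬ p ∣ i → c = 0) := by
  obtain ⟨c, hc, hc0⟩ := hb.ratFunc_kap ht0 hz a ((p-1) * i)
  have e : algebraMap F M a * t⁻¹ ^ i = (t⁻¹ ^ i) ^ p * (algebraMap F M a * t ^ ((p-1)*i)) := by
    obtain ⟨q, hq⟩ : ∃ q, p = q + 1 := ⟨p-1, (Nat.sub_add_cancel hp.out.one_le).symm⟩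
    rw [hq, Nat.add_sub_cancel, pow_succ, ← pow_mul, mul_comm i q]
    have : t⁻¹ ^ (q * i) * t ^ (q * i) = 1 := by rw [← mul_pow, inv_mul_cancel₀ ht0, one_pow]
    linear_combination (-(algebraMap F M a * t⁻¹ ^ i)) * this
  refine ⟨c, ?_, ?_⟩
  · rw [e, hz.kap_pow_mul, hc]
    by_cases h : p ∣ i
    · obtain ⟨m, rfl⟩ := h
      obtain ⟨q, hq⟩ : ∃ q, p = q + 1 := ⟨p-1, (Nat.sub_add_cancel hp.out.one_le).symm⟩
      have e1 : (p-1) * (p * m) / p = (p-1) * m := by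
        rw [mul_left_comm, Nat.mul_div_cancel_left _ hp.out.pos]
      rw [e1, Nat.mul_div_cancel_left _ hp.out.pos, hq, Nat.add_sub_cancel, add_mul, pow_add, one_mul]
      have : t⁻¹ ^ (q * m) * t ^ (q * m) = 1 := by rw [← mul_pow, inv_mul_cancel₀ ht0, one_pow]
      linear_combination (algebraMap F M c * t⁻¹ ^ m) * this
    · rw [hc0]
      · simp
      · intro hd
        apply h
        refine (Nat.Coprime.dvd_of_dvd_mul_left ?_ hd)
        have := (Nat.coprime_self_sub_right hp.out.one_le).2 (Nat.coprime_one_right p)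
        exact this
  · intro h
    apply hc0
    intro hd
    apply h
    refine (Nat.Coprime.dvd_of_dvd_mul_left ?_ hd)
    exact (Nat.coprime_self_sub_right hp.out.one_le).2 (Nat.coprime_one_right p)
end PBt

end

/-! ### PBex -/

section

section PBex
open Polynomial IntermediateField Cardinal

lemma gen_top {F M : Type*} [Field F] [Field M] [Algebra F M] (x : M) :
    F⟮AdjoinSimple.gen F x⟯ = (⊤ : IntermediateField F F⟮x⟯) := by
  apply lift_injective F⟮x⟯
  rw [lift_adjoin_simple, lift_top]; rfl

lemma trdeg_simple_le_one {F M : Type*} [Field F] [Field M] [Algebra F M] (t : M) (htop : F⟮t⟯ = ⊤) :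
    Algebra.trdeg F M ≤ 1 := by
  have : Algebra.IsAlgebraic (Algebra.adjoin F {t}) M := by
    constructor
    intro g
    obtain ⟨P, Q, hQ, rfl⟩ := exists_quot_of_top t htop g
    have h : ∀ P : F[X], IsAlgebraic (Algebra.adjoin F {t}) (aeval t P) := by
      intro P
      have : aeval t P ∈ Algebra.adjoin F {t} := aeval_mem_adjoin_singleton F t
      exact isAlgebraic_algebraMap (⟨_, this⟩ : Algebra.adjoin F {t})
    rw [div_eq_mul_inv]
    exact (h P).mul (h Q).inv
  refine (Algebra.IsAlgebraic.trdeg_le_cardinalMk F ({t} : Set M)).trans (by simp)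

theorem exists_isPB {p : ℕ} [hp : Fact p.Prime] {k F : Type*} [Field k] [Field F] [PerfectField k] [CharP k p] [CharP F p]
    [Algebra k F] (hfg : (⊤ : IntermediateField k F).FG) :
    ∃ (r : ℕ) (b : Fin r → F), IsPB p b ∧ Algebra.trdeg k F ≤ r := by
  have key : ∀ K : IntermediateField k F, K.FG → ∃ (r : ℕ) (b : Fin r → K), IsPB p b ∧ Algebra.trdeg k K ≤ r := by
    intro K hK
    refine induction_on_adjoin_fg (F := k) (E := F) (fun K => ∃ (r : ℕ) (b : Fin r → K), IsPB p b ∧ Algebra.trdeg k K ≤ r) ?_ ?_ K hK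
    · refine ⟨0, Fin.elim0, ⟨?_, ?_⟩, ?_⟩
      · intro c hc
        funext α
        rw [psum, Fintype.sum_eq_single α (fun β hβ => absurd (Subsingleton.elim _ _) hβ)] at hc
        simpa [pmon, hp.out.ne_zero] using hc
      · intro g
        obtain ⟨a, ha⟩ := (botEquiv k F).symm.surjective g
        have : ExpChar k p := ExpChar.prime hp.out
        obtain ⟨c, hc⟩ := surjective_frobenius k p a
        refine ⟨fun _ => (botEquiv k F).symm c, ?_⟩
        rw [← ha, ← hc]
        simp [psum, pmon, frobenius_def]
      · have : Algebra.IsAlgebraic k (⊥ : IntermediateField k F) := inferInstance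
        rw [_root_.trdeg_eq_zero]; simp
    · rintro K x ⟨r, b, hb, hr⟩
      change ∃ (r : ℕ) (b : Fin r → K⟮x⟯), IsPB p b ∧ Algebra.trdeg k K⟮x⟯ ≤ r
      have hfs : FaithfulSMul K K⟮x⟯ := (faithfulSMul_iff_algebraMap_injective _ _).2 (algebraMap K K⟮x⟯).injective
      have htr := _root_.trdeg_add_eq k K (A := K⟮x⟯)
      by_cases hx : IsAlgebraic K x
      · have h_integral := hx.isIntegral
        have : FiniteDimensional K K⟮x⟯ := adjoin.finiteDimensional h_integral
        obtain ⟨y, hy, -⟩ := hb.thmD (L := K⟮x⟯)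
        refine ⟨r, y, hy, ?_⟩
        rw [← htr, _root_.trdeg_eq_zero (R := K), add_zero]; exact hr
      · refine ⟨r + 1, _, hb.ratFunc (M := K⟮x⟯) (AdjoinSimple.gen K x) ?_ (gen_top x), ?_⟩
        · intro h
          apply hx
          exact (isAlgebraic_algebraMap_iff (algebraMap K⟮x⟯ F).injective (R := K) (a := AdjoinSimple.gen K x)).2 h
        · rw [← htr]; push_cast
          exact add_le_add hr (trdeg_simple_le_one _ (gen_top x))
  obtain ⟨r, b, hb, hr⟩ := key ⊤ hfg
  let e : (⊤ : IntermediateField k F) ≃ₐ[k] F := topEquiv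
  refine ⟨r, fun i => e (b i), ⟨?_, ?_⟩, ?_⟩
  · intro c hc
    have h1 := hb.indep (fun α => e.symm (c α)) (by
      apply e.injective
      rw [map_zero, ← hc]; simp [psum, pmon])
    funext α
    have h2 := congrFun h1 α
    simpa using h2
  · intro g
    obtain ⟨c, hc⟩ := hb.span (e.symm g)
    refine ⟨fun α => e (c α), ?_⟩
    apply e.symm.injective
    rw [hc]; simp [psum, pmon]
  · rw [← e.trdeg_eq]; exact hr
end PBex

end

/-! ### G1 -/

section

section G1
open Matrix

theorem plucker {α β ι R : Type*} [Fintype α] [Fintype β] [Fintype ι] [DecidableEq α] [DecidableEq β] [DecidableEq ι] [CommRing R]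
    (e e' : α ⊕ β ≃ ι) (A : Matrix β ι R) (U : Matrix ι α R) (hAU : A * U = 0) :
    (U.submatrix (e' ∘ Sum.inl) id).det * (A.submatrix id (e ∘ Sum.inr)).det =
     ((Equiv.Perm.sign (e'.trans e.symm) : ℤ) : R) * ((A.submatrix id (e' ∘ Sum.inr)).det * (U.submatrix (e ∘ Sum.inl) id).det) := by
  classical
  let σ : Equiv.Perm (α ⊕ β) := e'.trans e.symm
  have hσ : ∀ a, e (σ a) = e' a := fun a => by simp [σ]
  let W : Matrix (α ⊕ β) (α ⊕ β) R := fromBlocks (U.submatrix (e ∘ Sum.inl) id) 0 (U.submatrix (e ∘ Sum.inr) id) 1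
  let V : Matrix (α ⊕ β) (α ⊕ β) R := Matrix.of fun r s => Sum.elim (fun a => if s = σ (Sum.inl a) then (1:R) else 0) (fun b => A b (e s)) r
  have hW : W.det = (U.submatrix (e ∘ Sum.inl) id).det := by
    simp [W, det_fromBlocks_zero₁₂]
  have hV : (V.submatrix id σ).det = (A.submatrix id (e' ∘ Sum.inr)).det := by
    have : V.submatrix id σ = fromBlocks 1 0 (A.submatrix id (e' ∘ Sum.inl)) (A.submatrix id (e' ∘ Sum.inr)) := by
      ext (a | b) (a' | b')
      · simp [V, Matrix.one_apply, eq_comm]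
      · simp [V]
      · simp [V, hσ]
      · simp [V, hσ]
    rw [this, det_fromBlocks_zero₁₂]; simp
  have hV2 : (V.submatrix id σ).det = ((Equiv.Perm.sign σ : ℤ) : R) * V.det := det_permute' σ V
  have hVW : V * W = fromBlocks (U.submatrix (e' ∘ Sum.inl) id) (Matrix.of fun a b => W (σ (Sum.inl a)) (Sum.inr b)) 0 (A.submatrix id (e ∘ Sum.inr)) := by
    ext (a | b) (a' | b')
    · simp only [Matrix.mul_apply, V, of_apply, Sum.elim_inl, ite_mul, one_mul, zero_mul, Finset.sum_ite_eq', Finset.mem_univ, if_true, fromBlocks_apply₁₁, submatrix_apply]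
      have h := hσ (Sum.inl a)
      rcases h' : σ (Sum.inl a) with q | q <;> rw [h'] at h <;> simp [W, ← h]
    · simp [Matrix.mul_apply, V]
    · have := congrFun (congrFun hAU b) a'
      rw [Matrix.mul_apply, ← e.sum_comp, Fintype.sum_sum_type] at this
      simp only [Matrix.mul_apply, V, W, of_apply, Sum.elim_inr, Fintype.sum_sum_type]
      simpa using this
    · simp only [Matrix.mul_apply, V, W, of_apply, Sum.elim_inr, Fintype.sum_sum_type]
      simp [Matrix.one_apply]
  have h1 := congrArg det hVW
  rw [det_mul, det_fromBlocks_zero₂₁, hW] at h1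
  rw [← h1, ← hV, hV2]
  have : ((Equiv.Perm.sign σ : ℤ) : R) * ((Equiv.Perm.sign σ : ℤ) : R) = 1 := by
    rw [← Int.cast_mul, ← Units.val_mul, Int.units_mul_self]; simp
  change _ = ((Equiv.Perm.sign σ : ℤ) : R) * _
  linear_combination (-(V.det * (U.submatrix (e ∘ Sum.inl) id).det)) * this

end G1

end

/-! ### G2 -/

section

section G2
open Matrix MvPolynomial

variable {k L : Type*} [Field k] [Field L] [Algebra k L] {ι : Type*} [Fintype ι]

lemma der_aeval (D : Derivation ℤ L L) (hD : ∀ a, D (algebraMap k L a) = 0) (x : ι → L) (P : MvPolynomial ι k) :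
    D (aeval x P) = ∑ j, aeval x (pderiv j P) * D (x j) := by
  classical
  induction P using MvPolynomial.induction_on with
  | C a => simp [hD]
  | add p q hp hq => simp [hp, hq, add_mul, Finset.sum_add_distrib]
  | mul_X p i hp =>
    simp only [map_mul, aeval_X, Derivation.leibniz, hp, smul_eq_mul, pderiv_X, map_add, Finset.mul_sum, add_mul, Finset.sum_add_distrib]
    congr 1
    · rw [Finset.sum_eq_single i]
      · simp
      · intro b _ hb; simp [Pi.single_apply, hb.symm]
      · simp
    · exact Finset.sum_congr rfl fun j _ => by ring

lemma homog_aeval_smul {P : MvPolynomial ι k} {d : ℕ} (h : P.IsHomogeneous d) (l : L) (x : ι → L) :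
    aeval (fun i => l * x i) P = l ^ d * aeval x P := by
  rw [aeval_def, aeval_def, eval₂_eq', eval₂_eq', Finset.mul_sum]
  refine Finset.sum_congr rfl fun m hm => ?_
  have h1 := h (mem_support_iff.1 hm)
  simp only [mul_pow, Finset.prod_mul_distrib, Finset.prod_pow_eq_pow_sum]
  have : ∑ i, m i = d := by
    rw [← h1, Finsupp.weight_apply, Finsupp.sum_fintype] <;> simp
  rw [this]; ring

/-- Jacobian matrix at `x`. -/
noncomputable def jacM {c : ℕ} (f : Fin c → MvPolynomial ι k) (x : ι → L) : Matrix (Fin c) ι L :=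
  Matrix.of fun i j => aeval x (pderiv j (f i))

/-- The matrix of `x` and its derivatives. -/
noncomputable def derM {m : ℕ} (δ : Fin m → Derivation ℤ L L) (x : ι → L) : Matrix ι (Unit ⊕ Fin m) L :=
  Matrix.of fun j => Sum.elim (fun _ => x j) (fun i => δ i (x j))

lemma jacM_mul_derM {c : ℕ} {d : Fin c → ℕ} {f : Fin c → MvPolynomial ι k} (hf : ∀ i, (f i).IsHomogeneous (d i))
    {m : ℕ} (δ : Fin m → Derivation ℤ L L) (hδ : ∀ i a, δ i (algebraMap k L a) = 0)
    (x : ι → L) (hx : ∀ i, aeval x (f i) = 0) : jacM f x * derM δ x = 0 := by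
  ext i (a | a)
  · have := congrArg (aeval x) (hf i).sum_X_mul_pderiv
    simp only [map_sum, map_mul, aeval_X, map_nsmul, hx, smul_zero] at this
    simpa [Matrix.mul_apply, jacM, derM, mul_comm] using this
  · have := der_aeval (δ a) (hδ a) x (f i)
    rw [hx, map_zero] at this
    simpa [Matrix.mul_apply, jacM, derM] using this.symm

lemma jacM_smul {c : ℕ} {d : Fin c → ℕ} {f : Fin c → MvPolynomial ι k} (hf : ∀ i, (f i).IsHomogeneous (d i))
    (l : L) (x : ι → L) : jacM f (fun i => l * x i) = Matrix.diagonal (fun i => l ^ (d i - 1)) * jacM f x := by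
  ext i j
  rw [Matrix.diagonal_mul]
  simp only [jacM, of_apply]
  exact homog_aeval_smul (hf i).pderiv l x

lemma derM_smul {m : ℕ} (δ : Fin m → Derivation ℤ L L) (l : L) (x : ι → L) :
    derM δ (fun i => l * x i) = derM δ x * (fromBlocks (Matrix.of fun _ _ => l) (Matrix.of fun _ i => δ i l) 0 (Matrix.diagonal fun _ => l) : Matrix (Unit ⊕ Fin m) (Unit ⊕ Fin m) L) := by
  ext j (a | a)
  · simp [Matrix.mul_apply, derM, mul_comm]
  · simp [Matrix.mul_apply, derM, Matrix.diagonal_apply, Finset.sum_ite_eq, mul_comm, add_comm]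

lemma det_derM_smul {m c : ℕ} (e : (Unit ⊕ Fin m) ⊕ Fin c ≃ ι) (δ : Fin m → Derivation ℤ L L) (l : L) (x : ι → L) :
    ((derM δ (fun i => l * x i)).submatrix (e ∘ Sum.inl) id).det = l ^ (m + 1) * ((derM δ x).submatrix (e ∘ Sum.inl) id).det := by
  rw [derM_smul]
  have : ∀ (W : Matrix (Unit ⊕ Fin m) (Unit ⊕ Fin m) L), (derM δ x * W).submatrix (e ∘ Sum.inl) id = (derM δ x).submatrix (e ∘ Sum.inl) id * W := by
    intro W; ext i j; simp [Matrix.mul_apply]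
  rw [this, det_mul, det_fromBlocks_zero₂₁]
  simp [Matrix.det_unique]; ring

lemma det_jacM_smul {m c : ℕ} {d : Fin c → ℕ} {f : Fin c → MvPolynomial ι k} (hf : ∀ i, (f i).IsHomogeneous (d i))
    (e : (Unit ⊕ Fin m) ⊕ Fin c ≃ ι) (l : L) (x : ι → L) :
    ((jacM f (fun i => l * x i)).submatrix id (e ∘ Sum.inr)).det = l ^ (∑ i, (d i - 1)) * ((jacM f x).submatrix id (e ∘ Sum.inr)).det := by
  rw [jacM_smul hf]
  have : ∀ (W : Matrix (Fin c) (Fin c) L), (W * jacM f x).submatrix id (e ∘ Sum.inr) = W * (jacM f x).submatrix id (e ∘ Sum.inr) := by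
    intro W; ext i j; simp [Matrix.mul_apply]
  rw [this, det_mul, det_diagonal, Finset.prod_pow_eq_pow_sum]

lemma det_derM_one {m c : ℕ} (e : (Unit ⊕ Fin m) ⊕ Fin c ≃ ι) (δ : Fin m → Derivation ℤ L L) (x : ι → L)
    (h1 : x (e (Sum.inl (Sum.inl ()))) = 1) :
    ((derM δ x).submatrix (e ∘ Sum.inl) id).det = (Matrix.of fun i j => δ i (x (e (Sum.inl (Sum.inr j))))).det := by
  have : (derM δ x).submatrix (e ∘ Sum.inl) id = fromBlocks 1 0 (Matrix.of fun j _ => x (e (Sum.inl (Sum.inr j)))) (Matrix.of fun i j => δ i (x (e (Sum.inl (Sum.inr j)))))ᵀ := by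
    ext (a | a) (b | b) <;> simp [derM, h1]
  rw [this, det_fromBlocks_zero₁₂, det_transpose]; simp

end G2

end

/-! ### G3 -/

section

section G3
open Matrix MvPolynomial

lemma exists_equiv_of_inj {ι : Type*} [Fintype ι] {n c : ℕ} (hcard : Fintype.card ι = n + 1 + c) (j : ι) (τ : Fin c → ι)
    (hτ : Function.Injective τ) (hj : ∀ b, τ b ≠ j) :
    ∃ e : (Unit ⊕ Fin n) ⊕ Fin c ≃ ι, e (Sum.inl (Sum.inl ())) = j ∧ ∀ b, e (Sum.inr b) = τ b := by
  classical
  let g : Unit ⊕ Fin c → ι := Sum.elim (fun _ => j) τ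
  have hg : Function.Injective g := by
    rintro (a | a) (b | b) h
    · rfl
    · exact absurd h.symm (hj b)
    · exact absurd h (hj a)
    · exact congrArg _ (hτ h)
  let e1 : Unit ⊕ Fin c ≃ Set.range g := Equiv.ofInjective g hg
  have hc2 : Fintype.card ((Set.range g)ᶜ : Set ι) = n := by
    rw [Fintype.card_compl_set, ← Fintype.card_congr e1, hcard]; simp; omega
  let e2 : Fin n ≃ ((Set.range g)ᶜ : Set ι) := (Fintype.equivFinOfCardEq hc2).symm
  let e3 : (Unit ⊕ Fin c) ⊕ Fin n ≃ ι := (Equiv.sumCongr e1 e2).trans (Equiv.Set.sumCompl _)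
  let e4 : (Unit ⊕ Fin n) ⊕ Fin c ≃ (Unit ⊕ Fin c) ⊕ Fin n :=
    (Equiv.sumAssoc _ _ _).trans ((Equiv.sumCongr (Equiv.refl _) (Equiv.sumComm _ _)).trans (Equiv.sumAssoc _ _ _).symm)
  refine ⟨e4.trans e3, ?_, ?_⟩
  · simp [e4, e3, e1, g]
  · intro b; simp [e4, e3, e1, g]

lemma exists_minor {K : Type*} [Field K] {ι : Type*} [Fintype ι] {c n : ℕ} (hcard : Fintype.card ι = n + 1 + c)
    (A : Matrix (Fin c) ι K) (hA : A.rank = c) (a : ι → K) (hAa : A.mulVec a = 0) (j : ι) (haj : a j = 1) :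
    ∃ e : (Unit ⊕ Fin n) ⊕ Fin c ≃ ι, e (Sum.inl (Sum.inl ())) = j ∧ (A.submatrix id (e ∘ Sum.inr)).det ≠ 0 := by
  classical
  let v : {i // i ≠ j} → (Fin c → K) := fun i => A.col i
  have hspan : Submodule.span K (Set.range v) = ⊤ := by
    have h1 : Submodule.span K (Set.range A.col) = ⊤ := by
      apply Submodule.eq_top_of_finrank_eq
      rw [← Matrix.rank_eq_finrank_span_cols, hA]; simp
    rw [eq_top_iff, ← h1, Submodule.span_le]
    rintro _ ⟨i, rfl⟩
    by_cases hi : i = j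
    · subst hi
      have h2 : A.col i = - ∑ l ∈ Finset.univ.erase i, a l • A.col l := by
        rw [Matrix.mulVec_eq_sum] at hAa
        rw [← Finset.add_sum_erase _ _ (Finset.mem_univ i), haj] at hAa
        have := eq_neg_of_add_eq_zero_left hAa
        simpa [Matrix.col, Matrix.transpose] using this
      rw [h2]
      refine Submodule.neg_mem _ (Submodule.sum_mem _ fun l hl => Submodule.smul_mem _ _ (Submodule.subset_span ⟨⟨l, Finset.ne_of_mem_erase hl⟩, rfl⟩))
    · exact Submodule.subset_span ⟨⟨i, hi⟩, rfl⟩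
  obtain ⟨κ, a', ha', hsp, hli⟩ := exists_linearIndependent' K v
  have : Finite κ := Finite.of_injective a' ha'
  have := Fintype.ofFinite κ
  let b := Module.Basis.mk hli (by rw [hsp, hspan])
  have hκ : Fintype.card κ = c := by
    rw [← Module.finrank_eq_card_basis b]; simp
  let q : Fin c ≃ κ := (Fintype.equivFinOfCardEq hκ).symm
  obtain ⟨e, he1, he2⟩ := exists_equiv_of_inj (n := n) hcard j (fun b => (a' (q b) : ι)) (fun b b' h => q.injective (ha' (Subtype.ext h))) (fun b => (a' (q b)).2)
  refine ⟨e, he1, ?_⟩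
  have hli2 : LinearIndependent K (A.submatrix id (e ∘ Sum.inr)).col := by
    have h3 := hli.comp q q.injective
    have h4 : (A.submatrix id (e ∘ Sum.inr)).col = (v ∘ a') ∘ q := by
      funext b i
      simp [Matrix.col, v, he2]
    rw [h4]; exact h3
  have := Matrix.linearIndependent_cols_iff_isUnit.1 hli2
  rw [Matrix.isUnit_iff_isUnit_det] at this
  exact this.ne_zero

variable {k L : Type*} [Field k] [IsAlgClosed k] [Field L] [Algebra k L] {ι : Type*} [Fintype ι]

/-- smooth locus Nullstellensatz -/
lemma null_minors {c n : ℕ} (hcard : Fintype.card ι = n + 1 + c) {d : Fin c → ℕ} {f : Fin c → MvPolynomial ι k} (hf : ∀ i, (f i).IsHomogeneous (d i))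
    (hsm : ∀ a : ι → k, a ≠ 0 → (∀ i, aeval a (f i) = 0) → (jacM f a).rank = c) (j : ι) :
    Ideal.span (Set.range f) ⊔ Ideal.span {X j - 1} ⊔ Ideal.span (Set.range fun e : {e : (Unit ⊕ Fin n) ⊕ Fin c ≃ ι // e (Sum.inl (Sum.inl ())) = j} =>
      ((Matrix.of fun i l => pderiv l (f i)).submatrix id (e.1 ∘ Sum.inr)).det) = (⊤ : Ideal (MvPolynomial ι k)) := by
  by_contra hne
  obtain ⟨m, hm, hle⟩ := Ideal.exists_le_maximal _ hne
  obtain ⟨a, rfl⟩ := isMaximal_iff_eq_vanishingIdeal_singleton.1 hm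
  simp only [sup_le_iff, Ideal.span_le] at hle
  obtain ⟨⟨h1, h2⟩, h3⟩ := hle
  have h1' : ∀ i, aeval a (f i) = 0 := fun i => by
    have := h1 ⟨i, rfl⟩
    simpa using this
  have h2' : a j = 1 := by
    have := h2 rfl
    simpa [sub_eq_zero] using this
  have ha0 : a ≠ 0 := fun h => by simp [h] at h2'
  have hA0 : (jacM f a).mulVec a = 0 := by
    funext i
    have := congrArg (aeval a) (hf i).sum_X_mul_pderiv
    simp only [map_sum, map_mul, aeval_X, map_nsmul, h1', smul_zero] at this
    simpa [Matrix.mulVec, dotProduct, jacM, mul_comm] using this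
  obtain ⟨e, he, hdet⟩ := exists_minor (n := n) hcard _ (hsm a ha0 h1') a hA0 j h2'
  apply hdet
  have := h3 ⟨⟨e, he⟩, rfl⟩
  simp only [SetLike.mem_coe, mem_vanishingIdeal_singleton_iff] at this
  rw [AlgHom.map_det] at this
  rw [← this]; rfl

lemma val_aeval_le {Γ : Type*} [LinearOrderedCommGroupWithZero Γ] (w : Valuation L Γ) (hw : ∀ a : k, w (algebraMap k L a) ≤ 1)
    (x : ι → L) (hx : ∀ i, w (x i) ≤ 1) (P : MvPolynomial ι k) : w (aeval x P) ≤ 1 := by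
  induction P using MvPolynomial.induction_on with
  | C a => simpa using hw a
  | add p q hp hq => rw [map_add]; exact (w.map_add _ _).trans (max_le hp hq)
  | mul_X p i hp => rw [map_mul, map_mul, aeval_X]; exact mul_le_one' hp (hx i)

lemma exists_minor_val {Γ : Type*} [LinearOrderedCommGroupWithZero Γ] (w : Valuation L Γ) (hw : ∀ a : k, w (algebraMap k L a) ≤ 1)
    {c n : ℕ} (hcard : Fintype.card ι = n + 1 + c) {d : Fin c → ℕ} {f : Fin c → MvPolynomial ι k} (hf : ∀ i, (f i).IsHomogeneous (d i))
    (hsm : ∀ a : ι → k, a ≠ 0 → (∀ i, aeval a (f i) = 0) → (jacM f a).rank = c) (j : ι)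
    (x : ι → L) (hfx : ∀ i, aeval x (f i) = 0) (hxj : x j = 1) (hx : ∀ i, w (x i) ≤ 1) :
    ∃ e : (Unit ⊕ Fin n) ⊕ Fin c ≃ ι, e (Sum.inl (Sum.inl ())) = j ∧ 1 ≤ w ((jacM f x).submatrix id (e ∘ Sum.inr)).det := by
  by_contra! hcon
  have htop := null_minors hcard hf hsm j
  have hJ : ∀ P ∈ Ideal.span (Set.range f) ⊔ Ideal.span {X j - 1} ⊔ Ideal.span (Set.range fun e : {e : (Unit ⊕ Fin n) ⊕ Fin c ≃ ι // e (Sum.inl (Sum.inl ())) = j} =>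
      ((Matrix.of fun i l => pderiv l (f i)).submatrix id (e.1 ∘ Sum.inr)).det), w (aeval x P) < 1 := by
    intro P hP
    rw [← Ideal.span_union, ← Ideal.span_union] at hP
    refine Submodule.span_induction ?_ ?_ ?_ ?_ hP
    · rintro _ ((⟨i, rfl⟩ | rfl) | ⟨⟨e, he⟩, rfl⟩)
      · simp [hfx]
      · simp [hxj]
      · rw [AlgHom.map_det]; exact hcon e he
    · simp
    · intro p q _ _ hp hq
      rw [map_add]; exact (w.map_add _ _).trans_lt (max_lt hp hq)
    · intro a p _ hp
      rw [smul_eq_mul, map_mul, map_mul]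
      exact (mul_le_mul_left (val_aeval_le w hw x hx a) _).trans_lt (by rwa [one_mul])
  have := hJ 1 (by rw [htop]; trivial)
  simp at this

end G3

end

/-! ### G4 -/

section

section G4
open Matrix MvPolynomial

variable {k L : Type*} [Field k] [Field L] [Algebra k L] {ι : Type*} [Fintype ι]

lemma der_sum_apply' {m : ℕ} (D : Fin m → Derivation ℤ L L) (a : L) : (∑ i, D i) a = ∑ i, D i a := by
  classical
  induction (Finset.univ : Finset (Fin m)) using Finset.induction_on with
  | empty => simp
  | insert a s ha ih => simp [Finset.sum_insert ha, ih]

/-- The Poincaré residue form. -/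
noncomputable def geoF {n c : ℕ} (f : Fin c → MvPolynomial ι k) (x : ι → L) (e : (Unit ⊕ Fin n) ⊕ Fin c ≃ ι)
    (δ : Fin n → Derivation ℤ L L) : L :=
  ((derM δ x).submatrix (e ∘ Sum.inl) id).det / ((jacM f x).submatrix id (e ∘ Sum.inr)).det

theorem geo_local [IsAlgClosed k] {Γ : Type*} [LinearOrderedCommGroupWithZero Γ] (w : Valuation L Γ) (hw : ∀ a : k, w (algebraMap k L a) ≤ 1)
    {c n : ℕ} (hcard : Fintype.card ι = n + 1 + c) {d : Fin c → ℕ} {f : Fin c → MvPolynomial ι k} (hf : ∀ i, (f i).IsHomogeneous (d i))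
    (hsm : ∀ a : ι → k, a ≠ 0 → (∀ i, aeval a (f i) = 0) → (jacM f a).rank = c)
    (x : ι → L) (hfx : ∀ i, aeval x (f i) = 0) (hx0 : x ≠ 0)
    (e0 : (Unit ⊕ Fin n) ⊕ Fin c ≃ ι) (he0 : ((jacM f x).submatrix id (e0 ∘ Sum.inr)).det ≠ 0)
    {s : ℕ} (hs : ∑ i, (d i - 1) = s + n + 1) (g : MvPolynomial ι k) (hg : g.IsHomogeneous s) :
    ∃ (u : Fin n → L) (G : L), (∀ i, w (u i) ≤ 1) ∧ w G ≤ 1 ∧ ∀ δ : Fin n → Derivation ℤ L L, (∀ i a, δ i (algebraMap k L a) = 0) →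
      aeval x g * geoF f x e0 δ = G * (Matrix.of fun i j => δ i (u j)).det := by
  classical
  obtain ⟨j1, hj1⟩ := Function.ne_iff.1 hx0
  have : Nonempty ι := ⟨j1⟩
  obtain ⟨j, hj⟩ := Finite.exists_max (fun i => w (x i))
  have hxj : x j ≠ 0 := by
    intro h
    have := hj j1
    rw [h, map_zero] at this
    exact hj1 (w.zero_iff.1 (le_zero_iff.1 this))
  set l := (x j)⁻¹ with hl
  have hl0 : l ≠ 0 := inv_ne_zero hxj
  set x' : ι → L := fun i => l * x i with hx'
  have hfx' : ∀ i, aeval x' (f i) = 0 := fun i => by rw [hx', homog_aeval_smul (hf i), hfx, mul_zero]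
  have hx'j : x' j = 1 := by simp [hx', hl, hxj]
  have hwx' : ∀ i, w (x' i) ≤ 1 := by
    intro i
    have h0 : w (x j) ≠ 0 := w.ne_zero_iff.2 hxj
    simp only [hx', hl, map_mul, map_inv₀]
    rw [mul_comm, ← div_eq_mul_inv, div_le_one₀ (zero_lt_iff.2 h0)]
    exact hj i
  obtain ⟨e, he, hdet⟩ := exists_minor_val w hw hcard hf hsm j x' hfx' hx'j hwx'
  set a := ((jacM f x').submatrix id (e ∘ Sum.inr)).det with ha
  have ha0 : a ≠ 0 := by
    intro h; rw [h, map_zero] at hdet; exact not_le_of_gt zero_lt_one hdet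
  set ε : L := ((Equiv.Perm.sign (e0.trans e.symm) : ℤ) : L) with hε
  refine ⟨fun i => x' (e (Sum.inl (Sum.inr i))), ε * aeval x' g / a, fun i => hwx' _, ?_, ?_⟩
  · rw [map_div₀, div_le_one₀ (lt_of_lt_of_le zero_lt_one hdet), map_mul]
    have h1 : w ε = 1 := by
      rcases Int.units_eq_one_or (Equiv.Perm.sign (e0.trans e.symm)) with h | h <;> simp [hε, h]
    rw [h1, one_mul]
    exact (val_aeval_le w hw x' hwx' g).trans hdet
  · intro δ hδ
    have hpl := plucker e e0 (jacM f x') (derM δ x') (jacM_mul_derM hf δ hδ x' hfx')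
    have e1 := det_derM_smul e0 δ l x
    have e2 := det_jacM_smul hf e0 l x
    have e3 := homog_aeval_smul hg l x
    have e4 := det_derM_one e δ x' (by rw [he]; exact hx'j)
    rw [← hx'] at e1 e2 e3
    rw [e1, e2, e4, hs, ← hε, ← ha] at hpl
    rw [e3, geoF]
    field_simp
    have hc : l ^ (n+1) * ((derM δ x).submatrix (e0 ∘ Sum.inl) id).det * a =
      l ^ (n+1) * (ε * (l ^ s * ((jacM f x).submatrix id (e0 ∘ Sum.inr)).det * (Matrix.of fun i j => δ i (x' (e (Sum.inl (Sum.inr j))))).det)) := by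
      rw [hpl]; ring
    have hc' := mul_left_cancel₀ (pow_ne_zero (n+1) hl0) ((mul_assoc _ _ _).symm.trans hc)
    linear_combination (aeval x g) * hc'

theorem exists_e0 [IsAlgClosed k] {c n : ℕ} (hcard : Fintype.card ι = n + 1 + c) {d : Fin c → ℕ} {f : Fin c → MvPolynomial ι k} (hf : ∀ i, (f i).IsHomogeneous (d i))
    (hsm : ∀ a : ι → k, a ≠ 0 → (∀ i, aeval a (f i) = 0) → (jacM f a).rank = c)
    (x : ι → L) (hfx : ∀ i, aeval x (f i) = 0) (j : ι) (hxj : x j = 1) :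
    ∃ e : (Unit ⊕ Fin n) ⊕ Fin c ≃ ι, ((jacM f x).submatrix id (e ∘ Sum.inr)).det ≠ 0 := by
  classical
  let w : Valuation L (WithZero (Multiplicative ℤ)) := 1
  have hw : ∀ a : L, w a ≤ 1 := fun a => by
    by_cases h : a = 0
    · simp [h]
    · exact (Valuation.one_apply_of_ne_zero h).le
  obtain ⟨e, -, he⟩ := exists_minor_val w (fun a => hw _) hcard hf hsm j x hfx hxj (fun i => hw _)
  refine ⟨e, fun h => ?_⟩
  rw [h, map_zero] at he; exact not_le_of_gt zero_lt_one he

theorem derM_inj {c n m : ℕ} {d : Fin c → ℕ} {f : Fin c → MvPolynomial ι k} (hf : ∀ i, (f i).IsHomogeneous (d i))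
    (x : ι → L) (hfx : ∀ i, aeval x (f i) = 0) (j : ι) (hxj : x j = 1)
    (e : (Unit ⊕ Fin n) ⊕ Fin c ≃ ι) (he : ((jacM f x).submatrix id (e ∘ Sum.inr)).det ≠ 0)
    (δ : Fin m → Derivation ℤ L L) (hδ : ∀ i a, δ i (algebraMap k L a) = 0) (hli : LinearIndependent L δ)
    (hD : ∀ D : Derivation ℤ L L, (∀ a, D (algebraMap k L a) = 0) → (∀ i, D (x i) = 0) → D = 0) :
    Function.Injective ((derM δ x).submatrix (e ∘ Sum.inl) id).mulVec := by
  classical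
  rw [← Matrix.coe_mulVecLin, injective_iff_map_eq_zero]
  intro v hv
  rw [Matrix.mulVecLin_apply] at hv
  set y := (derM δ x).mulVec v with hy
  have hyl : ∀ a, y (e (Sum.inl a)) = 0 := fun a => congrFun hv a
  have hAy : (jacM f x).mulVec y = 0 := by
    rw [hy, Matrix.mulVec_mulVec, jacM_mul_derM hf δ hδ x hfx, Matrix.zero_mulVec]
  have hyr : (fun b => y (e (Sum.inr b))) = 0 := by
    apply Matrix.eq_zero_of_mulVec_eq_zero he
    rw [← hAy]
    funext i
    simp only [Matrix.mulVec, dotProduct, ← e.sum_comp (fun j => jacM f x i j * y j), Fintype.sum_sum_type (α₁ := Unit ⊕ Fin n), hyl]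
    simp
  have hy0 : ∀ i, y i = 0 := by
    intro i
    obtain ⟨(a | b), rfl⟩ := e.surjective i
    · exact hyl a
    · exact congrFun hyr b
  have hexp : ∀ i, x i * v (Sum.inl ()) + ∑ l, δ l (x i) * v (Sum.inr l) = 0 := by
    intro i
    have := hy0 i
    simpa [hy, Matrix.mulVec, dotProduct, derM] using this
  have hv0 : v (Sum.inl ()) = 0 := by
    have := hexp j
    simpa [hxj] using this
  have hDz : ∑ l, v (Sum.inr l) • δ l = 0 := by
    apply hD
    · intro a; simp [hδ, der_sum_apply']
    · intro i
      have := hexp i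
      rw [hv0, mul_zero, zero_add] at this
      simp only [der_sum_apply', Derivation.smul_apply, smul_eq_mul]
      rw [← this]; exact Finset.sum_congr rfl fun l _ => mul_comm _ _
  have := Fintype.linearIndependent_iff.1 hli _ hDz
  funext q
  rcases q with a | a
  · exact hv0
  · exact this a

theorem der_card_le {c n m : ℕ} {d : Fin c → ℕ} {f : Fin c → MvPolynomial ι k} (hf : ∀ i, (f i).IsHomogeneous (d i))
    (x : ι → L) (hfx : ∀ i, aeval x (f i) = 0) (j : ι) (hxj : x j = 1)
    (e : (Unit ⊕ Fin n) ⊕ Fin c ≃ ι) (he : ((jacM f x).submatrix id (e ∘ Sum.inr)).det ≠ 0)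
    (δ : Fin m → Derivation ℤ L L) (hδ : ∀ i a, δ i (algebraMap k L a) = 0) (hli : LinearIndependent L δ)
    (hD : ∀ D : Derivation ℤ L L, (∀ a, D (algebraMap k L a) = 0) → (∀ i, D (x i) = 0) → D = 0) : m ≤ n := by
  have h := derM_inj hf x hfx j hxj e he δ hδ hli hD
  rw [← Matrix.coe_mulVecLin] at h
  have := LinearMap.finrank_le_finrank_of_injective h
  simpa using this

theorem geoF_ne_zero {c n : ℕ} {d : Fin c → ℕ} {f : Fin c → MvPolynomial ι k} (hf : ∀ i, (f i).IsHomogeneous (d i))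
    (x : ι → L) (hfx : ∀ i, aeval x (f i) = 0) (j : ι) (hxj : x j = 1)
    (e : (Unit ⊕ Fin n) ⊕ Fin c ≃ ι) (he : ((jacM f x).submatrix id (e ∘ Sum.inr)).det ≠ 0)
    (δ : Fin n → Derivation ℤ L L) (hδ : ∀ i a, δ i (algebraMap k L a) = 0) (hli : LinearIndependent L δ)
    (hD : ∀ D : Derivation ℤ L L, (∀ a, D (algebraMap k L a) = 0) → (∀ i, D (x i) = 0) → D = 0) : geoF f x e δ ≠ 0 := by
  classical
  have h := derM_inj hf x hfx j hxj e he δ hδ hli hD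
  refine div_ne_zero ?_ he
  have := Matrix.mulVec_injective_iff_isUnit.1 h
  rw [Matrix.isUnit_iff_isUnit_det] at this
  exact this.ne_zero

end G4

end

/-! ### FIN -/

section

section FIN
open MvPolynomial Pointwise

lemma set_pow_homog {k L ι : Type*} [Field k] [Field L] [Algebra k L] (x : ι → L) (m : ℕ) (y : L) (hy : y ∈ (Set.range x) ^ m) :
    ∃ g : MvPolynomial ι k, g.IsHomogeneous m ∧ aeval x g = y := by
  induction m generalizing y with
  | zero =>
    rw [pow_zero, Set.mem_one] at hy
    exact ⟨1, isHomogeneous_one _ _, by simp [hy]⟩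
  | succ m ih =>
    rw [pow_succ, Set.mem_mul] at hy
    obtain ⟨a, ha, _, ⟨i, rfl⟩, rfl⟩ := hy
    obtain ⟨g, hg, rfl⟩ := ih a ha
    exact ⟨g * X i, hg.mul (isHomogeneous_X _ _), by simp⟩

theorem homog_span {M L ι : Type*} [Field M] [Field L] [Algebra M L] [FiniteDimensional M L] 
    (x : ι → L) (j : ι) (hxj : x j = 1) (htop : IntermediateField.adjoin M (Set.range x) = ⊤) (s : ℕ)
    (hs : Module.finrank M L ≤ s + 1) : Submodule.span M ((Set.range x) ^ s) = ⊤ := by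
  rw [← Submodule.span_pow]
  set W : Submodule M L := Submodule.span M (Set.range x) with hW
  have h1 : (1 : L) ∈ W := Submodule.subset_span ⟨j, hxj⟩
  have hle : (1 : Submodule M L) ≤ W := by
    rw [Submodule.one_le]; exact h1
  have hmono : ∀ m, W ^ m ≤ W ^ (m + 1) := fun m => by
    rw [pow_succ]
    calc W ^ m = W ^ m * 1 := (mul_one _).symm
      _ ≤ _ := mul_le_mul' le_rfl hle
  have hone : ∀ m, (1 : L) ∈ W ^ m := fun m => by
    induction m with
    | zero => rw [pow_zero]; exact Submodule.one_le.1 le_rfl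
    | succ m ih => exact hmono m ih
  have hadj : Algebra.adjoin M (Set.range x) = ⊤ := by
    have h2 := IntermediateField.adjoin_toSubalgebra_of_isAlgebraic (F := M) (S := Set.range x) (fun y _ => Algebra.IsAlgebraic.isAlgebraic y)
    rw [← h2, htop]; rfl
  have hstab : ∀ m, W ^ (m + 1) = W ^ m → W ^ m = ⊤ := by
    intro m hm
    rw [eq_top_iff]
    intro y hyt
    clear hyt
    have hy : y ∈ Algebra.adjoin M (Set.range x) := by rw [hadj]; trivial
    have key : ∀ z ∈ W ^ m, y * z ∈ W ^ m := by
      induction hy using Algebra.adjoin_induction with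
      | mem y hy =>
        intro z hz
        have h3 : y * z ∈ W ^ (m + 1) := by
          rw [pow_succ, mul_comm y z]
          exact Submodule.mul_mem_mul hz (Submodule.subset_span hy)
        rwa [hm] at h3
      | algebraMap r => intro z hz; rw [← Algebra.smul_def]; exact Submodule.smul_mem _ _ hz
      | add a b _ _ ha hb => intro z hz; rw [add_mul]; exact Submodule.add_mem _ (ha z hz) (hb z hz)
      | mul a b _ _ ha hb => intro z hz; rw [mul_assoc]; exact ha _ (hb z hz)
    simpa using key 1 (hone m)
  have hdim : ∀ m, W ^ m = ⊤ ∨ m + 1 ≤ Module.finrank M (W ^ m : Submodule M L) := by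
    intro m
    induction m with
    | zero =>
      right
      have : Nontrivial (W ^ 0 : Submodule M L) := ⟨⟨⟨1, hone 0⟩, 0, fun h => one_ne_zero (congrArg Subtype.val h)⟩⟩
      exact Module.finrank_pos
    | succ m ih =>
      by_cases h : W ^ (m + 1) = W ^ m
      · left; rw [h]; exact hstab m h
      · rcases ih with h' | h'
        · exact absurd (le_antisymm (h' ▸ le_top) (hmono m)) h
        · right
          have := Submodule.finrank_lt_finrank_of_lt (lt_of_le_of_ne (hmono m) (Ne.symm h))
          omega
  rcases hdim s with h | h
  · exact h
  · exact Submodule.eq_top_of_finrank_eq (le_antisymm (Submodule.finrank_le _) (hs.trans h))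

theorem fin_contra {k M L ι : Type*} [Field k] [Field M] [Field L] [Algebra k L] [Algebra M L] [FiniteDimensional M L] 
    (x : ι → L) (j : ι) (hxj : x j = 1) (htop : IntermediateField.adjoin M (Set.range x) = ⊤) (s : ℕ)
    (hs : Module.finrank M L ≤ s + 1) (J : L) (hJ : J ≠ 0) (Λ : L →ₗ[M] M)
    (hΛ : ∀ g : MvPolynomial ι k, g.IsHomogeneous s → Λ (aeval x g * J) = 0) : Λ = 0 := by
  have h := homog_span x j hxj htop s hs
  have h2 : ∀ y : L, Λ (y * J) = 0 := by
    intro y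
    have hy : y ∈ Submodule.span M ((Set.range x) ^ s) := by rw [h]; trivial
    induction hy using Submodule.span_induction with
    | mem y hy =>
      obtain ⟨g, hg, rfl⟩ := set_pow_homog (k := k) x s y hy
      exact hΛ g hg
    | zero => simp
    | add a b _ _ ha hb => rw [add_mul, map_add, ha, hb, add_zero]
    | smul r a _ ha => rw [smul_mul_assoc, LinearMap.map_smul, ha, smul_zero]
  ext y
  have := h2 (y / J)
  rwa [div_mul_cancel₀ _ hJ] at this

end FIN

end

/-! ### CHP -/

section

section CHP
open IsDedekindDomain WithZero

lemma exists_not_pow {L : Type*} [Field L] {p : ℕ} (hp : p.Prime) (w : Valuation L (WithZero (Multiplicative ℤ))) (h : ∃ q : L, q ≠ 0 ∧ w q ≠ 1) :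
    ∃ q : L, q ≠ 0 ∧ ∀ c, w q ≠ w c ^ p := by
  by_contra! hcon
  have key : ∀ m : ℕ, ∀ q : L, q ≠ 0 → w q ≠ 1 → (WithZero.log (w q)).natAbs ≠ m := by
    intro m
    induction m using Nat.strong_induction_on with
    | _ m ih =>
      intro q hq hq1 hm
      obtain ⟨c, hc⟩ := hcon q hq
      have hc0 : c ≠ 0 := by
        rintro rfl
        rw [map_zero, zero_pow hp.ne_zero] at hc
        exact hq (w.zero_iff.1 hc)
      have hc1 : w c ≠ 1 := fun h => hq1 (by rw [hc, h, one_pow])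
      have hl : WithZero.log (w q) = p * WithZero.log (w c) := by
        rw [hc, WithZero.log_pow]; simp
      have hlc : WithZero.log (w c) ≠ 0 := by
        intro h0
        apply hc1
        have := WithZero.exp_log (w.ne_zero_iff.2 hc0)
        rw [← this, h0, WithZero.exp_zero]
      have hlt : (WithZero.log (w c)).natAbs < m := by
        rw [← hm, hl, Int.natAbs_mul, Int.natAbs_natCast]
        have h1 := Int.natAbs_pos.2 hlc
        nlinarith [hp.two_le]
      exact ih _ hlt c hc0 hc1 rfl
  obtain ⟨q, hq, hq1⟩ := h
  exact key _ q hq hq1 rfl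

theorem chart_p' {p : ℕ} [hp : Fact p.Prime] {k A M E L : Type*} [Field k] [CommRing A] [IsDedekindDomain A] [Field M] [Field E] [Field L]
    [CharP L p] [CharP E p] [Algebra A M] [IsFractionRing A M] [Algebra M E] [Algebra A E] [IsScalarTower A M E] [FiniteDimensional M E]
    [Algebra.IsSeparable M E] [Algebra E L] [FiniteDimensional E L] [IsPurelyInseparable E L] [Algebra k L]
    (hA : ¬ IsField A) (hk : ∀ c : k, ∃ c' : A, algebraMap k L c = algebraMap E L (algebraMap A E c'))
    {n : ℕ} {y : Fin n → L} (hy : IsPB p y) (Λ : L →ₗ[E] E) (a : A) (ha : a ≠ 0) (G0 : L)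
    (hgeo : ∀ w : Valuation L (WithZero (Multiplicative ℤ)), (∀ c : k, w (algebraMap k L c) ≤ 1) →
      ∃ (u : Fin n → L) (G : L), (∀ i, w (u i) ≤ 1) ∧ w G ≤ 1 ∧ G0 = G * (pJac hy u).det) :
    ∃ (r : ℕ) (g : L), hy.kap^[r] g = G0 ∧ ∃ b : A, Algebra.trace M E (Λ g) = algebraMap A M (a * b) := by
  let B := integralClosure A E
  have : IsDedekindDomain B := integralClosure.isDedekindDomain A M E
  have : IsFractionRing B E := integralClosure.isFractionRing_of_finite_extension M E
  have hinj : Function.Injective (algebraMap A E) := by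
    rw [IsScalarTower.algebraMap_eq A M E]
    exact (algebraMap M E).injective.comp (IsFractionRing.injective A M)
  have hinjB : Function.Injective (algebraMap A B) := by
    intro q q' h
    exact hinj (congrArg Subtype.val h)
  have hB : ¬ IsField B := fun h => hA (isField_of_isIntegral_of_isField hinjB h)
  have : ExpChar E p := ExpChar.prime hp.out
  have : ExpChar L p := ExpChar.prime hp.out
  let r0 := IsPurelyInseparable.exponent E L
  let φ : L →+* E := IsPurelyInseparable.iterateFrobenius E L p (le_refl r0)
  have hφ : ∀ l, algebraMap E L (φ l) = l ^ p ^ r0 := fun l => IsPurelyInseparable.algebraMap_iterateFrobenius E p (le_refl r0) l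
  have hφ2 : ∀ q : E, φ (algebraMap E L q) = q ^ p ^ r0 := fun q => by
    apply (algebraMap E L).injective
    rw [hφ, map_pow]
  obtain ⟨r, g, hg, b, hb⟩ := P4_main hB hy.kap hy.kap_pow_mul φ r0 hφ Λ (algebraMap A B a) (fun h => ha (hinjB (by rw [h, map_zero]))) G0 (by
    intro P
    let w : Valuation L (WithZero (Multiplicative ℤ)) := (P.valuation E).comap φ
    have hw : ∀ l, w l = P.valuation E (φ l) := fun l => rfl
    obtain ⟨u, G, hu, hG, hG0⟩ := hgeo w (by
      intro c
      obtain ⟨c', hc'⟩ := hk c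
      rw [hw, hc', hφ2, map_pow]
      exact pow_le_one₀ zero_le (P.valuation_le_one (K := E) (algebraMap A B c')))
    by_cases hdet : (pJac hy u).det = 0
    · refine ⟨0, 0, 0, by simp, by simp, fun r => ?_⟩
      rw [hG0, hdet]
      simp only [zero_mul, mul_zero]
      exact iterate_map_zero hy.kap _
    · obtain ⟨q, hq0, hq⟩ := exists_not_pow hp.out w (by
        obtain ⟨q, hq⟩ := P.valuation_exists_uniformizer E
        have hq0 : q ≠ 0 := by
          rintro rfl; rw [map_zero] at hq; exact WithZero.exp_ne_zero hq.symm
        refine ⟨algebraMap E L q, by simpa using hq0, ?_⟩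
        rw [hw, hφ2, map_pow, hq]
        intro h
        have h2 := congrArg WithZero.log h
        rw [WithZero.log_pow, WithZero.log_exp, WithZero.log_one] at h2
        have h3 : (p ^ r0 : ℕ) ≠ 0 := pow_ne_zero _ hp.out.ne_zero
        simp only [nsmul_eq_mul, mul_neg, mul_one, neg_eq_zero] at h2
        exact h3 (by exact_mod_cast h2))
      obtain ⟨H, Y, hY, hHY⟩ := hy.local_rep u hdet w hu q hq0 hq
      exact ⟨H, G, Y, hG, hY, fun r => by rw [hHY, hG0, mul_comm]⟩)
  refine ⟨r, g, hg, ?_⟩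
  have h_integral : IsIntegral A (Algebra.trace M E (algebraMap B E b)) := Algebra.isIntegral_trace b.2
  obtain ⟨b', hb'⟩ := IsIntegrallyClosed.isIntegral_iff.1 h_integral
  refine ⟨b', ?_⟩
  have h1 : algebraMap B E (algebraMap A B a) = algebraMap M E (algebraMap A M a) := by
    rw [← IsScalarTower.algebraMap_apply A M E]; rfl
  rw [hb, map_mul (algebraMap B E), map_mul (algebraMap A M), hb', h1, ← Algebra.smul_def, LinearMap.map_smul, smul_eq_mul]

end CHP

end

/-! ### FR -/

section

section FR
open Polynomial IntermediateField

lemma isFractionRing_of_top {F M : Type*} [Field F] [Field M] [Algebra F M] (t : M) (ht : Transcendental F t) (htop : F⟮t⟯ = ⊤)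
   [alg : Algebra F[X] M] (halg : ∀ P : F[X], algebraMap F[X] M P = aeval t P) : IsFractionRing F[X] M := by
  have hinj : Function.Injective (algebraMap F[X] M) := by
    rw [injective_iff_map_eq_zero]
    intro P hP
    rw [halg] at hP
    by_contra h
    exact ht ⟨P, h, hP⟩
  have : FaithfulSMul F[X] M := (faithfulSMul_iff_algebraMap_injective _ _).2 hinj
  refine IsFractionRing.of_field F[X] M ?_
  intro g
  obtain ⟨P, Q, hQ, rfl⟩ := exists_quot_of_top t htop g
  exact ⟨P, Q, by rw [halg, halg]⟩

lemma transc_inv {F M : Type*} [Field F] [Field M] [Algebra F M] {t : M} (ht : Transcendental F t) : Transcendental F t⁻¹ := by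
  intro h
  exact ht (by simpa using h.inv)

lemma top_inv {F M : Type*} [Field F] [Field M] [Algebra F M] {t : M} (htop : F⟮t⟯ = ⊤) : F⟮t⁻¹⟯ = ⊤ := by
  rw [eq_top_iff, ← htop, adjoin_simple_le_iff]
  have := inv_mem (mem_adjoin_simple_self F t⁻¹)
  rwa [inv_inv] at this

lemma poly_inv_zero {F M : Type*} [Field F] [Field M] [Algebra F M] {t : M} (ht : Transcendental F t) (P Q : F[X])
    (h : aeval t (X * P) = aeval t⁻¹ (X * Q)) : aeval t (X * P) = 0 := by
  have ht0 : t ≠ 0 := by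
    rintro rfl; exact ht (isAlgebraic_zero)
  let _ : Invertible t⁻¹ := invertibleOfNonzero (inv_ne_zero ht0)
  have h1 := eval₂_reverse_mul_pow (algebraMap F M) t⁻¹ (X * Q)
  rw [invOf_eq_inv, inv_inv, ← aeval_def, ← aeval_def, ← h] at h1
  set m := (X * Q).natDegree
  have h2 : aeval t (reverse (X * Q)) = aeval t (X * P * X ^ m) := by
    rw [map_mul _ (X * P), map_pow, aeval_X, ← h1, mul_assoc, ← mul_pow, inv_mul_cancel₀ ht0, one_pow, mul_one]
  have h3 : reverse (X * Q) = X * P * X ^ m := by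
    by_contra hne
    exact ht ⟨_, sub_ne_zero.2 hne, by rw [map_sub, h2, sub_self]⟩
  by_cases hP : P = 0
  · simp [hP]
  exfalso
  have h4 := congrArg natDegree h3
  rw [natDegree_mul_X_pow _ (mul_ne_zero X_ne_zero hP), natDegree_X_mul hP] at h4
  have h5 := reverse_natDegree_le (X * Q)
  omega

lemma kap_chart {p : ℕ} (hp : p.Prime) {F M : Type*} [Field F] [Field M] [Algebra F M] (κ : M →+ M) (t : M)
    (h : ∀ (a : F) (i : ℕ), ∃ c : F, κ (algebraMap F M a * t ^ i) = algebraMap F M c * t ^ (i / p) ∧ (¬ p ∣ i → c = 0)) (P : F[X]) (r : ℕ) :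
    ∃ Q : F[X], κ^[r] (aeval t (X * P)) = aeval t (X * Q) := by
  have one : ∀ P : F[X], ∃ Q : F[X], κ (aeval t (X * P)) = aeval t (X * Q) := by
    intro P
    induction P using Polynomial.induction_on' with
    | add P P' hP hP' =>
      obtain ⟨Q, hQ⟩ := hP
      obtain ⟨Q', hQ'⟩ := hP'
      exact ⟨Q + Q', by rw [mul_add, map_add, map_add, hQ, hQ', ← map_add, ← mul_add]⟩
    | monomial i a =>
      obtain ⟨c, hc, hc0⟩ := h a (i + 1)
      have h1 : aeval t (X * monomial i a) = algebraMap F M a * t ^ (i + 1) := by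
        simp [aeval_monomial, pow_succ, mul_comm, mul_left_comm]
      rw [h1, hc]
      by_cases hd : p ∣ i + 1
      · obtain ⟨q, hq⟩ := hd
        have hq0 : q ≠ 0 := by rintro rfl; simp at hq
        obtain ⟨q, rfl⟩ := Nat.exists_eq_succ_of_ne_zero hq0
        refine ⟨monomial q c, ?_⟩
        rw [hq, Nat.mul_div_cancel_left _ hp.pos]
        simp [aeval_monomial, pow_succ, mul_comm, mul_left_comm]
      · exact ⟨0, by simp [hc0 hd]⟩
  induction r generalizing P with
  | zero => exact ⟨P, rfl⟩
  | succ r ih =>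
    obtain ⟨Q, hQ⟩ := one P
    rw [Function.iterate_succ_apply, hQ]
    exact ih Q

end FR

end

/-! ### COP -/

section

section COP
open Polynomial IntermediateField

theorem core_p {p : ℕ} [hp : Fact p.Prime] {k F M L ι : Type*} [Field k] [Field F] [Field M] [Field L] [Fintype ι] [IsAlgClosed k] [CharP k p]
    [Algebra k F] [Algebra F M] [Algebra M L] [Algebra k L] [FiniteDimensional M L]
    (hkL : ∀ a : k, algebraMap k L a = algebraMap M L (algebraMap F M (algebraMap k F a)))
    (hfg : (⊤ : IntermediateField k F).FG) (t : M) (ht : Transcendental F t) (htop : F⟮t⟯ = ⊤)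
    {c n : ℕ} (hcard : Fintype.card ι = n + 1 + c) {d : Fin c → ℕ} {f : Fin c → MvPolynomial ι k} (hf : ∀ i, (f i).IsHomogeneous (d i))
    (hsm : ∀ a : ι → k, a ≠ 0 → (∀ i, MvPolynomial.aeval a (f i) = 0) → (jacM f a).rank = c)
    (x : ι → L) (hfx : ∀ i, MvPolynomial.aeval x (f i) = 0) (j : ι) (hxj : x j = 1)
    (hxtop : IntermediateField.adjoin M (Set.range x) = ⊤)
    (hD : ∀ D : Derivation ℤ L L, (∀ a, D (algebraMap k L a) = 0) → (∀ i, D (x i) = 0) → D = 0)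
    {s : ℕ} (hs : ∑ i, (d i - 1) = s + n + 1) (hrank : Module.finrank M L ≤ s + 1)
    (htr : (n : Cardinal) ≤ Algebra.trdeg k F + 1) : False := by
  have : CharP F p := charP_of_injective_algebraMap (algebraMap k F).injective p
  have : CharP M p := charP_of_injective_algebraMap (algebraMap F M).injective p
  have : CharP L p := charP_of_injective_algebraMap (algebraMap M L).injective p
  have hx0 : x ≠ 0 := fun h => by rw [h] at hxj; simp at hxj
  obtain ⟨r, b, hb, hr⟩ := exists_isPB (p := p) (k := k) (F := F) hfg
  have hz := hb.ratFunc (M := M) t ht htop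
  have ht0 : t ≠ 0 := by rintro rfl; exact ht isAlgebraic_zero
  have hk1 := hb.ratFunc_kap ht0 hz
  have hk2 := hb.ratFunc_kap_inv ht0 hz
  generalize (Fin.cons t fun i : Fin r => algebraMap F M (b i) : Fin (r+1) → M) = z at hz hk1 hk2
  obtain ⟨y, hy, Λ1, hΛ1, hΛκ⟩ := hz.thmD (L := L)
  have hδk : ∀ i (a : k), hy.del i (algebraMap k L a) = 0 := by
    intro i a
    have : ExpChar k p := ExpChar.prime hp.out
    obtain ⟨a', rfl⟩ := surjective_frobenius k p a
    have := der_pow_char (p := p) (hy.del i) (algebraMap k L a') 1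
    simpa [frobenius_def] using this
  have hli : LinearIndependent L hy.del := by
    rw [Fintype.linearIndependent_iff]
    intro q hq i
    have h1 := congrArg (fun D : Derivation ℤ L L => D (y i)) hq
    simp only [der_sum_apply', Derivation.smul_apply, hy.del_y, smul_eq_mul, mul_ite, mul_zero, Derivation.zero_apply] at h1
    rw [Finset.sum_ite_eq'] at h1
    simpa [hy.y_ne_zero] using h1
  obtain ⟨e0, he0⟩ := exists_e0 (n := n) hcard hf hsm x hfx j hxj
  have hle := der_card_le hf x hfx j hxj e0 he0 hy.del hδk hli hD
  have hn : n = r + 1 := by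
    have h1 := htr.trans (add_le_add_left hr 1)
    have h2 : n ≤ r + 1 := by exact_mod_cast h1
    omega
  subst hn
  set J := geoF f x e0 hy.del with hJ
  have hJ0 : J ≠ 0 := geoF_ne_zero hf x hfx j hxj e0 he0 hy.del hδk hli hD
  let E := separableClosure M L
  have chart : ∀ τ : M, Transcendental F τ → F⟮τ⟯ = ⊤ →
      (∀ (a : F) (i : ℕ), ∃ c : F, hz.kap (algebraMap F M a * τ ^ i) = algebraMap F M c * τ ^ (i / p) ∧ (¬ p ∣ i → c = 0)) →
      ∀ g : MvPolynomial ι k, g.IsHomogeneous s → ∃ Q : F[X], Algebra.trace M E (Λ1 (MvPolynomial.aeval x g * J)) = aeval τ (X * Q) := by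
    intro τ hτ hτtop hκ g hg
    let _ : Algebra F[X] M := (aeval τ : F[X] →ₐ[F] M).toRingHom.toAlgebra
    have halg : ∀ P : F[X], algebraMap F[X] M P = aeval τ P := fun P => rfl
    have := isFractionRing_of_top τ hτ hτtop halg
    let _ : Algebra F[X] E := ((algebraMap M E).comp (algebraMap F[X] M)).toAlgebra
    have : IsScalarTower F[X] M E := IsScalarTower.of_algebraMap_eq (fun _ => rfl)
    obtain ⟨r', g', hg', b', hb'⟩ := chart_p' (p := p) (k := k) (A := F[X]) (M := M) (E := E) (L := L) (Polynomial.not_isField F)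
      (fun a => ⟨C (algebraMap k F a), by
        rw [IsScalarTower.algebraMap_apply F[X] M E, halg, aeval_C, ← IsScalarTower.algebraMap_apply M E L, hkL]⟩) hy Λ1 X X_ne_zero (MvPolynomial.aeval x g * J) (by
        intro w hw
        obtain ⟨u, G, hu, hG, hG0⟩ := geo_local w hw hcard hf hsm x hfx hx0 e0 he0 hs g hg
        exact ⟨u, G, hu, hG, hG0 hy.del hδk⟩)
    obtain ⟨Q, hQ⟩ := kap_chart hp.out hz.kap τ hκ b' r'
    refine ⟨Q, ?_⟩
    rw [← hQ, ← halg, ← hb', ← hg']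
    have : ∀ (m : ℕ) (g : L), Algebra.trace M E (Λ1 (hy.kap^[m] g)) = hz.kap^[m] (Algebra.trace M E (Λ1 g)) := by
      intro m
      induction m with
      | zero => intro g; rfl
      | succ m ih => intro g; rw [Function.iterate_succ_apply, Function.iterate_succ_apply, ih, hΛκ]
    exact this r' g'
  let Λ : L →ₗ[M] M := (Algebra.trace M E).comp (Λ1.restrictScalars M)
  have hΛ0 : Λ = 0 := by
    refine fin_contra (k := k) x j hxj hxtop s hrank J hJ0 Λ ?_
    intro g hg
    obtain ⟨Q1, hQ1⟩ := chart t ht htop hk1 g hg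
    obtain ⟨Q2, hQ2⟩ := chart t⁻¹ (transc_inv ht) (top_inv htop) hk2 g hg
    have := poly_inv_zero ht Q1 Q2 (hQ1.symm.trans hQ2)
    exact hQ1.trans this
  apply Algebra.trace_ne_zero M E
  obtain ⟨l, hl⟩ : ∃ l, Λ1 l ≠ 0 := by
    by_contra! h
    exact hΛ1 (LinearMap.ext h)
  ext q
  have h1 := congrArg (fun φ : L →ₗ[M] M => φ ((q / Λ1 l) • l)) hΛ0
  have h2 : Λ1 ((q / Λ1 l) • l) = q := by
    rw [LinearMap.map_smul, smul_eq_mul, div_mul_cancel₀ _ hl]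
  simpa [Λ, h2] using h1

end COP

end

/-! ### C0a -/

section

section C0a
open WithZero

/-- logarithmic estimate for derivations, step -/
lemma log_step {L : Type*} [Field L] [CharZero L] (w : Valuation L ℤᵐ⁰) (hQ : ∀ m : ℕ, m ≠ 0 → w (m : L) = 1) (ϖ : L) (hϖ : w ϖ = exp (-1)) (q : L) (hq0 : q ≠ 0) (hq1 : w q < 1)
    (D : Derivation ℤ L L) (hDq : w (D q) ≤ w q) (C : ℤᵐ⁰) (hC : 1 ≤ C) (hD : ∀ y, w y ≤ 1 → w (D y) ≤ C) :
    w (D ϖ) ≤ w ϖ * C := by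
  have hϖ0 : ϖ ≠ 0 := by rintro rfl; rw [map_zero] at hϖ; exact exp_ne_zero hϖ.symm
  have hwq0 : w q ≠ 0 := w.ne_zero_iff.2 hq0
  -- w q = exp(-e)
  obtain ⟨e, he⟩ : ∃ e : ℕ, w q = w ϖ ^ (e + 1) := by
    have h1 : log (w q) < 0 := by
      have := (log_lt_log hwq0 one_ne_zero).2 hq1
      simpa using this
    refine ⟨(-log (w q)).toNat - 1, ?_⟩
    rw [hϖ, ← exp_nsmul, ← exp_log hwq0]
    congr 1
    simp only [log_exp, nsmul_eq_mul]
    push_cast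
    omega
  set U : L := ϖ ^ (e + 1) / q with hU
  have hwU : w U = 1 := by rw [hU, map_div₀, map_pow, ← he, div_self hwq0]
  have hUq : ϖ ^ (e + 1) = U * q := by rw [hU, div_mul_cancel₀ _ hq0]
  have h1 := congrArg D hUq
  rw [Derivation.leibniz_pow, Derivation.leibniz] at h1
  simp only [smul_eq_mul, nsmul_eq_mul, Nat.add_sub_cancel] at h1
  have h2 : w (U * D q + q * D U) ≤ w q * C := by
    refine (w.map_add _ _).trans (max_le ?_ ?_)
    · rw [map_mul, hwU, one_mul]
      exact hDq.trans (le_mul_of_one_le_right' hC)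
    · rw [map_mul]
      gcongr
      exact hD U hwU.le
  rw [← h1, map_mul, map_mul, hQ _ (Nat.succ_ne_zero e), one_mul, map_pow, he, pow_succ, mul_assoc] at h2
  exact le_of_mul_le_mul_left h2 (pow_pos (zero_lt_iff.2 (w.ne_zero_iff.2 hϖ0)) e)

lemma log_lemma {F L : Type*} [Field F] [Field L] [CharZero L] [Algebra F L] (w : Valuation L ℤᵐ⁰) (hwF : ∀ c : F, w (algebraMap F L c) ≤ 1)
    (hQ : ∀ m : ℕ, m ≠ 0 → w (m : L) = 1)
    (hres : ∀ y, w y ≤ 1 → ∃ c : F, w (y - algebraMap F L c) < 1) (ϖ : L) (hϖ : w ϖ = exp (-1)) (q : L) (hq0 : q ≠ 0) (hq1 : w q < 1)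
    (D : Derivation ℤ L L) (hDF : ∀ c : F, w (D (algebraMap F L c)) ≤ 1) (hDq : w (D q) ≤ w q) (hbd : ∃ C, ∀ y, w y ≤ 1 → w (D y) ≤ C) :
    (∀ y, w y ≤ 1 → w (D y) ≤ 1) ∧ (∀ y, w y < 1 → w (D y) < 1) := by
  have hϖ0 : ϖ ≠ 0 := by rintro rfl; rw [map_zero] at hϖ; exact exp_ne_zero hϖ.symm
  have hϖlt : w ϖ < 1 := by rw [hϖ, ← exp_zero]; exact exp_lt_exp.2 (by norm_num)
  have hdiv : ∀ z, w z < 1 → w (z / ϖ) ≤ 1 := by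
    intro z hz
    rcases eq_or_ne z 0 with rfl | hz0
    · simp
    rw [map_div₀, div_le_one₀ (zero_lt_iff.2 (w.ne_zero_iff.2 hϖ0)), hϖ]
    have hz0' := w.ne_zero_iff.2 hz0
    rw [← exp_log hz0'] at hz ⊢
    rw [← exp_zero, exp_lt_exp] at hz
    rw [exp_le_exp]; omega
  have hm : ∀ C : ℤᵐ⁰, 1 ≤ C → (∀ y, w y ≤ 1 → w (D y) ≤ C) → ∀ z, w z < 1 → w (D z) ≤ w ϖ * C := by
    intro C hC hD z hz
    have h1 := log_step w hQ ϖ hϖ q hq0 hq1 D hDq C hC hD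
    have hz' : z = ϖ * (z / ϖ) := by field_simp
    rw [hz', Derivation.leibniz, smul_eq_mul, smul_eq_mul]
    refine (w.map_add _ _).trans (max_le ?_ ?_)
    · rw [map_mul]; gcongr; exact hD _ (hdiv z hz)
    · rw [map_mul]
      calc w (z / ϖ) * w (D ϖ) ≤ 1 * (w ϖ * C) := by gcongr; exact hdiv z hz
        _ = _ := one_mul _
  have hstep : ∀ C : ℤᵐ⁰, 1 ≤ C → (∀ y, w y ≤ 1 → w (D y) ≤ C) → ∀ y, w y ≤ 1 → w (D y) ≤ max 1 (w ϖ * C) := by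
    intro C hC hD y hy
    obtain ⟨c, hc⟩ := hres y hy
    have : y = algebraMap F L c + (y - algebraMap F L c) := by ring
    rw [this, map_add]
    exact (w.map_add _ _).trans (max_le_max (hDF c) (hm C hC hD _ hc))
  have hmain : ∀ m : ℕ, (∀ y, w y ≤ 1 → w (D y) ≤ exp (m : ℤ)) → ∀ y, w y ≤ 1 → w (D y) ≤ 1 := by
    intro m
    induction m with
    | zero => intro h; simpa using h
    | succ m ih =>
      intro h
      apply ih
      intro y hy
      have h1 := hstep _ (by rw [← exp_zero, exp_le_exp]; positivity) h y hy
      rw [hϖ, ← exp_add] at h1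
      refine h1.trans (max_le ?_ ?_)
      · rw [← exp_zero, exp_le_exp]; positivity
      · rw [exp_le_exp]; push_cast; omega
  have hO : ∀ y, w y ≤ 1 → w (D y) ≤ 1 := by
    obtain ⟨C, hC⟩ := hbd
    refine hmain (log C).toNat (fun y hy => (hC y hy).trans ?_)
    rcases eq_or_ne C 0 with rfl | h0
    · exact zero_le
    · conv_lhs => rw [← exp_log h0]
      rw [exp_le_exp]; exact Int.self_le_toNat _
  refine ⟨hO, fun y hy => ?_⟩
  have := hm 1 le_rfl hO y hy
  rw [mul_one] at this
  exact this.trans_lt hϖlt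

end C0a

end

/-! ### C0b -/

section

section C0b
open WithZero IsDedekindDomain Polynomial

lemma prime_res {F B : Type*} [Field F] [IsAlgClosed F] [CommRing B] [IsDomain B] [Algebra F[X] B] [Algebra.IsIntegral F[X] B] (P : Ideal B) [P.IsPrime] (a : F)
    (ha : algebraMap F[X] B (X - C a) ∈ P) (b : B) : ∃ c : F, b - algebraMap F[X] B (C c) ∈ P := by
  let φ : F →+* (B ⧸ P) := (Ideal.Quotient.mk P).comp ((algebraMap F[X] B).comp C)
  have h1 : (Ideal.Quotient.mk P).comp (algebraMap F[X] B) = φ.comp (evalRingHom a) := by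
    apply Polynomial.ringHom_ext
    · intro c; simp [φ]
    · simp only [RingHom.comp_apply, φ, coe_evalRingHom, eval_X]
      rw [Ideal.Quotient.eq, ← map_sub]; exact ha
  have h2 : ((Ideal.Quotient.mk P).comp (algebraMap F[X] B)).IsIntegral :=
    RingHom.IsIntegral.trans _ _ (algebraMap_isIntegral_iff.2 inferInstance) (RingHom.isIntegral_of_surjective _ Ideal.Quotient.mk_surjective)
  rw [h1] at h2
  have h3 : φ.IsIntegral := RingHom.IsIntegral.tower_top _ _ h2
  let _ : Algebra F (B ⧸ P) := φ.toAlgebra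
  have : Algebra.IsIntegral F (B ⧸ P) := algebraMap_isIntegral_iff.1 h3
  obtain ⟨c, hc⟩ := (IsAlgClosed.algebraMap_bijective_of_isIntegral (k := F) (K := B ⧸ P)).2 (Ideal.Quotient.mk P b)
  refine ⟨c, ?_⟩
  rw [← Ideal.Quotient.eq, ← hc]; rfl

/-- boundedness -/
lemma der_bdd {A B L : Type*} [CommRing A] [CommRing B] [IsDedekindDomain B] [Field L] [Algebra A B] [Module.Finite A B] [Algebra B L] [IsFractionRing B L] [Algebra A L] [IsScalarTower A B L] (P : HeightOneSpectrum B)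
    (D : Derivation ℤ L L) (hDA : ∀ a : A, P.valuation L (D (algebraMap A L a)) ≤ 1) :
    ∃ C, ∀ y, P.valuation L y ≤ 1 → P.valuation L (D y) ≤ C := by
  obtain ⟨S, hS⟩ := Module.Finite.fg_top (R := A) (M := B)
  set w := P.valuation L with hw
  obtain ⟨C0, hC0⟩ : ∃ C0, ∀ s ∈ S, w (D (algebraMap B L s)) ≤ C0 := ⟨S.sup fun s => w (D (algebraMap B L s)), fun s hs => Finset.le_sup (f := fun s => w (D (algebraMap B L s))) hs⟩
  have hB : ∀ b : B, w (D (algebraMap B L b)) ≤ max 1 C0 := by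
    intro b
    have hb : b ∈ Submodule.span A (S : Set B) := by rw [hS]; trivial
    induction hb using Submodule.span_induction with
    | mem s hs => exact (hC0 s hs).trans (le_max_right _ _)
    | zero => simp
    | add x y _ _ hx hy => rw [map_add, map_add]; exact (w.map_add _ _).trans (max_le hx hy)
    | smul a x _ hx =>
      rw [Algebra.smul_def, map_mul, Derivation.leibniz, smul_eq_mul, smul_eq_mul]
      refine (w.map_add _ _).trans (max_le ?_ ?_)
      · rw [map_mul]
        exact (mul_le_of_le_one_left' (P.valuation_le_one _)).trans hx
      · rw [map_mul, ← IsScalarTower.algebraMap_apply]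
        refine le_trans ?_ (le_max_left 1 C0)
        exact mul_le_one₀ (P.valuation_le_one _) zero_le (hDA a)
  refine ⟨max 1 C0, fun y hy => ?_⟩
  obtain ⟨b, s, hbs⟩ := P.exists_primeCompl_mul_eq_of_integer y hy
  have hs1 : w (algebraMap B L s) = 1 := by
    rw [hw, HeightOneSpectrum.valuation_of_algebraMap]; exact (P.intValuation_eq_one_iff_mem_primeCompl _).2 s.2
  have h1 := congrArg D hbs
  rw [Derivation.leibniz, smul_eq_mul, smul_eq_mul] at h1
  have h2 : algebraMap B L s * D y = D (algebraMap B L b) - y * D (algebraMap B L s) := by rw [← h1]; ring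
  have h3 := congrArg w h2
  rw [map_mul, hs1, one_mul] at h3
  rw [h3]
  refine (w.map_sub _ _).trans (max_le (hB b) ?_)
  rw [map_mul]
  exact (mul_le_of_le_one_left' hy).trans (hB _)

end C0b

end

/-! ### C0c -/

section

section C0c
open WithZero IsDedekindDomain Polynomial

lemma trace_rad {A M L : Type*} [CommRing A] [IsDedekindDomain A] [Field M] [Field L] [Algebra A M] [IsFractionRing A M] [Algebra M L] [Algebra A L] [IsScalarTower A M L]
   [FiniteDimensional M L] [Algebra.IsSeparable M L] (q : A) (hq : Prime q) (y b : integralClosure A L) (m : ℕ) (hm : y ^ m = algebraMap A _ q * b) :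
   ∃ r : A, Algebra.trace M L (y : L) = algebraMap A M (q * r) := by
  have hinj : Function.Injective (algebraMap A M) := IsFractionRing.injective A M
  let Ω := AlgebraicClosure M
  have hq0 : algebraMap A Ω q ≠ 0 := by
    rw [IsScalarTower.algebraMap_apply A M Ω, _root_.map_ne_zero, map_ne_zero_iff _ hinj]; exact hq.ne_zero
  rcases Nat.eq_zero_or_pos m with rfl | hmpos
  · exfalso
    have h1 := congrArg Subtype.val hm
    have h2 : IsIntegral A (algebraMap A M q)⁻¹ := by
      have : (b : L) = algebraMap M L (algebraMap A M q)⁻¹ := by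
        rw [map_inv₀, ← IsScalarTower.algebraMap_apply]
        apply eq_inv_of_mul_eq_one_right
        simpa using h1.symm
      rw [← isIntegral_algebraMap_iff (algebraMap M L).injective, ← this]
      exact b.2
    obtain ⟨r, hr⟩ := IsIntegrallyClosed.isIntegral_iff.1 h2
    apply hq.not_isUnit
    refine IsUnit.of_mul_eq_one r (hinj ?_)
    rw [map_mul, hr, map_one, mul_inv_cancel₀]
    rw [map_ne_zero_iff _ hinj]; exact hq.ne_zero
  obtain ⟨ρ, hρ⟩ := IsAlgClosed.exists_pow_nat_eq (algebraMap A Ω q) hmpos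
  have hρ0 : ρ ≠ 0 := by rintro rfl; rw [zero_pow hmpos.ne'] at hρ; exact hq0 hρ.symm
  have hσ : ∀ σ : L →ₐ[M] Ω, IsIntegral A (σ y / ρ) := by
    intro σ
    apply IsIntegral.of_pow hmpos
    have : (σ y / ρ) ^ m = σ.restrictScalars A (b : L) := by
      rw [div_pow, hρ, div_eq_iff hq0, ← map_pow]
      have h1 := congrArg Subtype.val hm
      simp only [SubmonoidClass.coe_pow, MulMemClass.coe_mul] at h1
      rw [h1]
      have h2 : ((algebraMap A (integralClosure A L) q : integralClosure A L) : L) = algebraMap A L q := rfl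
      rw [h2, map_mul, mul_comm]
      congr 1
      exact (σ.restrictScalars A).commutes q
    rw [this]
    exact b.2.map _
  have hsum : IsIntegral A (algebraMap M Ω (Algebra.trace M L (y : L)) / ρ) := by
    rw [trace_eq_sum_embeddings Ω, Finset.sum_div]
    exact IsIntegral.sum _ fun σ _ => hσ σ
  obtain ⟨T, hT⟩ := IsIntegrallyClosed.isIntegral_iff.1 (Algebra.isIntegral_trace (L := M) y.2)
  rw [← hT] at hsum ⊢
  have h3 := hsum.pow m
  rw [div_pow, hρ, ← IsScalarTower.algebraMap_apply, ← map_pow] at h3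
  have h4 : IsIntegral A (algebraMap A M (T ^ m) / algebraMap A M q) := by
    rw [← isIntegral_algebraMap_iff (algebraMap M Ω).injective, map_div₀, ← IsScalarTower.algebraMap_apply, ← IsScalarTower.algebraMap_apply]
    exact h3
  obtain ⟨r, hr⟩ := IsIntegrallyClosed.isIntegral_iff.1 h4
  have h5 : T ^ m = q * r := by
    apply hinj
    rw [map_mul, hr, mul_div_cancel₀]
    rw [map_ne_zero_iff _ hinj]; exact hq.ne_zero
  obtain ⟨r', hr'⟩ := hq.dvd_of_dvd_pow (⟨r, h5⟩ : q ∣ T ^ m)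
  exact ⟨r', by rw [hr']⟩

lemma trace_local {A M L : Type*} [CommRing A] [IsDedekindDomain A] [Field M] [Field L] [Algebra A M] [IsFractionRing A M] [Algebra M L] [Algebra A L] [IsScalarTower A M L]
   [FiniteDimensional M L] [Algebra.IsSeparable M L] [IsDedekindDomain (integralClosure A L)] [IsFractionRing (integralClosure A L) L] (q : A) (hq : Prime q) (y : L)
   (h : ∀ P : HeightOneSpectrum (integralClosure A L), algebraMap A _ q ∈ P.asIdeal → P.valuation L y < 1) :
   ∃ s r : A, ¬ q ∣ s ∧ algebraMap A M s * Algebra.trace M L y = algebraMap A M (q * r) := by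
  let B := integralClosure A L
  have hinj : Function.Injective (algebraMap A L) := by
    rw [IsScalarTower.algebraMap_eq A M L]; exact (algebraMap M L).injective.comp (IsFractionRing.injective A M)
  obtain ⟨a0, ha0, hy0⟩ := IsAlgebraic.exists_integral_multiple (R := A) (z := y) ((IsFractionRing.isAlgebraic_iff A M L).2 (Algebra.IsAlgebraic.isAlgebraic (R := M) y))
  obtain ⟨m, s, hs, has⟩ := WfDvdMonoid.max_power_factor ha0 hq.irreducible
  have hval : ∀ P : HeightOneSpectrum B, P.valuation L (algebraMap A L s * y) ≤ 1 := by
    intro P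
    have hle : ∀ z : A, P.valuation L (algebraMap A L z) ≤ 1 := fun z => P.valuation_le_one (K := L) (algebraMap A B z)
    by_cases hP : algebraMap A _ q ∈ P.asIdeal
    · rw [map_mul]; exact mul_le_one₀ (hle _) zero_le (h P hP).le
    · have h1 : P.valuation L (algebraMap A L q) = 1 := by
        refine le_antisymm (hle q) (not_lt.1 fun hlt => hP ?_)
        exact (P.valuation_lt_one_iff_mem (K := L) (algebraMap A B q)).1 hlt
      have h2 : a0 • y = algebraMap B L ⟨a0 • y, hy0⟩ := rfl
      have h3 : P.valuation L (a0 • y) ≤ 1 := P.valuation_le_one (K := L) (⟨a0 • y, hy0⟩ : B)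
      rw [Algebra.smul_def, has, map_mul (algebraMap A L), map_pow (algebraMap A L), mul_assoc, map_mul, map_pow, h1, one_pow, one_mul] at h3
      exact h3
  obtain ⟨b, hb⟩ := HeightOneSpectrum.mem_integers_of_valuation_le_one (R := B) L _ hval
  have hrad : b ∈ (Ideal.span {algebraMap A B q}).radical := by
    rw [Ideal.radical_eq_sInf, Submodule.mem_sInf]
    rintro P ⟨hP, hPp⟩
    rw [Ideal.span_singleton_le_iff_mem] at hP
    have hne : P ≠ ⊥ := by
      rintro rfl
      have h0 : algebraMap A B q = 0 := hP
      exact hq.ne_zero (hinj ((congrArg Subtype.val h0).trans (map_zero _).symm))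
    let P' : HeightOneSpectrum B := ⟨P, hPp, hne⟩
    have h1 := h P' hP
    refine (P'.valuation_lt_one_iff_mem (K := L) b).1 ?_
    rw [Algebra.cast, hb, map_mul]
    exact mul_lt_one_of_nonneg_of_lt_one_right (P'.valuation_le_one (K := L) (algebraMap A B s)) zero_le h1
  obtain ⟨m', hm'⟩ := hrad
  obtain ⟨b', hb'⟩ := Ideal.mem_span_singleton.1 hm'
  obtain ⟨r, hr⟩ := trace_rad (M := M) q hq b b' m' hb'
  refine ⟨s, r, hs, ?_⟩
  rw [← hr]
  have : (b : L) = algebraMap A M s • y := by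
    rw [Algebra.smul_def, ← IsScalarTower.algebraMap_apply]; exact hb
  rw [this, LinearMap.map_smul, smul_eq_mul]

/-- globalization on F[X] -/
lemma poly_global {F M : Type*} [Field F] [IsAlgClosed F] [Field M] [Algebra F[X] M] [IsFractionRing F[X] M] (h : M)
    (hl : ∀ a : F, ∃ s r : F[X], s.eval a ≠ 0 ∧ algebraMap F[X] M s * h = algebraMap F[X] M (X * r)) :
    ∃ Q : F[X], h = algebraMap F[X] M (X * Q) := by
  have hinj : Function.Injective (algebraMap F[X] M) := IsFractionRing.injective _ _
  have htop : ¬ ∃ P : Ideal F[X], P.IsMaximal ∧ ∀ s, (∃ r, algebraMap F[X] M s * h = algebraMap F[X] M (X * r)) → s ∈ P := by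
    rintro ⟨P, hP, hs⟩
    obtain ⟨g, rfl⟩ : ∃ g, P = Ideal.span {g} := ⟨_, (Ideal.span_singleton_generator P).symm⟩
    have hg : ¬ IsUnit g := fun h => hP.ne_top (Ideal.span_singleton_eq_top.2 h)
    have hdeg : g.degree ≠ 0 := by
      intro h0
      exact hg (Polynomial.isUnit_iff_degree_eq_zero.2 h0)
    obtain ⟨a, ha⟩ := IsAlgClosed.exists_root g hdeg
    obtain ⟨s, r, hsa, hsr⟩ := hl a
    obtain ⟨v, hv⟩ := Ideal.mem_span_singleton.1 (hs s ⟨r, hsr⟩)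
    apply hsa
    rw [hv, eval_mul, ha.eq_zero, zero_mul]
  let I : Ideal F[X] :=
    { carrier := {s | ∃ r, algebraMap F[X] M s * h = algebraMap F[X] M (X * r)}
      zero_mem' := ⟨0, by simp⟩
      add_mem' := by
        rintro s s' ⟨r, hr⟩ ⟨r', hr'⟩
        exact ⟨r + r', by rw [map_add, add_mul, hr, hr', ← map_add, mul_add]⟩
      smul_mem' := by
        rintro u s ⟨r, hr⟩
        exact ⟨u * r, by rw [smul_eq_mul, map_mul, mul_assoc, hr, ← map_mul]; congr 1; ring⟩ }
  have hI : I = ⊤ := by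
    by_contra hI
    obtain ⟨P, hP, hle⟩ := Ideal.exists_le_maximal I hI
    exact htop ⟨P, hP, fun s hs => hle hs⟩
  obtain ⟨r, hr⟩ : (1 : F[X]) ∈ I := by rw [hI]; trivial
  exact ⟨r, by simpa using hr⟩

end C0c

end

/-! ### C0d -/

section

section C0d
open WithZero IsDedekindDomain Polynomial

lemma w_det_le {L Γ : Type*} [Field L] [LinearOrderedCommGroupWithZero Γ] (w : Valuation L Γ) {n : ℕ} (A : Matrix (Fin n) (Fin n) L) (hA : ∀ i j, w (A i j) ≤ 1) : w A.det ≤ 1 := by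
  rw [Matrix.det_apply]
  refine w.map_sum_le fun σ _ => ?_
  have : w (Equiv.Perm.sign σ • ∏ i, A (σ i) i) = w (∏ i, A (σ i) i) := by
    rcases Int.units_eq_one_or (Equiv.Perm.sign σ) with h | h <;> simp [h]
  rw [this, map_prod]
  exact Finset.prod_le_one' fun i _ => hA _ _

lemma w_det_lt {L Γ : Type*} [Field L] [LinearOrderedCommGroupWithZero Γ] (w : Valuation L Γ) {n : ℕ} (A : Matrix (Fin (n+1)) (Fin (n+1)) L) (hA : ∀ i j, w (A i j) ≤ 1) (h0 : ∀ j, w (A 0 j) < 1) : w A.det < 1 := by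
  rw [Matrix.det_succ_row_zero]
  refine w.map_sum_lt one_ne_zero fun j _ => ?_
  rw [map_mul, map_mul, map_pow, Valuation.map_neg, map_one, one_pow, one_mul]
  exact mul_lt_one_of_lt_of_le (h0 j) (w_det_le w _ fun _ _ => hA _ _)

theorem chart_0 {k F M L : Type*} [Field k] [Field F] [IsAlgClosed F] [CharZero F] [Field M] [Field L] [Algebra k F] [Algebra F M] [Algebra M L] [Algebra k L] [FiniteDimensional M L]
    (hkL : ∀ a : k, algebraMap k L a = algebraMap M L (algebraMap F M (algebraMap k F a)))
    (τ : M) (hτ : Transcendental F τ) (hτtop : IntermediateField.adjoin F {τ} = ⊤) {m : ℕ} (D : Fin m → Derivation ℤ L L) (E : Derivation ℤ L L)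
    (hDF : ∀ i (c : F), ∃ c' : F, D i (algebraMap M L (algebraMap F M c)) = algebraMap M L (algebraMap F M c')) (hDτ : ∀ i, D i (algebraMap M L τ) = 0)
    (hEF : ∀ c : F, E (algebraMap M L (algebraMap F M c)) = 0) (hEτ : E (algebraMap M L τ) = algebraMap M L τ ∨ E (algebraMap M L τ) = - algebraMap M L τ) (G0 : L)
    (hgeo : ∀ w : Valuation L ℤᵐ⁰, (∀ c : k, w (algebraMap k L c) ≤ 1) →
      ∃ (u : Fin (m + 1) → L) (G : L), (∀ i, w (u i) ≤ 1) ∧ w G ≤ 1 ∧ G0 = G * (Matrix.of fun i j => (Fin.cons E D : Fin (m + 1) → Derivation ℤ L L) i (u j)).det) :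
    ∃ Q : F[X], Algebra.trace M L G0 = aeval τ (X * Q) := by
  let _ : Algebra F[X] M := (aeval τ : F[X] →ₐ[F] M).toRingHom.toAlgebra
  have halg : ∀ P : F[X], algebraMap F[X] M P = aeval τ P := fun P => rfl
  have := isFractionRing_of_top τ hτ hτtop halg
  let _ : Algebra F[X] L := ((algebraMap M L).comp (algebraMap F[X] M)).toAlgebra
  have : IsScalarTower F[X] M L := IsScalarTower.of_algebraMap_eq (fun _ => rfl)
  let _ : Algebra F L := ((algebraMap M L).comp (algebraMap F M)).toAlgebra
  have hFL : ∀ c : F, algebraMap F L c = algebraMap M L (algebraMap F M c) := fun c => rfl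
  have : CharZero M := charZero_of_injective_algebraMap (algebraMap F M).injective
  have : CharZero L := charZero_of_injective_algebraMap (algebraMap M L).injective
  let B := integralClosure F[X] L
  have : IsDedekindDomain B := integralClosure.isDedekindDomain F[X] M L
  have : IsFractionRing B L := integralClosure.isFractionRing_of_finite_extension M L
  have : Module.Finite F[X] B := IsIntegralClosure.finite F[X] M L B
  have hC : ∀ c : F, algebraMap F[X] L (C c) = algebraMap F L c := fun c => by
    rw [IsScalarTower.algebraMap_apply F[X] M L, halg, aeval_C]; rfl
  have hX : algebraMap F[X] L X = algebraMap M L τ := by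
    rw [IsScalarTower.algebraMap_apply F[X] M L, halg, aeval_X]
  set T := algebraMap M L τ with hT
  have hτ0 : τ ≠ 0 := by rintro rfl; exact hτ isAlgebraic_zero
  have hT0 : T ≠ 0 := by rw [hT]; simpa using hτ0
  simp only [← hFL] at hDF hEF
  suffices ∃ Q : F[X], Algebra.trace M L G0 = algebraMap F[X] M (X * Q) from this
  apply poly_global
  intro a
  have hq : Prime (X - C a) := prime_X_sub_C a
  set q : L := T - algebraMap F L a with hqdef
  have hqA : algebraMap F[X] L (X - C a) = q := by rw [map_sub, hX, hC]
  have hq0 : q ≠ 0 := by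
    rw [← hqA, IsScalarTower.algebraMap_apply F[X] M L]
    exact (map_ne_zero_iff _ (algebraMap M L).injective).2 ((map_ne_zero_iff _ (IsFractionRing.injective F[X] M)).2 hq.ne_zero)
  obtain ⟨ε, hε, hETε⟩ : ∃ ε : L, ε * ε = 1 ∧ E T = ε * T := by
    rcases hEτ with h | h
    · exact ⟨1, by simp, by simpa using h⟩
    · exact ⟨-1, by simp, by simpa using h⟩
  choose D' hD' using fun i => hDF i a
  let E1 : Derivation ℤ L L := (q / T) • E
  let D1 : Fin m → Derivation ℤ L L := fun i => D i + (ε * algebraMap F L (D' i) / T) • E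
  have hloc := trace_local (A := F[X]) (M := M) (L := L) (X - C a) hq ((q / T) * G0) (by
    intro P hP
    set w := P.valuation L with hw
    have hwA : ∀ p : F[X], w (algebraMap F[X] L p) ≤ 1 := fun p => P.valuation_le_one (K := L) (algebraMap F[X] B p)
    have hwF : ∀ c : F, w (algebraMap F L c) ≤ 1 := fun c => by rw [← hC]; exact hwA _
    have hwT : w T ≤ 1 := by rw [← hX]; exact hwA _
    have hwq : w q < 1 := by
      rw [← hqA]; exact (P.valuation_lt_one_iff_mem (K := L) (algebraMap F[X] B (X - C a))).2 hP
    obtain ⟨ϖ, hϖ⟩ := P.valuation_exists_uniformizer L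
    have hQ : ∀ m : ℕ, m ≠ 0 → w (m : L) = 1 := by
      intro m hm
      have h1 := hwF (m : F)
      have h2 := hwF (m : F)⁻¹
      rw [map_inv₀, map_inv₀, map_natCast] at h2
      rw [map_natCast] at h1
      have h3 : w (m : L) ≠ 0 := w.ne_zero_iff.2 (by exact_mod_cast hm)
      exact le_antisymm h1 ((inv_le_one₀ (zero_lt_iff.2 h3)).1 h2)
    have hres : ∀ y, w y ≤ 1 → ∃ c : F, w (y - algebraMap F L c) < 1 := by
      intro y hy
      obtain ⟨b, hb⟩ := P.exists_valuation_sub_lt_of_integer hy 1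
      obtain ⟨c, hc⟩ := prime_res P.asIdeal a hP b
      refine ⟨c, ?_⟩
      have h1 : w (algebraMap B L (b - algebraMap F[X] B (C c))) < 1 := (P.valuation_lt_one_iff_mem (K := L) _).2 hc
      have h2 : y - algebraMap F L c = algebraMap B L (b - algebraMap F[X] B (C c)) - (algebraMap B L b - y) := by
        rw [map_sub, ← IsScalarTower.algebraMap_apply F[X] B L, hC]; ring
      rw [h2]
      exact (w.map_sub _ _).trans_lt (max_lt h1 hb)
    -- boundedness from generators
    have hbd : ∀ Δ : Derivation ℤ L L, (∀ c : F, w (Δ (algebraMap F L c)) ≤ 1) → w (Δ T) ≤ 1 → ∃ C, ∀ y, w y ≤ 1 → w (Δ y) ≤ C := by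
      intro Δ h1 h2
      refine der_bdd (A := F[X]) P Δ ?_
      intro p
      induction p using Polynomial.induction_on' with
      | add p p' hp hp' => rw [map_add, map_add]; exact (w.map_add _ _).trans (max_le hp hp')
      | monomial i c =>
        rw [← C_mul_X_pow_eq_monomial, map_mul, map_pow, hC, hX, Derivation.leibniz, Derivation.leibniz_pow]
        simp only [smul_eq_mul, nsmul_eq_mul]
        refine (w.map_add _ _).trans (max_le ?_ ?_)
        · simp only [map_mul, map_pow]
          refine mul_le_one₀ (hwF c) zero_le (mul_le_one₀ ?_ zero_le (mul_le_one₀ (pow_le_one₀ zero_le hwT) zero_le h2))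
          simpa using hwF (i : F)
        · rw [map_mul, map_pow]
          exact mul_le_one₀ (pow_le_one₀ zero_le hwT) zero_le (h1 c)
    have hE1F : ∀ c : F, E1 (algebraMap F L c) = 0 := fun c => by simp [E1, hEF]
    have hE1T : E1 T = ε * q := by
      simp only [E1, Derivation.smul_apply, smul_eq_mul, hETε]; field_simp
    have hε1 : w ε = 1 := by
      have := congrArg w hε
      rw [map_mul, map_one] at this
      rw [← sq] at this
      exact (pow_eq_one_iff_of_nonneg zero_le two_ne_zero).1 this
    have hE1q : w (E1 q) ≤ w q := by
      rw [hqdef, map_sub, hE1F, hE1T, sub_zero, map_mul, hε1, one_mul]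
    have hD1F : ∀ i (c : F), w (D1 i (algebraMap F L c)) ≤ 1 := fun i c => by
      obtain ⟨c', hc'⟩ := hDF i c
      simp only [D1, Derivation.add_apply, Derivation.smul_apply, hEF, smul_zero, add_zero, hc']
      exact hwF c'
    have hD1T : ∀ i, D1 i T = algebraMap F L (D' i) := fun i => by
      simp only [D1, Derivation.add_apply, Derivation.smul_apply, hDτ, smul_eq_mul, hETε, zero_add]
      field_simp
      linear_combination (algebraMap F L (D' i)) * hε
    have hD1q : ∀ i, w (D1 i q) ≤ w q := fun i => by
      have : D1 i q = 0 := by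
        rw [hqdef, map_sub, hD1T]
        simp only [D1, Derivation.add_apply, Derivation.smul_apply, hEF, smul_zero, add_zero, hD', sub_self]
      rw [this, map_zero]; exact zero_le
    have LE := log_lemma w hwF hQ hres ϖ hϖ q hq0 hwq E1 (fun c => by rw [hE1F, map_zero]; exact zero_le) hE1q
      (hbd E1 (fun c => by rw [hE1F, map_zero]; exact zero_le) (by rw [hE1T, map_mul, hε1, one_mul]; exact hwq.le))
    have LD := fun i => log_lemma w hwF hQ hres ϖ hϖ q hq0 hwq (D1 i) (hD1F i) (hD1q i) (hbd (D1 i) (hD1F i) (by rw [hD1T]; exact hwF _))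
    have LE' : ∀ y, w y ≤ 1 → w (E1 y) < 1 := by
      intro y hy
      obtain ⟨c, hc⟩ := hres y hy
      have := LE.2 _ hc
      rwa [map_sub, hE1F, sub_zero] at this
    obtain ⟨u, G, hu, hG, hG0⟩ := hgeo w (fun c => by rw [hkL]; exact hwF _)
    have hdet : (q / T) * (Matrix.of fun i j => (Fin.cons E D : Fin (m + 1) → Derivation ℤ L L) i (u j)).det
        = (Matrix.of fun i j => (Fin.cons E1 D1 : Fin (m + 1) → Derivation ℤ L L) i (u j)).det := by
      have h1 : (Matrix.of fun i j => (Fin.cons E D1 : Fin (m + 1) → Derivation ℤ L L) i (u j)).det = (Matrix.of fun i j => (Fin.cons E D : Fin (m + 1) → Derivation ℤ L L) i (u j)).det := by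
        apply Matrix.det_eq_of_forall_row_eq_smul_add_const (Fin.cons 0 fun i => ε * algebraMap F L (D' i) / T) 0 (by simp)
        intro i j
        refine Fin.cases ?_ (fun i => ?_) i
        · simp
        · simp [D1]
      have h2 : (Matrix.of fun i j => (Fin.cons E1 D1 : Fin (m + 1) → Derivation ℤ L L) i (u j)) = (Matrix.of fun i j => (Fin.cons E D1 : Fin (m + 1) → Derivation ℤ L L) i (u j)).updateRow 0 ((q / T) • fun j => E (u j)) := by
        ext i j
        refine Fin.cases ?_ (fun i => ?_) i
        · simp [E1]
        · simp [Matrix.updateRow_apply]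
      rw [h2, Matrix.det_updateRow_smul, ← h1]
      congr 2
      ext i j
      refine Fin.cases ?_ (fun i => ?_) i
      · simp
      · simp [Matrix.updateRow_apply]
    have hval : w ((Matrix.of fun i j => (Fin.cons E1 D1 : Fin (m + 1) → Derivation ℤ L L) i (u j)).det) < 1 := by
      apply w_det_lt
      · intro i j
        refine Fin.cases ?_ (fun i => ?_) i
        · simpa using (LE' _ (hu j)).le
        · simpa using (LD i).1 _ (hu j)
      · intro j
        simpa using LE' _ (hu j)
    rw [hG0, mul_left_comm, hdet, map_mul]
    exact mul_lt_one_of_nonneg_of_lt_one_right hG zero_le hval)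
  obtain ⟨s, r, hs, hsr⟩ := hloc
  refine ⟨s, r, fun h => hs (dvd_iff_isRoot.2 h), ?_⟩
  have hqM : q / T = algebraMap M L (algebraMap F[X] M (X - C a) / τ) := by
    rw [map_div₀, ← IsScalarTower.algebraMap_apply, hqA]
  rw [hqM, ← Algebra.smul_def (algebraMap F[X] M (X - C a) / τ) G0, LinearMap.map_smul, smul_eq_mul, map_mul] at hsr
  have hq0' : algebraMap F[X] M (X - C a) ≠ 0 := (map_ne_zero_iff _ (IsFractionRing.injective F[X] M)).2 hq.ne_zero
  have hXM : algebraMap F[X] M X = τ := by rw [halg, aeval_X]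
  rw [map_mul, hXM]
  field_simp at hsr
  exact hsr

end C0d

end

/-! ### C0e -/

section

section C0e
open TensorProduct

lemma tb_etale {k F ι : Type*} [Field k] [CharZero k] [Field F] [Algebra k F] {x : ι → F} (hx : IsTranscendenceBasis k x)
    [Algebra (MvPolynomial ι k) F] (h : ∀ p, algebraMap (MvPolynomial ι k) F p = MvPolynomial.aeval x p) : Algebra.FormallyEtale (MvPolynomial ι k) F := by
  let R := MvPolynomial ι k
  let Q := FractionRing R
  have hinj : Function.Injective (algebraMap R F) := by
    have : ⇑(algebraMap R F) = ⇑(MvPolynomial.aeval x : MvPolynomial ι k →ₐ[k] F) := funext h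
    rw [this]; exact hx.1
  have : FaithfulSMul R F := (faithfulSMul_iff_algebraMap_injective R F).2 hinj
  let _ : Algebra Q F := FractionRing.liftAlgebra R F
  have : IsScalarTower R Q F := FractionRing.isScalarTower_liftAlgebra R F
  have e1 : Algebra.FormallyEtale R Q := Algebra.FormallyEtale.of_isLocalization (nonZeroDivisors R)
  have : CharZero Q := charZero_of_injective_algebraMap (R := R) (IsFractionRing.injective R Q)
  have hA := hx.isAlgebraic
  have : Algebra.IsAlgebraic R F := by
    constructor
    intro y
    have := hA.isAlgebraic y
    obtain ⟨p, hp0, hp⟩ := this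
    have hφ : ∀ r, ((hx.1.aevalEquiv r : Algebra.adjoin k (Set.range x)) : F) = algebraMap R F r := fun r => by rw [h]; simp
    refine ⟨p.map (hx.1.aevalEquiv.symm : Algebra.adjoin k (Set.range x) →+* R), ?_, ?_⟩
    · rwa [Ne, Polynomial.map_eq_zero_iff (by exact hx.1.aevalEquiv.symm.injective)]
    · rw [Polynomial.aeval_def, Polynomial.eval₂_map]
      rw [Polynomial.aeval_def] at hp
      have hcomp : (algebraMap R F).comp (hx.1.aevalEquiv.symm : Algebra.adjoin k (Set.range x) →+* R) = algebraMap (Algebra.adjoin k (Set.range x)) F := by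
        refine RingHom.ext fun r => ?_
        have h2 := hφ (hx.1.aevalEquiv.symm r)
        rw [AlgEquiv.apply_symm_apply] at h2
        exact h2.symm
      rw [hcomp]; exact hp
  have : Algebra.IsAlgebraic Q F := ⟨fun y => (IsFractionRing.isAlgebraic_iff R Q F).1 (Algebra.IsAlgebraic.isAlgebraic y)⟩
  have e2 : Algebra.FormallyEtale Q F := Algebra.FormallyEtale.of_isSeparable Q F
  exact Algebra.FormallyEtale.comp R Q F

lemma der_of_tb {k F ι : Type*} [Field k] [CharZero k] [Field F] [Algebra k F] {x : ι → F} (hx : IsTranscendenceBasis k x) (v : ι → F) :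
    ∃ D : Derivation k F F, ∀ i, D (x i) = v i := by
  let R := MvPolynomial ι k
  let _ : Algebra R F := (MvPolynomial.aeval x : R →ₐ[k] F).toRingHom.toAlgebra
  have h : ∀ p, algebraMap R F p = MvPolynomial.aeval x p := fun p => rfl
  have : IsScalarTower k R F := IsScalarTower.of_algebraMap_eq fun c => by rw [h]; exact ((MvPolynomial.aeval x : MvPolynomial ι k →ₐ[k] F).commutes c).symm
  have := tb_etale hx h
  let d : Derivation k R F := MvPolynomial.mkDerivation k v
  let e := KaehlerDifferential.tensorKaehlerEquivOfFormallyEtale k R F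
  let l : F ⊗[R] Ω[R⁄k] →ₗ[F] F := LinearMap.liftBaseChange F d.liftKaehlerDifferential
  refine ⟨(l ∘ₗ e.symm.toLinearMap).compDer (KaehlerDifferential.D k F), fun i => ?_⟩
  have h1 : x i = algebraMap R F (MvPolynomial.X i) := by rw [h]; simp
  rw [h1]
  have h2 : e.symm (KaehlerDifferential.D k F (algebraMap R F (MvPolynomial.X i))) = 1 ⊗ₜ KaehlerDifferential.D k R (MvPolynomial.X i) :=
    KaehlerDifferential.tensorKaehlerEquivOfFormallyEtale_symm_D_algebraMap k R F _
  change l (e.symm (KaehlerDifferential.D k F (algebraMap R F (MvPolynomial.X i)))) = v i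
  rw [h2, LinearMap.liftBaseChange_tmul, one_smul, Derivation.liftKaehlerDifferential_comp_D]
  exact MvPolynomial.mkDerivation_X k v i

lemma der_uniq {k F V ι : Type*} [Field k] [CharZero k] [Field F] [Algebra k F] [AddCommGroup V] [Module F V] [Module k V] [IsScalarTower k F V] {x : ι → F} (hx : IsTranscendenceBasis k x) (D : Derivation k F V)
    (hD : ∀ i, D (x i) = 0) : D = 0 := by
  let R := MvPolynomial ι k
  let _ : Algebra R F := (MvPolynomial.aeval x : R →ₐ[k] F).toRingHom.toAlgebra
  have h : ∀ p, algebraMap R F p = MvPolynomial.aeval x p := fun p => rfl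
  have : IsScalarTower k R F := IsScalarTower.of_algebraMap_eq fun c => by rw [h]; exact ((MvPolynomial.aeval x : MvPolynomial ι k →ₐ[k] F).commutes c).symm
  have := tb_etale hx h
  let _ : Module R V := Module.compHom V (algebraMap R F)
  have : IsScalarTower R F V := ⟨fun r f v => by rw [Algebra.smul_def, mul_smul]; rfl⟩
  have hR : ∀ r : R, D (algebraMap R F r) = 0 := by
    intro r
    rw [h]
    induction r using MvPolynomial.induction_on with
    | C c => simp
    | add p q hp hq => rw [map_add, map_add, hp, hq, add_zero]
    | mul_X p i hp => rw [map_mul, Derivation.leibniz, hp, MvPolynomial.aeval_X, hD, smul_zero, smul_zero, add_zero]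
  let D' : Derivation R F V :=
    { toFun := D
      map_add' := map_add D
      map_smul' := fun r f => by
        rw [Algebra.smul_def, Derivation.leibniz, hR, smul_zero, add_zero]; rfl
      map_one_eq_zero' := D.map_one_eq_zero
      leibniz' := D.leibniz }
  have hsub : Subsingleton (Ω[F⁄R]) := inferInstance
  have : D' = 0 := by
    rw [← D'.liftKaehlerDifferential_comp, Subsingleton.elim D'.liftKaehlerDifferential 0]
    ext; simp
  ext y
  exact congrArg (fun Δ : Derivation R F V => Δ y) this

end C0e

end

/-! ### C0f -/

section

section C0f
open Polynomial IntermediateField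

lemma tb_simple {F M : Type*} [Field F] [Field M] [Algebra F M] (t : M) (ht : Transcendental F t) (htop : F⟮t⟯ = ⊤) :
    IsTranscendenceBasis F (fun _ : Unit => t) := by
  let _ : Algebra F[X] M := (aeval t : F[X] →ₐ[F] M).toRingHom.toAlgebra
  have halg : ∀ P : F[X], algebraMap F[X] M P = aeval t P := fun P => rfl
  have := isFractionRing_of_top t ht htop halg
  have : IsScalarTower F F[X] M := IsScalarTower.of_algebraMap_eq fun c => by rw [halg]; simp
  have : Algebra.IsAlgebraic F[X] M := IsLocalization.isAlgebraic _ (nonZeroDivisors F[X])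
  have : FaithfulSMul F[X] M := (faithfulSMul_iff_algebraMap_injective _ _).2 (IsFractionRing.injective F[X] M)
  have h := (IsTranscendenceBasis.polynomial Unit F).algebraMap_comp (A := M)
  convert h using 1
  ext; simp [halg]

/-- Existence of derivations on `L ⊇ M = F(t)` with prescribed values, preserving `F`. -/
lemma der_ext {k F M L ι' : Type*} [Field k] [CharZero k] [Field F] [Field M] [Field L]
    [Algebra k F] [Algebra F M] [Algebra M L] [Algebra k L] [FiniteDimensional M L]
    (hkL : ∀ a : k, algebraMap k L a = algebraMap M L (algebraMap F M (algebraMap k F a)))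
    (t : M) (ht : Transcendental F t) (htop : F⟮t⟯ = ⊤) {b : ι' → F} (hb : IsTranscendenceBasis k b)
    (v : ι' → F) (s : L) : ∃ D : Derivation ℤ L L, (∀ a, D (algebraMap k L a) = 0) ∧ D (algebraMap M L t) = s ∧
      (∀ i, D (algebraMap M L (algebraMap F M (b i))) = algebraMap M L (algebraMap F M (v i))) ∧
      ((∀ a, ∃ a', D (algebraMap M L (algebraMap F M a)) = algebraMap M L (algebraMap F M a')) ∧
      (v = 0 → ∀ a, D (algebraMap M L (algebraMap F M a)) = 0)) := by
  let _ : Algebra F L := ((algebraMap M L).comp (algebraMap F M)).toAlgebra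
  have hFL : ∀ a, algebraMap M L (algebraMap F M a) = algebraMap F L a := fun a => rfl
  have : IsScalarTower F M L := IsScalarTower.of_algebraMap_eq fun _ => rfl
  have : IsScalarTower k F L := IsScalarTower.of_algebraMap_eq hkL
  have h1 : IsTranscendenceBasis F (fun _ : Unit => algebraMap M L t) := (tb_simple t ht htop).algebraMap_comp (A := L)
  have h2 := hb.sumElim_comp h1
  obtain ⟨D, hD⟩ := der_of_tb h2 (Sum.elim (fun _ => s) (fun i => algebraMap F L (v i)))
  obtain ⟨D0, hD0⟩ := der_of_tb hb v
  have hDF : ∀ a, D (algebraMap F L a) = algebraMap F L (D0 a) := by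
    let Δ : Derivation k F L := D.compAlgebraMap F - (Algebra.linearMap F L).compDer D0
    have hΔ : Δ = 0 := der_uniq hb Δ fun i => by
      have := hD (Sum.inr i)
      simp only [Sum.elim_inr, Function.comp_apply] at this
      simp [Δ, this, hD0]
    intro a
    have := congrArg (fun Δ : Derivation k F L => Δ a) hΔ
    simpa [Δ, sub_eq_zero] using this
  refine ⟨D.restrictScalars ℤ, fun a => by simp, hD (Sum.inl ()), fun i => hD (Sum.inr i), fun a => ⟨D0 a, hDF a⟩, ?_⟩
  rintro rfl a
  have : D0 = 0 := der_uniq hb D0 (by simpa using hD0)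
  have h3 := hDF a
  rw [this] at h3
  change D (algebraMap F L a) = 0
  simpa using h3

theorem core_0 {k F M L ι : Type*} [Field k] [Field F] [Field M] [Field L] [Fintype ι] [IsAlgClosed k] [CharZero k] [IsAlgClosed F]
    [Algebra k F] [Algebra F M] [Algebra M L] [Algebra k L] [FiniteDimensional M L]
    (hkL : ∀ a : k, algebraMap k L a = algebraMap M L (algebraMap F M (algebraMap k F a)))
    (t : M) (ht : Transcendental F t) (htop : F⟮t⟯ = ⊤)
    {c n : ℕ} (hn : 1 ≤ n) (hcard : Fintype.card ι = n + 1 + c) {d : Fin c → ℕ} {f : Fin c → MvPolynomial ι k} (hf : ∀ i, (f i).IsHomogeneous (d i))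
    (hsm : ∀ a : ι → k, a ≠ 0 → (∀ i, MvPolynomial.aeval a (f i) = 0) → (jacM f a).rank = c)
    (x : ι → L) (hfx : ∀ i, MvPolynomial.aeval x (f i) = 0) (j : ι) (hxj : x j = 1)
    (hxtop : IntermediateField.adjoin M (Set.range x) = ⊤)
    (hD : ∀ D : Derivation ℤ L L, (∀ a, D (algebraMap k L a) = 0) → (∀ i, D (x i) = 0) → D = 0)
    {s : ℕ} (hs : ∑ i, (d i - 1) = s + n + 1) (hrank : Module.finrank M L ≤ s + 1)
    (htr : (n : Cardinal) ≤ Algebra.trdeg k F + 1) : False := by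
  have : CharZero F := charZero_of_injective_algebraMap (algebraMap k F).injective
  have : CharZero M := charZero_of_injective_algebraMap (algebraMap F M).injective
  have : CharZero L := charZero_of_injective_algebraMap (algebraMap M L).injective
  have hx0 : x ≠ 0 := fun h => by rw [h] at hxj; simp at hxj
  have ht0 : t ≠ 0 := by rintro rfl; exact ht isAlgebraic_zero
  have htL : algebraMap M L t ≠ 0 := by simpa using ht0
  obtain ⟨m, rfl⟩ : ∃ m, n = m + 1 := ⟨n - 1, by omega⟩
  obtain ⟨ι', b, hb⟩ := exists_isTranscendenceBasis' k F
  obtain ⟨φ⟩ : Nonempty (Fin m ↪ ι') := by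
    rw [← Cardinal.lift_mk_le', Cardinal.mk_fin, Cardinal.lift_natCast, Cardinal.lift_uzero, hb.cardinalMk_eq_trdeg]
    push_cast at htr
    exact Cardinal.add_one_le_add_one_iff.1 htr
  classical
  choose D hDk hDt hDb hDF _ using fun i : Fin m => der_ext hkL t ht htop hb (Pi.single (φ i) 1) 0
  obtain ⟨E, hEk, hEt, hEb, _, hEF⟩ := der_ext hkL t ht htop hb 0 (algebraMap M L t)
  have hEF := hEF rfl
  set δ : Fin (m+1) → Derivation ℤ L L := Fin.cons E D with hδ
  have hδk : ∀ i (a : k), δ i (algebraMap k L a) = 0 := by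
    intro i a
    refine Fin.cases ?_ (fun i => ?_) i
    · exact hEk a
    · exact hDk i a
  have hli : LinearIndependent L δ := by
    rw [Fintype.linearIndependent_iff]
    intro q hq
    have h1 : ∀ y, q 0 * E y + ∑ i : Fin m, q i.succ * D i y = 0 := by
      intro y
      have h1 := congrArg (fun D : Derivation ℤ L L => D y) hq
      simpa [Fin.sum_univ_succ, der_sum_apply', hδ] using h1
    intro i
    refine Fin.cases ?_ (fun i => ?_) i
    · have := h1 (algebraMap M L t)
      simpa [hDt, hEt, ht0] using this
    · have := h1 (algebraMap M L (algebraMap F M (b (φ i))))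
      simpa [hDb, hEF, Pi.single_apply, apply_ite] using this
  obtain ⟨e0, he0⟩ := exists_e0 (n := m + 1) hcard hf hsm x hfx j hxj
  set J := geoF f x e0 δ with hJ
  have hJ0 : J ≠ 0 := geoF_ne_zero hf x hfx j hxj e0 he0 δ hδk hli hD
  have chart : ∀ τ : M, Transcendental F τ → F⟮τ⟯ = ⊤ → (∀ i, D i (algebraMap M L τ) = 0) →
      (E (algebraMap M L τ) = algebraMap M L τ ∨ E (algebraMap M L τ) = - algebraMap M L τ) → 
      ∀ g : MvPolynomial ι k, g.IsHomogeneous s → ∃ Q : F[X], Algebra.trace M L (MvPolynomial.aeval x g * J) = aeval τ (X * Q) := by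
    intro τ hτ hτtop h1 h2 g hg
    refine chart_0 hkL τ hτ hτtop D E hDF h1 hEF h2 _ ?_
    intro w hw
    obtain ⟨u, G, hu, hG, hG0⟩ := geo_local w hw hcard hf hsm x hfx hx0 e0 he0 hs g hg
    exact ⟨u, G, hu, hG, hG0 δ hδk⟩
  apply Algebra.trace_ne_zero M L
  refine fin_contra (k := k) x j hxj hxtop s hrank J hJ0 _ ?_
  intro g hg
  obtain ⟨Q1, hQ1⟩ := chart t ht htop hDt (Or.inl hEt) g hg
  obtain ⟨Q2, hQ2⟩ := chart t⁻¹ (transc_inv ht) (top_inv htop) (fun i => by rw [map_inv₀, Derivation.leibniz_inv, hDt, smul_zero])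
    (Or.inr (by rw [map_inv₀, Derivation.leibniz_inv, hEt, smul_eq_mul]; field_simp)) g hg
  have := poly_inv_zero ht Q1 Q2 (hQ1.symm.trans hQ2)
  exact hQ1.trans this

end C0f

end

/-! ### RED -/

section

section RED
open IntermediateField

lemma adjoin_gen_top {M Ω ι : Type*} [Field M] [Field Ω] [Algebra M Ω] (x : ι → Ω) :
    IntermediateField.adjoin M (Set.range fun i => (⟨x i, subset_adjoin _ _ ⟨i, rfl⟩⟩ : IntermediateField.adjoin M (Set.range x))) = ⊤ := by
  apply lift_injective (IntermediateField.adjoin M (Set.range x))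
  rw [lift_adjoin, lift_top, ← Set.range_comp]
  rfl

lemma der_zero_of_sep {P L : Type*} [Field P] [Field L] [Algebra P L] [Algebra.IsSeparable P L] (D : Derivation ℤ L L) (h : ∀ a, D (algebraMap P L a) = 0) : D = 0 := by
  let D' : Derivation P L L :=
    { toFun := D
      map_add' := map_add D
      map_smul' := fun r f => by
        rw [Algebra.smul_def, Derivation.leibniz, h, smul_zero, add_zero, RingHom.id_apply, algebraMap_smul]
      map_one_eq_zero' := D.map_one_eq_zero
      leibniz' := D.leibniz }
  have : Algebra.FormallyUnramified P L := Algebra.FormallyUnramified.of_isSeparable P L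
  have hsub : Subsingleton (Ω[L⁄P]) := inferInstance
  have : D' = 0 := by
    rw [← D'.liftKaehlerDifferential_comp, Subsingleton.elim D'.liftKaehlerDifferential 0]
    ext; simp
  ext y
  exact congrArg (fun Δ : Derivation P L L => Δ y) this

theorem red1 {k F Ω P ι : Type*} [Field k] [Field F] [Field Ω] [Field P] [Fintype ι] [IsAlgClosed k]
    [Algebra k F] [Algebra F Ω] [Algebra k Ω] [IsScalarTower k F Ω] [Algebra P Ω]
    (hcore : (CharZero k ∧ IsAlgClosed F) ∨ ∃ p : ℕ, p.Prime ∧ CharP k p ∧ (⊤ : IntermediateField k F).FG)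
    (t : Ω) (ht : Transcendental F t)
    (hPM : ∀ y : P, algebraMap P Ω y ∈ F⟮t⟯)
    {c n : ℕ} (hn : 1 ≤ n) (hcard : Fintype.card ι = n + 1 + c) {d : Fin c → ℕ} {f : Fin c → MvPolynomial ι k} (hf : ∀ i, (f i).IsHomogeneous (d i))
    (hsm : ∀ a : ι → k, a ≠ 0 → (∀ i, MvPolynomial.aeval a (f i) = 0) → (jacM f a).rank = c)
    (x : ι → Ω) (hfx : ∀ i, MvPolynomial.aeval x (f i) = 0) (j : ι) (hxj : x j = 1)
    (hsepF : ∀ a : F, IsSeparable (IntermediateField.adjoin k (Set.range x)) (algebraMap F Ω a))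
    (hsept : IsSeparable (IntermediateField.adjoin k (Set.range x)) t)
    (C : IntermediateField P Ω) (hxC : ∀ i, x i ∈ C) [FiniteDimensional P C]
    {s : ℕ} (hs : ∑ i, (d i - 1) = s + n + 1) (hrank : Module.finrank P C ≤ s + 1)
    (htr : (n : Cardinal) ≤ Algebra.trdeg k F + 1) : False := by
  let M := F⟮t⟯
  let L := IntermediateField.adjoin M (Set.range x)
  let _ : Algebra P M := ((algebraMap P Ω).codRestrict M hPM).toAlgebra
  have : IsScalarTower P M Ω := IsScalarTower.of_algebraMap_eq fun _ => rfl
  have hfin : FiniteDimensional M L ∧ Module.finrank M L ≤ s + 1 := by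
    have h1 := adjoin_rank_le_of_isAlgebraic_right (F := P) M C
    have h2 : L ≤ IntermediateField.adjoin M (C : Set Ω) := by
      apply adjoin.mono
      rintro _ ⟨i, rfl⟩
      exact hxC i
    have h3 : Module.rank M L ≤ Module.rank M (IntermediateField.adjoin M (C : Set Ω)) := 
      LinearMap.rank_le_of_injective (IntermediateField.inclusion h2).toLinearMap (IntermediateField.inclusion h2).injective
    have h4 := h3.trans h1
    have hfd : FiniteDimensional M L := by
      rw [FiniteDimensional, ← Module.rank_lt_aleph0_iff]
      exact h4.trans_lt (Module.rank_lt_aleph0 P C)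
    refine ⟨hfd, le_trans ?_ hrank⟩
    rw [← Module.finrank_eq_rank, ← Module.finrank_eq_rank] at h4
    exact_mod_cast h4
  obtain ⟨hfd, hrk⟩ := hfin
  let _ : Algebra k L := ((algebraMap M L).comp ((algebraMap F M).comp (algebraMap k F))).toAlgebra
  have hkL : ∀ a : k, algebraMap k L a = algebraMap M L (algebraMap F M (algebraMap k F a)) := fun a => rfl
  have hkΩ : ∀ a : k, ((algebraMap k L a : L) : Ω) = algebraMap k Ω a := fun a => (IsScalarTower.algebraMap_apply k F Ω a).symm
  let y : ι → L := fun i => ⟨x i, subset_adjoin _ _ ⟨i, rfl⟩⟩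
  have hytop : IntermediateField.adjoin M (Set.range y) = ⊤ := adjoin_gen_top x
  let τ : M := AdjoinSimple.gen F t
  have hτ : Transcendental F τ := by
    intro h
    apply ht
    have := h.algebraMap (A := Ω)
    exact this
  have hτtop : F⟮τ⟯ = ⊤ := gen_top t
  let LL : L →+* Ω := algebraMap L Ω
  have hLL : Function.Injective LL := LL.injective
  have hfy : ∀ i, MvPolynomial.aeval y (f i) = 0 := by
    intro i
    apply hLL
    rw [map_zero, ← hfx i, MvPolynomial.aeval_def, MvPolynomial.aeval_def, MvPolynomial.hom_eval₂]
    congr 1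
    ext a
    exact hkΩ a
  have hyj : y j = 1 := Subtype.ext hxj
  have hD : ∀ D : Derivation ℤ L L, (∀ a, D (algebraMap k L a) = 0) → (∀ i, D (y i) = 0) → D = 0 := by
    intro D hDk hDy
    let Q := IntermediateField.adjoin k (Set.range x)
    have hQL : ∀ a : Q, ∃ l : L, (l : Ω) = a ∧ D l = 0 := by
      rintro ⟨a, ha⟩
      induction ha using adjoin_induction with
      | mem z hz => obtain ⟨i, rfl⟩ := hz; exact ⟨y i, rfl, hDy i⟩
      | algebraMap a => exact ⟨algebraMap k L a, hkΩ a, hDk a⟩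
      | add a b _ _ ha hb =>
        obtain ⟨a', ha, ha'⟩ := ha
        obtain ⟨b', hb, hb'⟩ := hb
        exact ⟨a' + b', by simp [ha, hb], by simp [ha', hb']⟩
      | inv a _ ha =>
        obtain ⟨a', ha, ha'⟩ := ha
        exact ⟨a'⁻¹, by simp [ha], by simp [Derivation.leibniz_inv, ha']⟩
      | mul a b _ _ ha hb =>
        obtain ⟨a', ha, ha'⟩ := ha
        obtain ⟨b', hb, hb'⟩ := hb
        exact ⟨a' * b', by simp [ha, hb], by simp [ha', hb']⟩
    let _ : Algebra Q L := ((algebraMap Q Ω).codRestrict L (fun a => by obtain ⟨l, hl, _⟩ := hQL a; change (a : Ω) ∈ L; rw [← hl]; exact l.2)).toAlgebra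
    have : IsScalarTower Q L Ω := IsScalarTower.of_algebraMap_eq fun _ => rfl
    have hsepL : ∀ l : L, (l : Ω) ∈ separableClosure Q Ω := by
      have hM : ∀ z ∈ M, z ∈ separableClosure Q Ω := by
        intro z hz
        induction hz using adjoin_induction with
        | mem z hz => rw [Set.mem_singleton_iff] at hz; rw [hz]; exact mem_separableClosure_iff.2 hsept
        | algebraMap a => exact mem_separableClosure_iff.2 (hsepF a)
        | add a b _ _ ha hb => exact add_mem ha hb
        | inv a _ ha => exact inv_mem ha
        | mul a b _ _ ha hb => exact mul_mem ha hb
      rintro ⟨z, hz⟩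
      change z ∈ separableClosure Q Ω
      induction hz using adjoin_induction with
      | mem z hz => 
        obtain ⟨i, rfl⟩ := hz
        exact (separableClosure Q Ω).algebraMap_mem (⟨x i, subset_adjoin _ _ ⟨i, rfl⟩⟩ : Q)
      | algebraMap a => exact hM _ a.2
      | add a b _ _ ha hb => exact add_mem ha hb
      | inv a _ ha => exact inv_mem ha
      | mul a b _ _ ha hb => exact mul_mem ha hb
    have : Algebra.IsSeparable Q L := ⟨fun l => by
      have := mem_separableClosure_iff.1 (hsepL l)
      exact IsSeparable.of_algHom (IsScalarTower.toAlgHom Q L Ω) this⟩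
    refine der_zero_of_sep (P := Q) D fun a => ?_
    obtain ⟨l, hl, hl'⟩ := hQL a
    have : algebraMap Q L a = l := Subtype.ext hl.symm
    rw [this, hl']
  rcases hcore with ⟨h0, hF⟩ | ⟨p, hp, hcp, hfg⟩
  · exact core_0 hkL τ hτ hτtop hn hcard hf hsm y hfy j hyj hytop hD hs hrk htr
  · have : Fact p.Prime := ⟨hp⟩
    exact core_p (p := p) hkL hfg τ hτ hτtop hcard hf hsm y hfy j hyj hytop hD hs hrk htr

end RED

end

/-! ### RED2 -/

section

section RED2
open IntermediateField

lemma fg_aux {k k' B Ω : Type*} [Field k] [Field k'] [Field B] [Field Ω] [Algebra k k'] [Algebra k B] [Algebra k' Ω] [Algebra B Ω] [Algebra k Ω]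
    [IsScalarTower k k' Ω] [IsScalarTower k B Ω] (hfg : (⊤ : IntermediateField k B).FG) (F : IntermediateField B Ω) (hF : F = IntermediateField.adjoin B (Set.range (algebraMap k' Ω)))
    [Algebra k' F] [IsScalarTower k' F Ω] : (⊤ : IntermediateField k' F).FG := by
  obtain ⟨S, hS⟩ := hfg
  classical
  refine ⟨S.image (algebraMap B F), ?_⟩
  rw [eq_top_iff]
  rintro ⟨y, hy⟩ -
  suffices h : ∃ l ∈ IntermediateField.adjoin k' (S.image (algebraMap B F) : Set F), (l : Ω) = y by
    obtain ⟨l, hl, rfl⟩ := h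
    exact hl
  have hy' := hy
  rw [hF] at hy'
  clear hy
  induction hy' using adjoin_induction with
  | mem z hz =>
    obtain ⟨b, rfl⟩ := hz
    exact ⟨algebraMap k' F b, IntermediateField.algebraMap_mem _ _, (IsScalarTower.algebraMap_apply k' F Ω b).symm⟩
  | algebraMap b =>
    refine ⟨algebraMap B F b, ?_, rfl⟩
    have hb : b ∈ IntermediateField.adjoin k (S : Set B) := by rw [hS]; trivial
    induction hb using adjoin_induction with
    | mem z hz => exact subset_adjoin _ _ (by rw [Finset.coe_image]; exact ⟨z, hz, rfl⟩)
    | algebraMap a =>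
      have : algebraMap B F (algebraMap k B a) = algebraMap k' F (algebraMap k k' a) := by
        apply (algebraMap F Ω).injective
        rw [← IsScalarTower.algebraMap_apply k' F Ω, ← IsScalarTower.algebraMap_apply k k' Ω, ← IsScalarTower.algebraMap_apply B F Ω, ← IsScalarTower.algebraMap_apply k B Ω]
      rw [this]; exact IntermediateField.algebraMap_mem _ _
    | add a b _ _ ha hb => rw [map_add]; exact add_mem ha hb
    | inv a _ ha => rw [map_inv₀]; exact inv_mem ha
    | mul a b _ _ ha hb => rw [map_mul]; exact mul_mem ha hb
  | add a b _ _ ha hb =>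
    obtain ⟨a', ha, ha'⟩ := ha
    obtain ⟨b', hb, hb'⟩ := hb
    exact ⟨a' + b', add_mem ha hb, by simp [ha', hb']⟩
  | inv a _ ha =>
    obtain ⟨a', ha, ha'⟩ := ha
    exact ⟨a'⁻¹, inv_mem ha, by simp [ha']⟩
  | mul a b _ _ ha hb =>
    obtain ⟨a', ha, ha'⟩ := ha
    obtain ⟨b', hb, hb'⟩ := hb
    exact ⟨a' * b', mul_mem ha hb, by simp [ha', hb']⟩

theorem red2 {k : Type u} {B P C : Type w} {ι : Type*} [Field k] [Field B] [Field P] [Field C] [Fintype ι]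
    [Algebra k B] [Algebra B P] [Algebra P C] [Algebra k C] [FiniteDimensional P C]
    (hkC : ∀ a : k, algebraMap k C a = algebraMap P C (algebraMap B P (algebraMap k B a)))
    (hfg : (⊤ : IntermediateField k B).FG)
    (t : P) (ht : Transcendental B t) (htop : B⟮t⟯ = ⊤)
    {c n : ℕ} (hn : 1 ≤ n) (hcard : Fintype.card ι = n + 1 + c) {d : Fin c → ℕ} {f : Fin c → MvPolynomial ι k} (hf : ∀ i, (f i).IsHomogeneous (d i))
    (hsm : ∀ a : ι → AlgebraicClosure k, a ≠ 0 → (∀ i, MvPolynomial.eval a (MvPolynomial.map (algebraMap k (AlgebraicClosure k)) (f i)) = 0) →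
      (Matrix.of fun (i : Fin c) (j : ι) =>
          MvPolynomial.eval a (MvPolynomial.pderiv j
            (MvPolynomial.map (algebraMap k (AlgebraicClosure k)) (f i)))).rank = c)
    (x : ι → C) (hfx : ∀ i, MvPolynomial.aeval x (f i) = 0) (j : ι) (hxj : x j = 1)
    (hsep : ∀ a : C, IsSeparable (IntermediateField.adjoin k (Set.range x)) a)
    {s : ℕ} (hs : ∑ i, (d i - 1) = s + n + 1) (hrank : Module.finrank P C ≤ s + 1)
    (htr : (n : Cardinal) ≤ Algebra.trdeg k B + 1) : False := by
  let _ : Algebra B C := ((algebraMap P C).comp (algebraMap B P)).toAlgebra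
  have : IsScalarTower B P C := IsScalarTower.of_algebraMap_eq fun _ => rfl
  have : IsScalarTower k B C := IsScalarTower.of_algebraMap_eq hkC
  let Ω := AlgebraicClosure C
  let k' := AlgebraicClosure k
  let σ : k' →ₐ[k] Ω := IsAlgClosed.lift
  let _ : Algebra k' Ω := σ.toRingHom.toAlgebra
  have : IsScalarTower k k' Ω := IsScalarTower.of_algHom σ
  let x' : ι → Ω := fun i => algebraMap C Ω (x i)
  let Q := IntermediateField.adjoin k (Set.range x)
  let Q' := IntermediateField.adjoin k' (Set.range x')
  have hQQ : ∀ a : Q, algebraMap C Ω (a : C) ∈ Q' := by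
    rintro ⟨a, ha⟩
    change algebraMap C Ω a ∈ Q'
    induction ha using adjoin_induction with
    | mem z hz => obtain ⟨i, rfl⟩ := hz; exact subset_adjoin _ _ ⟨i, rfl⟩
    | algebraMap a => 
      rw [← IsScalarTower.algebraMap_apply k C Ω, IsScalarTower.algebraMap_apply k k' Ω]
      exact Q'.algebraMap_mem _
    | add a b _ _ ha hb => rw [map_add]; exact add_mem ha hb
    | inv a _ ha => rw [map_inv₀]; exact inv_mem ha
    | mul a b _ _ ha hb => rw [map_mul]; exact mul_mem ha hb
  let _ : Algebra Q Q' := (((algebraMap C Ω).comp (algebraMap Q C)).codRestrict Q' hQQ).toAlgebra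
  have : IsScalarTower Q Q' Ω := IsScalarTower.of_algebraMap_eq fun _ => rfl
  have hsep' : ∀ a : C, IsSeparable Q' (algebraMap C Ω a) := by
    intro a
    have h1 : IsSeparable Q (algebraMap C Ω a) := IsSeparable.map (IsScalarTower.toAlgHom Q C Ω) (algebraMap C Ω).injective (hsep a)
    exact IsSeparable.tower_top Q' h1
  let t' : Ω := algebraMap P Ω t
  have ht' : Transcendental B t' := by
    intro h
    exact ht ((isAlgebraic_algebraMap_iff (algebraMap P Ω).injective).1 h)
  -- general argument
  have main : ∀ F : IntermediateField B Ω, Algebra.IsAlgebraic B F → ∀ (hkF : ∀ a : k', algebraMap k' Ω a ∈ F),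
      (∀ a ∈ F, IsSeparable Q' a) →
      (∀ (_ : Algebra k' F) (_ : IsScalarTower k' F Ω), (CharZero k' ∧ IsAlgClosed F) ∨ ∃ p : ℕ, p.Prime ∧ CharP k' p ∧ (⊤ : IntermediateField k' F).FG) → False := by
    intro F hFB hkF hsepF hcore
    let _ : Algebra k' F := ((algebraMap k' Ω).codRestrict F hkF).toAlgebra
    have hT : IsScalarTower k' F Ω := IsScalarTower.of_algebraMap_eq fun _ => rfl
    have : IsScalarTower k k' F := IsScalarTower.of_algebraMap_eq fun a => Subtype.ext (by
      change algebraMap k Ω a = algebraMap k' Ω (algebraMap k k' a)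
      exact IsScalarTower.algebraMap_apply k k' Ω a)
    have htF : Transcendental F t' := (Algebra.IsAlgebraic.transcendental_iff B F).1 ht'
    have hPM : ∀ y : P, algebraMap P Ω y ∈ F⟮t'⟯ := by
      intro y
      have hy : y ∈ B⟮t⟯ := by rw [htop]; trivial
      induction hy using adjoin_induction with
      | mem z hz => rw [Set.mem_singleton_iff] at hz; rw [hz]; exact mem_adjoin_simple_self F t'
      | algebraMap a => 
        rw [← IsScalarTower.algebraMap_apply B P Ω, IsScalarTower.algebraMap_apply B F Ω]
        exact F⟮t'⟯.algebraMap_mem _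
      | add a b _ _ ha hb => rw [map_add]; exact add_mem ha hb
      | inv a _ ha => rw [map_inv₀]; exact inv_mem ha
      | mul a b _ _ ha hb => rw [map_mul]; exact mul_mem ha hb
    let C' : IntermediateField P Ω := (IsScalarTower.toAlgHom P C Ω).fieldRange
    let eC : C ≃ₐ[P] C' := AlgEquiv.ofInjectiveField (IsScalarTower.toAlgHom P C Ω)
    have : FiniteDimensional P C' := eC.toLinearEquiv.finiteDimensional
    refine red1 (k := k') (F := F) (Ω := Ω) (P := P) (hcore _ hT) t' htF hPM hn hcard
      (f := fun i => MvPolynomial.map (algebraMap k k') (f i)) (d := d) (fun i => (hf i).map _) ?_ x' ?_ j ?_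
      (fun a => hsepF _ a.2) (hsep' _) C' (fun i => ⟨x i, rfl⟩) hs ?_ ?_
    · intro a ha hfa
      convert hsm a ha (fun i => by simpa [MvPolynomial.aeval_eq_eval] using hfa i) using 2
      ext i j
      simp [jacM, MvPolynomial.aeval_eq_eval]
      rfl
    · intro i
      have := congrArg (algebraMap C Ω) (hfx i)
      rw [map_zero] at this
      rw [MvPolynomial.aeval_map_algebraMap, ← this, ← MvPolynomial.aeval_algebraMap_apply]
      rfl
    · simp [x', hxj]
    · rw [← eC.toLinearEquiv.finrank_eq]; exact hrank
    · have : FaithfulSMul k' F := (faithfulSMul_iff_algebraMap_injective _ _).2 (algebraMap k' F).injective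
      have h1 := lift_trdeg_add_eq k k' F
      have h2 := trdeg_add_eq k B (A := F)
      rw [trdeg_eq_zero, Cardinal.lift_zero, zero_add, Cardinal.lift_inj] at h1
      rw [trdeg_eq_zero (R := B), add_zero] at h2
      rw [h1, ← h2]; exact htr
  rcases CharP.exists' k with h0 | ⟨p, hp, hcp⟩
  · -- characteristic zero
    have h0' : CharZero k' := charZero_of_injective_algebraMap (algebraMap k k').injective
    have h0Q : CharZero Q' := charZero_of_injective_algebraMap (algebraMap k' Q').injective
    refine main (algebraicClosure B Ω) inferInstance ?_ ?_ ?_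
    · intro a
      rw [mem_algebraicClosure_iff]
      have h1 : IsAlgebraic k (algebraMap k' Ω a) := (Algebra.IsAlgebraic.isAlgebraic (R := k) a).algebraMap
      exact h1.tower_top B
    · intro a ha
      rw [mem_algebraicClosure_iff] at ha
      let A := algebraicClosure Q' Ω
      have hBA : ∀ b : B, algebraMap B Ω b ∈ A := by
        intro b
        rw [mem_algebraicClosure_iff, IsScalarTower.algebraMap_apply B C Ω]
        exact (hsep' _).isIntegral.isAlgebraic
      let _ : Algebra B A := ((algebraMap B Ω).codRestrict A hBA).toAlgebra
      have : IsScalarTower B A Ω := IsScalarTower.of_algebraMap_eq fun _ => rfl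
      have h1 : IsAlgebraic A a := ha.tower_top A
      have h2 : IsAlgebraic Q' a := h1.restrictScalars Q'
      exact (minpoly.irreducible h2.isIntegral).separable
    · intro _ _
      exact Or.inl ⟨h0', IsAlgClosure.isAlgClosed B⟩
  · have hcp' : CharP k' p := charP_of_injective_algebraMap (algebraMap k k').injective p
    have h_integral : ∀ y ∈ Set.range (algebraMap k' Ω), IsIntegral B y := by
      rintro _ ⟨a, rfl⟩
      have h1 : IsAlgebraic k (algebraMap k' Ω a) := (Algebra.IsAlgebraic.isAlgebraic (R := k) a).algebraMap
      exact (h1.tower_top B).isIntegral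
    refine main (IntermediateField.adjoin B (Set.range (algebraMap k' Ω))) (isAlgebraic_adjoin h_integral) (fun a => subset_adjoin _ _ ⟨a, rfl⟩) ?_ ?_
    · intro a ha
      rw [← mem_separableClosure_iff]
      induction ha using adjoin_induction with
      | mem z hz =>
        obtain ⟨b, rfl⟩ := hz
        rw [IsScalarTower.algebraMap_apply k' Q' Ω]
        exact (separableClosure Q' Ω).algebraMap_mem _
      | algebraMap b =>
        rw [mem_separableClosure_iff, IsScalarTower.algebraMap_apply B C Ω]
        exact hsep' _
      | add a b _ _ ha hb => exact add_mem ha hb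
      | inv a _ ha => exact inv_mem ha
      | mul a b _ _ ha hb => exact mul_mem ha hb
    · intro _ hT
      refine Or.inr ⟨p, hp.out, hcp', ?_⟩
      exact fg_aux (k := k) hfg _ rfl

end RED2

end

/-! ### TR -/

section

section TR

lemma krullDim_le_of_integral {A R : Type*} [CommRing A] [CommRing R] [Algebra A R] [Algebra.IsIntegral A R] : ringKrullDim R ≤ ringKrullDim A := by
  refine Order.krullDim_le_of_strictMono (fun p : PrimeSpectrum R => PrimeSpectrum.comap (algebraMap A R) p) ?_
  intro p q hpq
  have h : p.asIdeal < q.asIdeal := hpq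
  obtain ⟨y, hy, hyp⟩ := Set.exists_of_ssubset h
  have := p.isPrime
  exact Ideal.comap_lt_comap_of_integral_mem_sdiff (R := A) h.le ⟨hy, hyp⟩ (Algebra.IsIntegral.isIntegral y)

lemma trdeg_ge_dim {K R : Type*} [Field K] [CommRing R] [IsDomain R] [Algebra K R] [Algebra.FiniteType K R] (m : ℕ) (h : (m : WithBot ℕ∞) ≤ ringKrullDim R) :
    (m : Cardinal) ≤ Algebra.trdeg K R := by
  obtain ⟨s, g, hg, h_integral⟩ := exists_integral_inj_algHom_of_fg K R
  let _ : Algebra (MvPolynomial (Fin s) K) R := g.toRingHom.toAlgebra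
  have : Algebra.IsIntegral (MvPolynomial (Fin s) K) R := ⟨h_integral⟩
  have h1 := h.trans (krullDim_le_of_integral (A := MvPolynomial (Fin s) K) (R := R))
  rw [MvPolynomial.ringKrullDim_of_isNoetherianRing, ringKrullDim_eq_zero_of_field, zero_add] at h1
  have h2 : m ≤ s := by simpa using h1
  have h3 : AlgebraicIndependent K (fun i : Fin s => g (MvPolynomial.X i)) := by
    have : (MvPolynomial.aeval fun i : Fin s => g (MvPolynomial.X i)) = g := by ext; simp
    rw [AlgebraicIndependent, this]; exact hg
  have h4 := h3.lift_cardinalMk_le_trdeg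
  have h5 : (s : Cardinal) ≤ Algebra.trdeg K R := by simpa using h4
  exact le_trans (by exact_mod_cast h2) h5

lemma trdeg_le_of_integral_range {k : Type u} {R R' : Type w} [Field k] [CommRing R] [CommRing R'] [IsDomain R'] [Algebra k R] [Algebra k R'] (φ : R →ₐ[k] R')
    (h_integral : Algebra.IsIntegral φ.range R') : Algebra.trdeg k R' ≤ Algebra.trdeg k R := by
  have h3 : Algebra.trdeg k φ.range ≤ Algebra.trdeg k R := trdeg_le_of_surjective φ.rangeRestrict φ.rangeRestrict_surjective
  have h4 := trdeg_add_eq k φ.range (A := R')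
  rw [trdeg_eq_zero (R := φ.range), add_zero] at h4
  rw [← h4]
  exact h3

/-- Transcendence degree of the coordinate ring over the base field. -/
lemma trdeg_cone {k : Type u} [Field k] {σ : Type} [Fintype σ] {c : ℕ} (f : Fin c → MvPolynomial σ k) [hI : (Ideal.span (Set.range f)).IsPrime]
    (hgeom : (Ideal.span (Set.range fun i =>
        MvPolynomial.map (algebraMap k (AlgebraicClosure k)) (f i))).IsPrime) (m : ℕ)
    (hdim : ringKrullDim (MvPolynomial σ (AlgebraicClosure k) ⧸
        Ideal.span (Set.range fun i =>
          MvPolynomial.map (algebraMap k (AlgebraicClosure k)) (f i))) = (m : WithBot ℕ∞)) :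
    (m : Cardinal) ≤ Algebra.trdeg k (MvPolynomial σ k ⧸ Ideal.span (Set.range f)) := by
  set I' := Ideal.span (Set.range fun i => MvPolynomial.map (algebraMap k (AlgebraicClosure k)) (f i)) with hI'
  let k' := AlgebraicClosure k
  let R' := MvPolynomial σ k' ⧸ I'
  have h1 : (m : Cardinal) ≤ Algebra.trdeg k' R' := trdeg_ge_dim m hdim.ge
  have hdom : IsDomain R' := Ideal.Quotient.isDomain I'
  have hfa : FaithfulSMul k' R' := (faithfulSMul_iff_algebraMap_injective _ _).2 (algebraMap k' R').injective
  have h2 := trdeg_add_eq k k' (A := R')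
  rw [trdeg_eq_zero, zero_add] at h2
  rw [h2] at h1
  let φ0 : MvPolynomial σ k →ₐ[k] R' := MvPolynomial.aeval fun i => Ideal.Quotient.mk I' (MvPolynomial.X i)
  have hφ0 : ∀ p, φ0 p = Ideal.Quotient.mk I' (MvPolynomial.map (algebraMap k k') p) := by
    intro p
    induction p using MvPolynomial.induction_on with
    | C a => simp [φ0]; rfl
    | add p q hp hq => rw [map_add, hp, hq, map_add, map_add]
    | mul_X p i hp => rw [map_mul, hp, map_mul, map_mul]; simp [φ0]
  let φ : (MvPolynomial σ k ⧸ Ideal.span (Set.range f)) →ₐ[k] R' := Ideal.Quotient.liftₐ _ φ0 (by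
    intro a ha
    have : Ideal.span (Set.range f) ≤ RingHom.ker φ0 := by
      rw [Ideal.span_le]
      rintro _ ⟨i, rfl⟩
      change φ0 (f i) = 0
      rw [hφ0, Ideal.Quotient.eq_zero_iff_mem]
      exact Ideal.subset_span ⟨i, rfl⟩
    exact this ha)
  let R0 := φ.range
  have h_integral : Algebra.IsIntegral R0 R' := by
    constructor
    intro y
    obtain ⟨p, rfl⟩ := Ideal.Quotient.mk_surjective y
    induction p using MvPolynomial.induction_on with
    | C a => 
      have h : IsIntegral k (algebraMap k' R' a) := (Algebra.IsIntegral.isIntegral (R := k) a).algebraMap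
      exact h.tower_top
    | add p q hp hq => rw [map_add]; exact hp.add hq
    | mul_X p i hp =>
      rw [map_mul]
      refine hp.mul ?_
      have : Ideal.Quotient.mk I' (MvPolynomial.X i) = algebraMap R0 R' ⟨φ (Ideal.Quotient.mk _ (MvPolynomial.X i)), ⟨_, rfl⟩⟩ := by
        change _ = φ0 (MvPolynomial.X i)
        simp [φ0]
      rw [this]
      exact isIntegral_algebraMap
  exact h1.trans (trdeg_le_of_integral_range φ h_integral)

end TR

end

/-! ### FF -/

section

section FF
open IntermediateField MvPolynomial

lemma ff_homog {k Fr : Type*} [Field k] [Field Fr] [Algebra k Fr] {n : ℕ} (y : Fin n → Fr) (j : Fin n) (hj : y j ≠ 0) {p : MvPolynomial (Fin n) k} {m : ℕ} (hp : p.IsHomogeneous m) :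
    aeval y p = y j ^ m * aeval (fun i => y i / y j) p := by
  rw [← homog_aeval_smul hp]
  congr 2
  funext i
  field_simp

lemma aeval_mem_adjoin {k Fr ι : Type*} [Field k] [Field Fr] [Algebra k Fr] (y : ι → Fr) (p : MvPolynomial ι k) :
    aeval y p ∈ IntermediateField.adjoin k (Set.range y) := by
  induction p using MvPolynomial.induction_on with
  | C a => rw [aeval_C]; exact IntermediateField.algebraMap_mem _ _
  | add p q hp hq => rw [map_add]; exact add_mem hp hq
  | mul_X p i hp => rw [map_mul, aeval_X]; exact mul_mem hp (subset_adjoin _ _ ⟨i, rfl⟩)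

lemma ff_adjoin {k Fr : Type*} [Field k] [Field Fr] [Algebra k Fr] {n : ℕ} (y : Fin n → Fr) (j : Fin n) (hj : y j ≠ 0) :
    IntermediateField.adjoin k {x | ∃ (p q : MvPolynomial (Fin n) k) (m : ℕ), p.IsHomogeneous m ∧ q.IsHomogeneous m ∧
      aeval y q ≠ 0 ∧ x = aeval y p / aeval y q} = IntermediateField.adjoin k (Set.range fun i => y i / y j) := by
  apply le_antisymm
  · rw [adjoin_le_iff]
    rintro x ⟨p, q, m, hp, hq, hq0, rfl⟩
    rw [ff_homog y j hj hp, ff_homog y j hj hq, mul_div_mul_left _ _ (pow_ne_zero _ hj)]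
    exact div_mem (aeval_mem_adjoin _ _) (aeval_mem_adjoin _ _)
  · rw [adjoin_le_iff]
    rintro _ ⟨i, rfl⟩
    exact subset_adjoin _ _ ⟨X i, X j, 1, isHomogeneous_X _ _, isHomogeneous_X _ _, by simpa using hj, by simp⟩

lemma ff_trdeg {k Fr : Type*} [Field k] [Field Fr] [Algebra k Fr] {n : ℕ} (y : Fin n → Fr) (j : Fin n) (hj : y j ≠ 0)
    (htop : IntermediateField.adjoin k (Set.range y) = ⊤) (K : IntermediateField k Fr) (hK : ∀ i, y i / y j ∈ K) :
    Algebra.trdeg k Fr ≤ Algebra.trdeg k K + 1 := by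
  rw [← trdeg_add_eq k K (A := Fr)]
  refine add_le_add le_rfl ?_
  apply trdeg_simple_le_one (y j)
  have h2 : ∀ i, y i ∈ K⟮y j⟯ := by
    intro i
    have h1 : algebraMap K Fr ⟨y i / y j, hK i⟩ * y j = y i := div_mul_cancel₀ _ hj
    have h3 := mul_mem (K⟮y j⟯.algebraMap_mem ⟨y i / y j, hK i⟩) (mem_adjoin_simple_self K (y j))
    rwa [h1] at h3
  have h4 : (⊤ : IntermediateField k Fr) ≤ K⟮y j⟯.restrictScalars k := by
    rw [← htop, adjoin_le_iff]
    rintro _ ⟨i, rfl⟩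
    exact h2 i
  rw [← restrictScalars_eq_top_iff (K := k)]
  exact top_le_iff.1 h4

lemma ff_exists {k Fr : Type*} [Field k] [Field Fr] [Algebra k Fr] {n : ℕ} (y : Fin n → Fr)
    (htop : IntermediateField.adjoin k (Set.range y) = ⊤) (h : 1 ≤ Algebra.trdeg k Fr) : ∃ j, y j ≠ 0 := by
  by_contra! hc
  have h1 : (⊤ : IntermediateField k Fr) ≤ ⊥ := by
    rw [← htop, adjoin_le_iff]
    rintro _ ⟨i, rfl⟩
    rw [hc]; exact zero_mem _
  have : Algebra.IsAlgebraic k Fr := by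
    constructor
    intro a
    obtain ⟨b, hb⟩ := mem_bot.1 (h1 (mem_top (x := a)))
    rw [← hb]; exact isAlgebraic_algebraMap b
  rw [trdeg_eq_zero] at h
  simp at h

end FF

end

/-! ### NE -/

section

section NE
open IntermediateField

lemma finite_of_fg_alg {k K : Type*} [Field k] [Field K] [Algebra k K] (S : Set K) [Finite S] (hS : IntermediateField.adjoin k S = ⊤) [Algebra.IsAlgebraic k K] : FiniteDimensional k K := by
  have := finiteDimensional_adjoin (K := k) (S := S) (fun x _ => (Algebra.IsAlgebraic.isAlgebraic x).isIntegral)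
  rw [hS] at this
  exact topEquiv.toLinearEquiv.finiteDimensional

lemma alg_of_subset_range {k P K : Type*} [Field k] [Field P] [Field K] [Algebra k P] [Algebra P K] [Algebra k K] [IsScalarTower k P K]
    (s : Set K) (hs : s ⊆ Set.range (algebraMap P K)) [Algebra.IsAlgebraic (IntermediateField.adjoin k s) K] : Algebra.IsAlgebraic P K := by
  let g : P →ₐ[k] K := IsScalarTower.toAlgHom k P K
  have hle : IntermediateField.adjoin k s ≤ g.fieldRange := by
    rw [adjoin_le_iff]
    intro a ha
    obtain ⟨b, rfl⟩ := hs ha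
    exact ⟨b, rfl⟩
  let φ : IntermediateField.adjoin k s →+* P := ((AlgEquiv.ofInjectiveField g).symm.toAlgHom.comp (inclusion hle)).toRingHom
  let _ : Algebra (IntermediateField.adjoin k s) P := φ.toAlgebra
  have : IsScalarTower (IntermediateField.adjoin k s) P K := IsScalarTower.of_algebraMap_eq fun a => by
    change a.1 = g ((AlgEquiv.ofInjectiveField g).symm (inclusion hle a))
    have h := (AlgEquiv.ofInjectiveField g).apply_symm_apply (inclusion hle a)
    exact (congrArg Subtype.val h).symm
  exact Algebra.IsAlgebraic.tower_top (K := IntermediateField.adjoin k s) P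

lemma exists_diagram {k K : Type u} [Field k] [Field K] [Algebra k K] (S : Set K) [Finite S] (hS : IntermediateField.adjoin k S = ⊤)
   (h : 1 ≤ Algebra.trdeg k K) : ∃ e, 0 < e ∧ HasSepCvgDiagram k K e := by
  have : Algebra.IsAlgebraic (Algebra.adjoin k S) K := by
    constructor
    intro a
    rw [← isAlgebraic_adjoin_iff]
    have : a ∈ IntermediateField.adjoin k S := by rw [hS]; trivial
    exact isAlgebraic_algebraMap (⟨a, this⟩ : IntermediateField.adjoin k S)
  obtain ⟨s, -, hs, hb⟩ := exists_isTranscendenceBasis_between (R := k) (∅ : Set K) S (Set.empty_subset _)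
    ((algebraicIndependent_empty_iff k K).mpr (algebraMap k K).injective)
  have hfin : s.Finite := (Set.toFinite S).subset hs
  have hne : s.Nonempty := by
    rw [Set.nonempty_iff_ne_empty]
    rintro rfl
    have h1 := hb.lift_cardinalMk_eq_trdeg
    simp at h1
    rw [← h1] at h
    simp at h
  obtain ⟨b, hbs⟩ := hne
  let T : Set K := s \ {b}
  let KB := IntermediateField.adjoin k T
  have htr : Transcendental KB b := by
    rw [transcendental_adjoin_iff]
    have h1 := hb.1.transcendental_adjoin (s := {i : s | i.1 ≠ b}) (i := ⟨b, hbs⟩) (by simp)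
    have h2 : (Subtype.val '' {i : s | i.1 ≠ b}) = T := by
      ext a; simp [T, and_comm]
    rw [h2] at h1
    exact h1
  have hTfin : Finite T := (hfin.subset Set.sdiff_subset).to_subtype
  let π0 : RatFunc KB →ₐ[KB] K := (KB⟮b⟯.val).comp (RatFunc.algEquivOfTranscendental b htr).toAlgHom
  let π : RatFunc KB →ₐ[k] K := π0.restrictScalars k
  have hX : π RatFunc.X = b := by
    change ((RatFunc.algEquivOfTranscendental b htr) RatFunc.X).1 = b
    simp
  have hKB : ∀ a : KB, π (algebraMap KB (RatFunc KB) a) = a := fun a => π0.commutes a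
  let _ : Algebra (RatFunc KB) K := π.toRingHom.toAlgebra
  have : IsScalarTower k (RatFunc KB) K := IsScalarTower.of_algebraMap_eq fun a => (π.commutes a).symm
  have hFD : FiniteDimensional (RatFunc KB) K := by
    have h1 := hb.isAlgebraic_field
    rw [Subtype.range_coe] at h1
    have : Algebra.IsAlgebraic (RatFunc KB) K := by
      refine alg_of_subset_range (k := k) s fun a ha => ?_
      by_cases hab : a = b
      · exact ⟨RatFunc.X, hX.trans hab.symm⟩
      · exact ⟨algebraMap KB _ ⟨a, subset_adjoin _ _ ⟨ha, hab⟩⟩, hKB _⟩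
    refine finite_of_fg_alg S ?_
    rw [← restrictScalars_eq_top_iff (K := k), ← top_le_iff, ← hS, adjoin_le_iff]
    exact subset_adjoin (RatFunc KB) S
  refine ⟨Module.finrank (RatFunc KB) K, Module.finrank_pos, KB, K, inferInstance, inferInstance, inferInstance, inferInstance, ?_, ?_, AlgHom.id k K, π, ?_, ?_, rfl⟩
  · refine fg_def.2 ⟨Set.range fun a : T => (⟨a.1, subset_adjoin _ _ a.2⟩ : KB), Set.finite_range _, ?_⟩
    have h := adjoin_gen_top (M := k) (fun a : T => a.1)
    apply lift_injective KB
    rw [lift_adjoin, lift_top, ← Set.range_comp]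
    change IntermediateField.adjoin k (Set.range fun a : T => a.1) = KB
    rw [Subtype.range_coe]
  · exact fg_def.2 ⟨S, Set.toFinite _, hS⟩
  · exact RingHom.Finite.id K
  · exact Algebra.isSeparable_self K
end NE

end

/-! ### MAIN -/

section

section MAIN
open IntermediateField

lemma sep_transfer {k K C ι : Type*} [Field k] [Field K] [Field C] [Algebra k K] [Algebra k C] (f : K →ₐ[k] C)
    (hs : @Algebra.IsSeparable K C _ _ f.toRingHom.toAlgebra) (x : ι → K) (hx : IntermediateField.adjoin k (Set.range x) = ⊤) (a : C) :
    IsSeparable (IntermediateField.adjoin k (Set.range fun i => f (x i))) a := by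
  have hle : ∀ z : K, f z ∈ IntermediateField.adjoin k (Set.range fun i => f (x i)) := by
    intro z
    have h1 : f z ∈ (IntermediateField.adjoin k (Set.range x)).map f := ⟨z, by rw [hx]; trivial, rfl⟩
    rw [adjoin_map, ← Set.range_comp] at h1
    exact h1
  let _ : Algebra K C := f.toRingHom.toAlgebra
  let φ : K →+* IntermediateField.adjoin k (Set.range fun i => f (x i)) := f.toRingHom.codRestrict _ hle
  let _ : Algebra K (IntermediateField.adjoin k (Set.range fun i => f (x i))) := φ.toAlgebra
  have : IsScalarTower K (IntermediateField.adjoin k (Set.range fun i => f (x i))) C := IsScalarTower.of_algebraMap_eq fun _ => rfl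
  exact (Algebra.IsSeparable.isSeparable K a).tower_top _

lemma main_abs {k K : Type u} [Field k] [Field K] [Algebra k K] (N c : ℕ) (hcN : c ≤ N - 1) (hdim1 : 1 ≤ N - c)
    (d : Fin c → ℕ) (f : Fin c → MvPolynomial (Fin (N + 1)) k)
    (hhom : ∀ i, (f i).IsHomogeneous (d i)) (hdeg : N + 1 ≤ ∑ i, d i)
    (hsmooth : ∀ a : Fin (N + 1) → AlgebraicClosure k, a ≠ 0 →
      (∀ i, MvPolynomial.eval a
          (MvPolynomial.map (algebraMap k (AlgebraicClosure k)) (f i)) = 0) →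
      (Matrix.of fun (i : Fin c) (j : Fin (N + 1)) =>
          MvPolynomial.eval a (MvPolynomial.pderiv j
            (MvPolynomial.map (algebraMap k (AlgebraicClosure k)) (f i)))).rank = c)
    (x : Fin (N + 1) → K) (hx : IntermediateField.adjoin k (Set.range x) = ⊤) (j : Fin (N + 1)) (hxj : x j = 1)
    (hfx : ∀ i, MvPolynomial.aeval x (f i) = 0) (htr : ((N - c : ℕ) : Cardinal) ≤ Algebra.trdeg k K) :
    ((∑ i, d i : ℤ)) - N + 1 ≤ (scvg k K : ℤ) := by
  have hne : {e : ℕ | 0 < e ∧ HasSepCvgDiagram k K e}.Nonempty :=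
    exists_diagram (Set.range x) hx (le_trans (by exact_mod_cast hdim1) htr)
  obtain ⟨he0, B, C, _, _, _, _, hB, hC, φ, π, hfin, hsep, hrk⟩ := Nat.sInf_mem hne
  change 0 < scvg k K at he0
  change _ = scvg k K at hrk
  by_contra hlt
  rw [not_le] at hlt
  have hcast : (∑ i, (d i : ℤ)) = ((∑ i, d i : ℕ) : ℤ) := by push_cast; rfl
  rw [hcast] at hlt
  have hle : scvg k K + N ≤ ∑ i, d i := by omega
  let _ : Algebra (RatFunc B) C := π.toRingHom.toAlgebra
  have hrk' : Module.finrank (RatFunc B) C = scvg k K := hrk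
  have hFD : FiniteDimensional (RatFunc B) C := Module.finite_of_finrank_pos (by rw [hrk']; exact he0)
  let d' : Fin c → ℕ := fun i => if d i = 0 then 1 else d i
  have hd'1 : ∀ i, 1 ≤ d' i := fun i => by simp only [d']; split_ifs <;> omega
  have hdd' : ∀ i, d i ≤ d' i := fun i => by simp only [d']; split_ifs <;> omega
  have hhom' : ∀ i, (f i).IsHomogeneous (d' i) := by
    intro i
    by_cases h0 : d i = 0
    · have h1 := hhom i
      rw [h0] at h1
      have h2 : f i = MvPolynomial.C (MvPolynomial.coeff 0 (f i)) :=
        MvPolynomial.totalDegree_eq_zero_iff_eq_C.1 (Nat.le_zero.1 h1.totalDegree_le)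
      have h3 := hfx i
      rw [h2, MvPolynomial.aeval_C, map_eq_zero] at h3
      rw [h2, h3, map_zero]
      exact MvPolynomial.isHomogeneous_zero _ _ _
    · have : d' i = d i := by simp [d', h0]
      rw [this]; exact hhom i
  have hsum : ∑ i, d i ≤ ∑ i, d' i := Finset.sum_le_sum fun i _ => hdd' i
  have hsum2 : ∑ i, (d' i - 1) + c = ∑ i, d' i := by
    have : ∑ i, (d' i - 1) + ∑ i : Fin c, 1 = ∑ i, d' i := by
      rw [← Finset.sum_add_distrib]
      exact Finset.sum_congr rfl fun i _ => Nat.sub_add_cancel (hd'1 i)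
    simpa using this
  have hkC : ∀ a, algebraMap k C a = algebraMap (RatFunc B) C (algebraMap B (RatFunc B) (algebraMap k B a)) := by
    intro a
    have h1 : π (algebraMap k (RatFunc B) a) = algebraMap k C a := π.commutes a
    rw [← h1]
    rfl
  refine red2 (k := k) (B := B) (P := RatFunc B) (C := C) (ι := Fin (N + 1)) hkC hB RatFunc.X RatFunc.transcendental_X RatFunc.adjoin_X (c := c) (n := N - c) hdim1
    (by rw [Fintype.card_fin]; omega) (d := d') (f := f) hhom' hsmooth (fun i => φ (x i)) ?_ j (by rw [hxj, map_one]) (sep_transfer φ hsep x hx)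
    (s := ∑ i, d' i - N - 1) (by omega) (by rw [hrk']; omega) ?_
  · intro i
    have h1 : MvPolynomial.aeval (fun i => φ (x i)) (f i) = φ (MvPolynomial.aeval x (f i)) := by
      exact (MvPolynomial.comp_aeval_apply x φ (f i)).symm
    rw [h1, hfx, map_zero]
  · have h1 : Algebra.trdeg k K ≤ Algebra.trdeg k C := trdeg_le_of_injective φ φ.injective
    have h2 : IsScalarTower k (RatFunc B) C := IsScalarTower.of_algebraMap_eq hkC
    have h3 := trdeg_add_eq k (RatFunc B) (A := C)
    rw [trdeg_eq_zero (R := RatFunc B), add_zero] at h3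
    have h4 := trdeg_add_eq k B (A := RatFunc B)
    have h5 := trdeg_simple_le_one (F := B) (M := RatFunc B) RatFunc.X RatFunc.adjoin_X
    refine htr.trans (h1.trans ?_)
    rw [← h3, ← h4]
    exact add_le_add le_rfl h5

lemma frac_adjoin_top {k R Fr : Type*} [Field k] [CommRing R] [IsDomain R] [Field Fr] [Algebra R Fr] [IsFractionRing R Fr] [Algebra k Fr] (n : ℕ)
    (q : MvPolynomial (Fin n) k →+* R) (hq : Function.Surjective q)
    (g : MvPolynomial (Fin n) k →ₐ[k] Fr) (hg : ∀ p, g p = algebraMap R Fr (q p)) :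
    IntermediateField.adjoin k (Set.range fun i => g (MvPolynomial.X i)) = ⊤ := by
  have hmem : ∀ p, g p ∈ IntermediateField.adjoin k (Set.range fun i => g (MvPolynomial.X i)) := by
    intro p
    have h := aeval_mem_adjoin (fun i => g (MvPolynomial.X i)) p
    have h2 : MvPolynomial.aeval (fun i => g (MvPolynomial.X i)) p = g p :=
      (DFunLike.congr_fun (MvPolynomial.aeval_unique g) p).symm
    rwa [h2] at h
  rw [eq_top_iff]
  intro a _
  obtain ⟨a, b, hb, rfl⟩ := IsFractionRing.div_surjective (A := R) a
  obtain ⟨a, rfl⟩ := hq a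
  obtain ⟨b, rfl⟩ := hq b
  rw [← hg, ← hg]
  exact div_mem (hmem a) (hmem b)

end MAIN

end

/-- A smooth geometrically integral complete intersection `X ⊆ ℙ^N_k` of hypersurfaces of
degrees `d_1, …, d_c` with `d_1 + ⋯ + d_c ≥ N + 1` has
`scvg_k(K(X)) ≥ d_1 + ⋯ + d_c − N + 1`. -/
theorem stmt0 (k : Type u) [Field k] (N c : ℕ) (hN : 0 < N) (hc : 0 < c) (hcN : c ≤ N - 1)
    (d : Fin c → ℕ) (f : Fin c → MvPolynomial (Fin (N + 1)) k)
    (hhom : ∀ i, (f i).IsHomogeneous (d i))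
    (hdeg : N + 1 ≤ ∑ i, d i)
    -- `X` is integral (part of geometric integrality): the homogeneous ideal of `X` is prime
    [hI : (Ideal.span (Set.range f)).IsPrime]
    -- `X` is geometrically integral: over the algebraic closure the ideal is still prime
    (hgeom : (Ideal.span (Set.range fun i =>
        MvPolynomial.map (algebraMap k (AlgebraicClosure k)) (f i))).IsPrime)
    -- `X` has dimension `N - c ≥ 1`: the affine cone over `k̄` has Krull dimension `N - c + 1`
    (hdim1 : 1 ≤ N - c)
    (hdim : ringKrullDim (MvPolynomial (Fin (N + 1)) (AlgebraicClosure k) ⧸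
        Ideal.span (Set.range fun i =>
          MvPolynomial.map (algebraMap k (AlgebraicClosure k)) (f i)))
      = ((N - c + 1 : ℕ) : WithBot ℕ∞))
    -- `X` is smooth over `k`: the Jacobian criterion at every geometric point of the cone
    (hsmooth : ∀ a : Fin (N + 1) → AlgebraicClosure k, a ≠ 0 →
      (∀ i, MvPolynomial.eval a
          (MvPolynomial.map (algebraMap k (AlgebraicClosure k)) (f i)) = 0) →
      (Matrix.of fun (i : Fin c) (j : Fin (N + 1)) =>
          MvPolynomial.eval a (MvPolynomial.pderiv j
            (MvPolynomial.map (algebraMap k (AlgebraicClosure k)) (f i)))).rank = c) :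
    ((∑ i, d i : ℤ)) - N + 1 ≤
      (scvg k ↥(projFunctionField k (N + 1) (Ideal.span (Set.range f))) : ℤ) := by
  have hlow := trdeg_cone f hgeom (N - c + 1) hdim
  let R := MvPolynomial (Fin (N + 1)) k ⧸ Ideal.span (Set.range f)
  let Fr := FractionRing R
  let g : MvPolynomial (Fin (N + 1)) k →ₐ[k] Fr := (IsScalarTower.toAlgHom k R Fr).comp (Ideal.Quotient.mkₐ k (Ideal.span (Set.range f)))
  have hg : ∀ p, g p = algebraMap R Fr (Ideal.Quotient.mk _ p) := fun p => rfl
  have hFr : ((N - c + 1 : ℕ) : Cardinal) ≤ Algebra.trdeg k Fr :=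
    hlow.trans (trdeg_le_of_injective (IsScalarTower.toAlgHom k R Fr) (IsFractionRing.injective R Fr))
  let y : Fin (N + 1) → Fr := fun i => g (MvPolynomial.X i)
  have htop : IntermediateField.adjoin k (Set.range y) = ⊤ := frac_adjoin_top (R := R) (N + 1) (Ideal.Quotient.mk _) Ideal.Quotient.mk_surjective g hg
  have hgy : ∀ p, g p = MvPolynomial.aeval y p := by
    intro p
    rw [MvPolynomial.aeval_unique g]; rfl
  obtain ⟨j, hj⟩ := ff_exists y htop (le_trans (by exact_mod_cast Nat.le_add_left 1 (N - c)) hFr)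
  have hK : projFunctionField k (N + 1) (Ideal.span (Set.range f)) = IntermediateField.adjoin k (Set.range fun i => y i / y j) := by
    rw [← ff_adjoin y j hj]
    simp only [← hgy]
    rfl
  have hyK : ∀ i, y i / y j ∈ projFunctionField k (N + 1) (Ideal.span (Set.range f)) := by
    intro i
    rw [hK]
    exact IntermediateField.subset_adjoin _ _ ⟨i, rfl⟩
  have htr := ff_trdeg y j hj htop _ hyK
  have htr2 : ((N - c : ℕ) : Cardinal) ≤ Algebra.trdeg k (projFunctionField k (N + 1) (Ideal.span (Set.range f))) := by
    have h1 := hFr.trans htr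
    rw [Nat.cast_add, Nat.cast_one] at h1
    exact Cardinal.add_one_le_add_one_iff.1 h1
  refine main_abs N c hcN hdim1 d f hhom hdeg hsmooth (fun i => ⟨y i / y j, hyK i⟩) ?_ j ?_ ?_ htr2
  · apply IntermediateField.lift_injective (projFunctionField k (N + 1) (Ideal.span (Set.range f)))
    rw [IntermediateField.lift_adjoin, IntermediateField.lift_top, ← Set.range_comp]
    exact hK.symm
  · exact Subtype.ext (div_self hj)
  · intro i
    have h1 := ff_homog y j hj (hhom i)
    have h2 : MvPolynomial.aeval y (f i) = 0 := by
      have h5 : Ideal.Quotient.mk (Ideal.span (Set.range f)) (f i) = 0 := Ideal.Quotient.eq_zero_iff_mem.2 (Ideal.subset_span ⟨i, rfl⟩)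
      rw [← hgy, hg, h5, map_zero]
    rw [h2] at h1
    have h3 := (mul_eq_zero.1 h1.symm).resolve_left (pow_ne_zero _ hj)
    apply Subtype.ext
    have h4 := MvPolynomial.comp_aeval_apply (fun i => (⟨y i / y j, hyK i⟩ : projFunctionField k (N + 1) (Ideal.span (Set.range f)))) (projFunctionField k (N + 1) (Ideal.span (Set.range f))).val (f i)
    exact h4.trans h3
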